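/- Let p be a prime, n ≥ 1 an integer, and ε ∈ ℤ. Let f : ℚ_p → ℚ_p be a definable function and set D = {x ∈ ℚ_p : x ≠ 0, v(x) ≥ ε, x ∈ P_n}. Assume f x ≠ 0 for every x ∈ D. Then there exist an integer δ ≥ ε, a positive multiple m of n, and integers a ∈ ℤ, b ≥ 1, γ₀ ∈ ℤ such that for every x with x ≠ 0, v(x) ≥ δ, and x ∈ P_m one has b · v(f x) = a · v(x) + b · γ₀ (i.e. v(f x) = q · v(x) + γ₀ with q = a/b). -/

import Mathlib

open FirstOrder Filter Topology

/-- The ring-language structure on `ℚ_[p]`. -/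
noncomputable instance (p : ℕ) [Fact p.Prime] : FirstOrder.Language.ring.Structure ℚ_[p] :=
  (FirstOrder.Ring.compatibleRingOfRing ℚ_[p]).toStructure

namespace PadicQE

variable {p : ℕ} [Fact p.Prime]

/-- `x` is a nonzero `n`-th power. -/
def IsPow (n : ℕ) (x : ℚ_[p]) : Prop := x ≠ 0 ∧ ∃ y, y ^ n = x

/-- `a` and `b` agree up to a factor congruent to `1` modulo `p ^ e`. -/
def Near (e : ℕ) (a b : ℚ_[p]) : Prop := ‖a - b‖ ≤ ‖(p : ℚ_[p]) ^ e * b‖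

lemma p_ne_zero : (p : ℚ_[p]) ≠ 0 := by
  exact_mod_cast (Fact.out : p.Prime).ne_zero

lemma norm_p_lt_one : ‖(p : ℚ_[p])‖ < 1 := Padic.norm_p_lt_one

lemma norm_pow_p_le {e e' : ℕ} (h : e ≤ e') : ‖(p : ℚ_[p]) ^ e'‖ ≤ ‖(p : ℚ_[p]) ^ e‖ := by
  rw [norm_pow, norm_pow]
  exact pow_le_pow_of_le_one (norm_nonneg _) norm_p_lt_one.le h

lemma norm_pow_p_le_one (e : ℕ) : ‖(p : ℚ_[p]) ^ e‖ ≤ 1 := by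
  simpa using norm_pow_p_le (p := p) (Nat.zero_le e)

lemma norm_pow_p_lt_one {e : ℕ} (he : 1 ≤ e) : ‖(p : ℚ_[p]) ^ e‖ < 1 :=
  (norm_pow_p_le he).trans_lt (by simpa using norm_p_lt_one (p := p))

lemma norm_pow_p_pos (e : ℕ) : 0 < ‖(p : ℚ_[p]) ^ e‖ :=
  norm_pos_iff.2 (pow_ne_zero _ p_ne_zero)

lemma norm_sub_le_max' (a b : ℚ_[p]) : ‖a - b‖ ≤ max ‖a‖ ‖b‖ := by
  simpa [sub_eq_add_neg] using IsUltrametricDist.norm_add_le_max a (-b)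

lemma norm_add_le_of_le {a b : ℚ_[p]} {r : ℝ} (ha : ‖a‖ ≤ r) (hb : ‖b‖ ≤ r) : ‖a + b‖ ≤ r :=
  (IsUltrametricDist.norm_add_le_max a b).trans (max_le ha hb)

lemma norm_sub_le_of_le {a b : ℚ_[p]} {r : ℝ} (ha : ‖a‖ ≤ r) (hb : ‖b‖ ≤ r) : ‖a - b‖ ≤ r :=
  (norm_sub_le_max' a b).trans (max_le ha hb)

lemma norm_eq_of_sub_lt {a b : ℚ_[p]} (h : ‖a - b‖ < ‖b‖) : ‖a‖ = ‖b‖ := by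
  have := IsUltrametricDist.norm_add_eq_max_of_norm_ne_norm h.ne
  rw [sub_add_cancel, max_eq_right h.le] at this
  exact this

/-- The norm on `ℚ_[p]` is discrete. -/
lemma norm_le_p_mul_of_lt {a b : ℚ_[p]} (h : ‖a‖ < ‖b‖) : ‖a‖ ≤ ‖(p : ℚ_[p]) * b‖ := by
  have hb : b ≠ 0 := norm_pos_iff.1 ((norm_nonneg _).trans_lt h)
  have h1 : ‖a / b‖ < 1 := by
    rw [norm_div, div_lt_one (norm_pos_iff.2 hb)]; exact h
  have h2 : ‖a / b‖ ≤ ‖(p : ℚ_[p])‖ := by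
    have := (Padic.norm_le_pow_iff_norm_lt_pow_add_one (a / b) (-1)).2 (by simpa using h1)
    simpa using this
  rw [norm_div, div_le_iff₀ (norm_pos_iff.2 hb)] at h2
  rwa [norm_mul]

namespace Near

lemma refl (e : ℕ) (a : ℚ_[p]) : Near e a a := by
  unfold Near; rw [sub_self, norm_zero]; exact norm_nonneg _

lemma mono {e e' : ℕ} {a b : ℚ_[p]} (h : Near e' a b) (he : e ≤ e') : Near e a b := by
  refine le_trans h ?_
  rw [norm_mul, norm_mul]
  exact mul_le_mul_of_nonneg_right (norm_pow_p_le he) (norm_nonneg _)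

lemma norm_eq {e : ℕ} {a b : ℚ_[p]} (h : Near e a b) (he : 1 ≤ e) : ‖a‖ = ‖b‖ := by
  by_cases hb : b = 0
  · subst hb
    have : ‖a‖ ≤ 0 := by simpa [Near] using h
    simp [le_antisymm this (norm_nonneg _)]
  · apply norm_eq_of_sub_lt
    refine lt_of_le_of_lt h ?_
    rw [norm_mul]
    exact mul_lt_of_lt_one_left (norm_pos_iff.2 hb) (norm_pow_p_lt_one he)

lemma eq_zero_iff {e : ℕ} {a b : ℚ_[p]} (h : Near e a b) (he : 1 ≤ e) : a = 0 ↔ b = 0 := by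
  rw [← norm_eq_zero, h.norm_eq he, norm_eq_zero]

lemma symm {e : ℕ} {a b : ℚ_[p]} (h : Near e a b) (he : 1 ≤ e) : Near e b a := by
  have h0 := h.norm_eq he
  unfold Near at *
  rw [norm_mul, h0, ← norm_mul, norm_sub_rev]
  exact h

lemma trans {e : ℕ} {a b c : ℚ_[p]} (h : Near e a b) (h' : Near e b c) (he : 1 ≤ e) :
    Near e a c := by
  have : a - c = (a - b) + (b - c) := by ring
  have h0 := h'.norm_eq he
  unfold Near at *
  rw [this]
  refine norm_add_le_of_le ?_ h'
  rw [norm_mul, ← h0, ← norm_mul]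
  exact h

lemma mul {e : ℕ} {a b c d : ℚ_[p]} (h : Near e a b) (h' : Near e c d) (he : 1 ≤ e) :
    Near e (a * c) (b * d) := by
  have h1 : Near e (a * c) (b * c) := by
    unfold Near at *
    rw [← sub_mul, ← mul_assoc, norm_mul, norm_mul _ c]
    exact mul_le_mul_of_nonneg_right h (norm_nonneg _)
  have h2 : Near e (b * c) (b * d) := by
    unfold Near at *
    rw [← mul_sub, mul_left_comm, norm_mul, norm_mul b]
    exact mul_le_mul_of_nonneg_left h' (norm_nonneg _)
  exact h1.trans h2 he

lemma pow {e : ℕ} {a b : ℚ_[p]} (h : Near e a b) (he : 1 ≤ e) (n : ℕ) :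
    Near e (a ^ n) (b ^ n) := by
  induction n with
  | zero => simpa using Near.refl e 1
  | succ n ih => rw [pow_succ, pow_succ]; exact ih.mul h he

lemma mul_left {e : ℕ} {a b : ℚ_[p]} (c : ℚ_[p]) (h : Near e a b) (he : 1 ≤ e) :
    Near e (c * a) (c * b) := (Near.refl e c).mul h he

lemma add_right_of_le {e : ℕ} {a b : ℚ_[p]} (h : ‖b‖ ≤ ‖(p : ℚ_[p]) ^ e * a‖) :
    Near e (a + b) a := by
  simpa [Near] using h

end Near

/-! ### Powers -/

lemma IsPow.mul {n : ℕ} {a b : ℚ_[p]} (ha : IsPow n a) (hb : IsPow n b) : IsPow n (a * b) := by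
  obtain ⟨ha0, u, rfl⟩ := ha
  obtain ⟨hb0, v, rfl⟩ := hb
  exact ⟨mul_ne_zero ha0 hb0, u * v, mul_pow _ _ _⟩

lemma IsPow.inv {n : ℕ} {a : ℚ_[p]} (ha : IsPow n a) : IsPow n a⁻¹ := by
  obtain ⟨ha0, u, rfl⟩ := ha
  exact ⟨inv_ne_zero ha0, u⁻¹, inv_pow _ _⟩

lemma IsPow.pow {n : ℕ} {a : ℚ_[p]} (ha : IsPow n a) (k : ℕ) : IsPow n (a ^ k) := by
  obtain ⟨ha0, u, rfl⟩ := ha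
  exact ⟨pow_ne_zero _ ha0, u ^ k, pow_right_comm _ _ _⟩

lemma isPow_pow {a : ℚ_[p]} (ha : a ≠ 0) (n : ℕ) : IsPow n (a ^ n) :=
  ⟨pow_ne_zero _ ha, a, rfl⟩

lemma isPow_pow_of_dvd {a : ℚ_[p]} (ha : a ≠ 0) {n m : ℕ} (h : n ∣ m) : IsPow n (a ^ m) := by
  obtain ⟨k, rfl⟩ := h
  exact ⟨pow_ne_zero _ ha, a ^ k, by rw [← pow_mul, mul_comm]⟩

lemma isPow_mul_iff {n : ℕ} {a b : ℚ_[p]} (ha : IsPow n a) : IsPow n (a * b) ↔ IsPow n b := by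
  refine ⟨fun h => ?_, ha.mul⟩
  have := ha.inv.mul h
  rwa [inv_mul_cancel_left₀ ha.1] at this

lemma IsPow.of_dvd {n m : ℕ} {a : ℚ_[p]} (h : IsPow m a) (hd : n ∣ m) : IsPow n a := by
  obtain ⟨k, rfl⟩ := hd
  obtain ⟨ha0, u, rfl⟩ := h
  exact ⟨ha0, u ^ k, by rw [← pow_mul, mul_comm]⟩

lemma isPow_one_iff {a : ℚ_[p]} : IsPow 1 a ↔ a ≠ 0 := by simp [IsPow]

lemma exists_pow_norm_lt {r : ℝ} (hr : 0 < r) : ∃ e : ℕ, ‖(p : ℚ_[p]) ^ e‖ < r := by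
  obtain ⟨e, he⟩ := exists_pow_lt_of_lt_one hr (norm_p_lt_one (p := p))
  exact ⟨e, by rwa [norm_pow]⟩

lemma exists_root_of_norm_sub_one_lt (n : ℕ) {u : ℚ_[p]} (hu1 : ‖u‖ ≤ 1)
    (hu : ‖u - 1‖ < ‖(n : ℚ_[p])‖ ^ 2) : ∃ v, v ^ n = u := by
  obtain ⟨U, rfl⟩ : ∃ U : ℤ_[p], (U : ℚ_[p]) = u := ⟨⟨u, hu1⟩, rfl⟩
  obtain ⟨z, hz, -⟩ := hensels_lemma (p := p) (R := ℤ_[p])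
    (F := Polynomial.X ^ n - Polynomial.C U) (a := 1) (by
      have h2 : ‖(1 : ℤ_[p]) - U‖ < ‖(n : ℤ_[p])‖ ^ 2 := by
        rw [norm_sub_rev, PadicInt.norm_def, PadicInt.norm_def]
        push_cast
        exact hu
      simpa [Polynomial.derivative_X_pow] using h2)
  refine ⟨z, ?_⟩
  have h3 : z ^ n = U := by simpa [sub_eq_zero] using hz
  simpa using congrArg (fun x : ℤ_[p] => (x : ℚ_[p])) h3

lemma exists_isPow_of_near_one (n : ℕ) (hn : 0 < n) :
    ∃ e : ℕ, 1 ≤ e ∧ ∀ u : ℚ_[p], Near e u 1 → ∃ v, v ^ n = u := by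
  have hn0 : (0 : ℝ) < ‖(n : ℚ_[p])‖ ^ 2 := by
    have : (n : ℚ_[p]) ≠ 0 := by exact_mod_cast hn.ne'
    positivity
  obtain ⟨e, he⟩ := exists_pow_norm_lt (p := p) hn0
  refine ⟨e + 1, by omega, fun u hu => ?_⟩
  have hu1 : ‖u‖ = 1 := by simpa using hu.norm_eq (by omega)
  have hu2 : ‖u - 1‖ < ‖(n : ℚ_[p])‖ ^ 2 := by
    refine (hu.mono (Nat.le_succ e)).trans_lt ?_
    simpa using he
  exact exists_root_of_norm_sub_one_lt n hu1.le hu2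

lemma exists_isPow_congr (n : ℕ) (hn : 0 < n) :
    ∃ e₀ : ℕ, 1 ≤ e₀ ∧ ∀ e, e₀ ≤ e → ∀ a b : ℚ_[p], Near e a b → (IsPow n a ↔ IsPow n b) := by
  obtain ⟨e₀, h1, h⟩ := exists_isPow_of_near_one (p := p) n hn
  refine ⟨e₀, h1, fun e he a b hab => ?_⟩
  by_cases hb : b = 0
  · rw [hb, (hab.eq_zero_iff (h1.trans he)).2 hb]
  have hn1 : Near e₀ (a * b⁻¹) 1 := by
    have := (hab.mono he).mul (Near.refl e₀ b⁻¹) h1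
    rwa [mul_inv_cancel₀ hb] at this
  have hp : IsPow n (a * b⁻¹) :=
    ⟨mul_ne_zero (fun h => hb ((hab.eq_zero_iff (h1.trans he)).1 h)) (inv_ne_zero hb), h _ hn1⟩
  have : a = (a * b⁻¹) * b := by field_simp
  rw [this, isPow_mul_iff hp]

/-- Finite sets of representatives of `ℤ_p` modulo `p ^ e`. -/
lemma exists_int_reps (e : ℕ) : ∃ R : Finset ℚ_[p], (∀ r ∈ R, ‖r‖ ≤ 1) ∧
    ∀ z : ℚ_[p], ‖z‖ ≤ 1 → ∃ r ∈ R, ‖z - r‖ ≤ ‖(p : ℚ_[p]) ^ e‖ := by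
  classical
  refine ⟨(Finset.range (p ^ e)).image (fun k : ℕ => (k : ℚ_[p])), ?_, fun z hz => ?_⟩
  · simp only [Finset.mem_image, Finset.mem_range, forall_exists_index, and_imp]
    rintro _ k - rfl
    exact_mod_cast Padic.norm_int_le_one (p := p) k
  · obtain ⟨Z, rfl⟩ : ∃ Z : ℤ_[p], (Z : ℚ_[p]) = z := ⟨⟨z, hz⟩, rfl⟩
    have h1 := PadicInt.appr_spec e Z
    rw [← PadicInt.norm_le_pow_iff_mem_span_pow] at h1
    refine ⟨(Z.appr e : ℕ), Finset.mem_image_of_mem _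
      (Finset.mem_range.2 (PadicInt.appr_lt _ _)), ?_⟩
    rw [Padic.norm_p_pow]
    rw [PadicInt.norm_def] at h1
    simpa using h1

lemma norm_eq_zpow (x : ℚ_[p]) (hx : x ≠ 0) : ‖x‖ = ‖(p : ℚ_[p])‖ ^ x.valuation := by
  rw [Padic.norm_eq_zpow_neg_valuation hx, Padic.norm_p, inv_zpow, zpow_neg]

/-- Finite sets of representatives of units modulo `n`-th powers. -/
lemma exists_unit_reps (n : ℕ) (hn : 0 < n) : ∃ R : Finset ℚ_[p], (∀ r ∈ R, ‖r‖ = 1) ∧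
    ∀ u : ℚ_[p], ‖u‖ = 1 → ∃ r ∈ R, IsPow n (r * u) := by
  classical
  obtain ⟨e, he1, he⟩ := exists_isPow_congr (p := p) n hn
  obtain ⟨R, -, hR⟩ := exists_int_reps (p := p) e
  refine ⟨R.filter (fun r => ‖r‖ = 1), fun r hr => (Finset.mem_filter.1 hr).2, fun u hu => ?_⟩
  have hu0 : u ≠ 0 := by rintro rfl; simp at hu
  obtain ⟨r, hr, hru⟩ := hR u⁻¹ (by simp [hu])
  have h1 : Near e r u⁻¹ := by
    unfold Near; rw [norm_sub_rev, norm_mul, norm_inv, hu]; simpa using hru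
  refine ⟨r, Finset.mem_filter.2 ⟨hr, by rw [h1.norm_eq he1]; simp [hu]⟩, ?_⟩
  have h2 : Near e (r * u) 1 := by
    have := h1.mul (Near.refl e u) he1
    rwa [inv_mul_cancel₀ hu0] at this
  rw [he e le_rfl _ _ h2]
  exact ⟨one_ne_zero, 1, one_pow _⟩

/-- Finite sets of representatives of `ℚ_pˣ` modulo `n`-th powers. -/
lemma exists_pow_reps (n : ℕ) (hn : 0 < n) : ∃ R : Finset ℚ_[p], (∀ r ∈ R, r ≠ 0) ∧
    ∀ x : ℚ_[p], x ≠ 0 → ∃ r ∈ R, IsPow n (r * x) := by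
  classical
  obtain ⟨R, hR1, hR⟩ := exists_unit_reps (p := p) n hn
  refine ⟨(R ×ˢ Finset.range n).image (fun q => q.1 * (p : ℚ_[p]) ^ q.2), ?_, fun x hx => ?_⟩
  · simp only [Finset.mem_image, Finset.mem_product, forall_exists_index, and_imp]
    rintro _ ⟨r, k⟩ hr - rfl
    have : r ≠ 0 := by rintro rfl; simpa using hR1 _ hr
    exact mul_ne_zero this (pow_ne_zero _ p_ne_zero)
  · set k : ℕ := ((-x.valuation) % n).toNat with hk
    have hn' : (n : ℤ) ≠ 0 := by exact_mod_cast hn.ne'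
    have hk0 : (k : ℤ) = (-x.valuation) % n := Int.toNat_of_nonneg (Int.emod_nonneg _ hn')
    have hkn : k < n := by
      have := Int.emod_lt_of_pos (-x.valuation) (by exact_mod_cast hn : (0 : ℤ) < n)
      omega
    set m : ℤ := (-x.valuation) / n with hm
    have hmk : (-x.valuation) = k + n * m := by
      rw [hk0]; exact (Int.emod_add_mul_ediv _ _).symm
    have hpp := p_ne_zero (p := p)
    obtain ⟨r, hr, hru⟩ := hR (x * (p : ℚ_[p]) ^ (-x.valuation)) (by
      rw [norm_mul, norm_zpow, norm_eq_zpow x hx, ← zpow_add₀ (norm_ne_zero_iff.2 hpp)]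
      simp)
    refine ⟨r * (p : ℚ_[p]) ^ k, Finset.mem_image.2 ⟨(r, k), by simp [hr, hkn], rfl⟩, ?_⟩
    have h3 : r * (x * (p : ℚ_[p]) ^ (-x.valuation)) =
        ((p : ℚ_[p]) ^ m) ^ n * (r * (p : ℚ_[p]) ^ k * x) := by
      rw [hmk, zpow_add₀ hpp, mul_comm (n : ℤ) m, zpow_mul]
      simp only [zpow_natCast]; ring
    rw [h3, isPow_mul_iff (isPow_pow (zpow_ne_zero _ hpp) n)] at hru
    exact hru

/-- The valuation ring is definable through squares. -/
lemma norm_le_iff_isPow (a b : ℚ_[p]) :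
    ‖a‖ ≤ ‖b‖ ↔ a = 0 ∨ IsPow 2 (b ^ 4 + (p : ℚ_[p]) ^ 3 * a ^ 4) := by
  have hpp := p_ne_zero (p := p)
  have h0 := norm_pos_iff.2 hpp
  by_cases ha : a = 0
  · simp [ha]
  simp only [ha, false_or]
  have odd_ne : ∀ c : ℚ_[p], c ^ 2 ≠ 0 → c ^ 2 = b ^ 4 + (p : ℚ_[p]) ^ 3 * a ^ 4 →
      ¬ ‖b ^ 4‖ < ‖(p : ℚ_[p]) ^ 3 * a ^ 4‖ := by
    intro c hc0 hc hlt
    have h1 : ‖c ^ 2‖ = ‖(p : ℚ_[p]) ^ 3 * a ^ 4‖ := by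
      rw [hc]; apply norm_eq_of_sub_lt; simpa using hlt
    have hc' : c ≠ 0 := by rintro rfl; simp at hc0
    rw [norm_pow, norm_mul, norm_pow, norm_pow, norm_eq_zpow c hc', norm_eq_zpow a ha,
      ← zpow_natCast, ← zpow_mul, ← zpow_natCast, ← zpow_natCast, ← zpow_mul,
      ← zpow_add₀ h0.ne'] at h1
    have := zpow_right_injective₀ h0 norm_p_lt_one.ne h1
    push_cast at this
    omega
  constructor
  · intro h
    have hb : b ≠ 0 := norm_pos_iff.1 ((norm_pos_iff.2 ha).trans_le h)
    have hq : Near 3 (b ^ 4 + (p : ℚ_[p]) ^ 3 * a ^ 4) (b ^ 4) := by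
      apply Near.add_right_of_le
      rw [norm_mul, norm_mul, norm_pow a, norm_pow b]
      gcongr
    have hne : b ^ 4 + (p : ℚ_[p]) ^ 3 * a ^ 4 ≠ 0 :=
      fun h' => pow_ne_zero 4 hb ((hq.eq_zero_iff (by norm_num)).1 h')
    refine ⟨hne, ?_⟩
    have hq1 : Near 3 ((b ^ 4 + (p : ℚ_[p]) ^ 3 * a ^ 4) * (b ^ 4)⁻¹) 1 := by
      have := hq.mul (Near.refl 3 (b ^ 4)⁻¹) (by norm_num)
      rwa [mul_inv_cancel₀ (pow_ne_zero 4 hb)] at this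
    set u := (b ^ 4 + (p : ℚ_[p]) ^ 3 * a ^ 4) * (b ^ 4)⁻¹ with hu
    have hu1 : ‖u‖ = 1 := by simpa using hq1.norm_eq (by norm_num)
    have hq2 : ‖u - 1‖ ≤ ‖(p : ℚ_[p])‖ ^ 3 := by simpa [Near] using hq1
    have hlt : ‖u - 1‖ < ‖(2 : ℚ_[p])‖ ^ 2 := by
      refine hq2.trans_lt ?_
      have h2 : ‖(p : ℚ_[p])‖ ≤ ‖(2 : ℚ_[p])‖ := by
        by_contra hcon
        push Not at hcon
        have hlt1 : ‖((2 : ℤ) : ℚ_[p])‖ < 1 := by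
          push_cast; exact hcon.trans norm_p_lt_one
        have hd := (Padic.norm_intCast_lt_one_iff).1 hlt1
        have hd' : p ∣ 2 := by exact_mod_cast hd
        have : p = 2 := (Nat.prime_dvd_prime_iff_eq Fact.out Nat.prime_two).1 hd'
        subst this
        simp at hcon
      calc ‖(p : ℚ_[p])‖ ^ 3 < ‖(p : ℚ_[p])‖ ^ 2 :=
            pow_lt_pow_right_of_lt_one₀ h0 norm_p_lt_one (by norm_num)
        _ ≤ _ := by gcongr
    obtain ⟨z, h4⟩ := exists_root_of_norm_sub_one_lt 2 hu1.le (by exact_mod_cast hlt)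
    refine ⟨z * b ^ 2, ?_⟩
    rw [mul_pow, h4, hu, ← pow_mul, inv_mul_cancel_right₀ (pow_ne_zero 4 hb)]
  · rintro ⟨hne, c, hc⟩
    by_contra hcon
    push Not at hcon
    refine odd_ne c (hc ▸ hne) hc ?_
    have h1 := norm_le_p_mul_of_lt hcon
    have h2 : ‖b ^ 4‖ ≤ ‖((p : ℚ_[p]) * a) ^ 4‖ := by
      rw [norm_pow, norm_pow]; gcongr
    refine h2.trans_lt ?_
    rw [mul_pow, norm_mul, norm_mul]
    refine mul_lt_mul_of_pos_right ?_ (norm_pos_iff.2 (pow_ne_zero 4 ha))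
    rw [norm_pow, norm_pow]
    exact pow_lt_pow_right_of_lt_one₀ h0 norm_p_lt_one (by norm_num)

/-! ### Semialgebraic predicates -/

/-- Quantifier-free definable predicates (in the sense of Macintyre) on `ℚ_[p]`-valued
sequences. -/
inductive SA : ((ℕ → ℚ_[p]) → Prop) → Prop
  | basic (Q : MvPolynomial ℕ ℚ_[p]) (n : ℕ) (hn : 0 < n) :
      SA (fun y => IsPow n (MvPolynomial.eval y Q))
  | not {B : (ℕ → ℚ_[p]) → Prop} (h : SA B) : SA (fun y => ¬ B y)
  | and {B C : (ℕ → ℚ_[p]) → Prop} (hB : SA B) (hC : SA C) : SA (fun y => B y ∧ C y)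

/-- Prepend a value to a sequence. -/
def pcons (t : ℚ_[p]) (y : ℕ → ℚ_[p]) : ℕ → ℚ_[p]
  | 0 => t
  | k + 1 => y k

@[simp] lemma pcons_zero (t : ℚ_[p]) (y : ℕ → ℚ_[p]) : pcons t y 0 = t := rfl

@[simp] lemma pcons_succ (t : ℚ_[p]) (y : ℕ → ℚ_[p]) (k : ℕ) : pcons t y (k + 1) = y k := rfl

namespace SA

variable {B C : (ℕ → ℚ_[p]) → Prop}

lemma congr (h : SA B) (hBC : ∀ y, B y ↔ C y) : SA C := by
  have : B = C := funext fun y => propext (hBC y)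
  rwa [← this]

lemma or (hB : SA B) (hC : SA C) : SA (fun y => B y ∨ C y) :=
  (hB.not.and hC.not).not.congr fun y => by tauto

lemma true : SA (fun _ : ℕ → ℚ_[p] => True) :=
  (basic 1 1 one_pos).congr fun y => by simp [isPow_one_iff]

lemma const (c : Prop) : SA (fun _ : ℕ → ℚ_[p] => c) := by
  by_cases h : c
  · exact true.congr fun y => by simp [h]
  · exact true.not.congr fun y => by simp [h]

lemma exists_finset {ι : Type*} (s : Finset ι) {P : ι → (ℕ → ℚ_[p]) → Prop}
    (h : ∀ i ∈ s, SA (P i)) : SA (fun y => ∃ i ∈ s, P i y) := by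
  classical
  induction s using Finset.induction_on with
  | empty => exact (const False).congr fun y => by simp
  | insert a s ha ih =>
    exact ((h a (by simp)).or (ih fun i hi => h i (by simp [hi]))).congr fun y => by simp

lemma forall_finset {ι : Type*} (s : Finset ι) {P : ι → (ℕ → ℚ_[p]) → Prop}
    (h : ∀ i ∈ s, SA (P i)) : SA (fun y => ∀ i ∈ s, P i y) :=
  (exists_finset s fun i hi => (h i hi).not).not.congr fun y => by push Not; rfl

lemma exists_finite {ι : Type*} {s : Set ι} (hs : s.Finite) {P : ι → (ℕ → ℚ_[p]) → Prop}
    (h : ∀ i ∈ s, SA (P i)) : SA (fun y => ∃ i ∈ s, P i y) :=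
  (exists_finset hs.toFinset (P := P) fun i hi => h i (hs.mem_toFinset.1 hi)).congr
    fun y => by simp

/-- Substitution of polynomials into a semialgebraic predicate. -/
lemma comp_poly (h : SA B) (T : ℕ → MvPolynomial ℕ ℚ_[p]) :
    SA (fun y => B fun i => MvPolynomial.eval y (T i)) := by
  induction h with
  | basic Q n hn =>
    refine (basic (MvPolynomial.bind₁ T Q) n hn).congr fun y => ?_
    have : MvPolynomial.eval y (MvPolynomial.bind₁ T Q) =
        MvPolynomial.eval (fun i => MvPolynomial.eval y (T i)) Q :=
      MvPolynomial.eval₂Hom_bind₁ _ _ _ _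
    show IsPow n _ ↔ IsPow n _
    rw [this]
  | not _ ih => exact ih.not
  | and _ _ ih1 ih2 => exact ih1.and ih2

lemma comp (h : SA B) (σ : ℕ → ℕ) : SA (fun y => B fun i => y (σ i)) :=
  (h.comp_poly fun i => MvPolynomial.X (σ i)).congr fun y => by simp

end SA

/-- The polynomial in the zeroth variable associated with `Q`. -/
noncomputable def splitPoly (Q : MvPolynomial ℕ ℚ_[p]) : Polynomial (MvPolynomial ℕ ℚ_[p]) :=
  MvPolynomial.aeval
    (fun i => Nat.casesOn i Polynomial.X fun k => Polynomial.C (MvPolynomial.X k)) Q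

lemma eval_splitPoly (Q : MvPolynomial ℕ ℚ_[p]) (t : ℚ_[p]) (y : ℕ → ℚ_[p]) :
    ((splitPoly Q).map (MvPolynomial.eval y)).eval t = MvPolynomial.eval (pcons t y) Q := by
  unfold splitPoly
  induction Q using MvPolynomial.induction_on with
  | C a =>
    simp [MvPolynomial.algebraMap_eq, IsScalarTower.algebraMap_apply ℚ_[p]
      (MvPolynomial ℕ ℚ_[p]) (Polynomial (MvPolynomial ℕ ℚ_[p]))]
  | add f g hf hg => simp [hf, hg]
  | mul_X f i hf => cases i <;> simp [hf]

/-! ### Functions which can be substituted into semialgebraic predicates -/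

/-- Functions whose substitution into semialgebraic predicates is again semialgebraic. -/
def Good (f : (ℕ → ℚ_[p]) → ℚ_[p]) : Prop :=
  ∀ (σ : ℕ → ℕ) (B : (ℕ → ℚ_[p]) → Prop), SA B →
    SA (fun y => B (pcons (f fun i => y (σ i)) y))

lemma Good.subst {f : (ℕ → ℚ_[p]) → ℚ_[p]} (hf : Good f) {B : (ℕ → ℚ_[p]) → Prop} (hB : SA B) :
    SA (fun y => B (pcons (f y) y)) := hf id B hB

lemma good_of_basic {f : (ℕ → ℚ_[p]) → ℚ_[p]}
    (h : ∀ (σ : ℕ → ℕ) (Q : MvPolynomial ℕ ℚ_[p]) (n : ℕ), 0 < n →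
      SA fun y => IsPow n (MvPolynomial.eval (pcons (f fun i => y (σ i)) y) Q)) : Good f := by
  intro σ B hB
  induction hB with
  | basic Q n hn => exact h σ Q n hn
  | not _ ih => exact ih.not
  | and _ _ ih1 ih2 => exact ih1.and ih2

lemma sa_subst_inv {B : (ℕ → ℚ_[p]) → Prop} (hB : SA B) :
    SA (fun z => B (pcons (z 0)⁻¹ fun k => z (k + 1))) := by
  induction hB with
  | basic Q n hn =>
    set R := splitPoly Q with hR
    set d := R.natDegree with hd
    have h0 : SA (fun z : ℕ → ℚ_[p] => z 0 ≠ 0) :=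
      (SA.basic (MvPolynomial.X 0) 1 one_pos).congr fun z => by simp [isPow_one_iff]
    have h1 := SA.basic (MvPolynomial.rename (fun k => k + 1) (R.coeff 0)) n hn
    have h2 := SA.basic (∑ i ∈ Finset.range (d + 1),
      MvPolynomial.rename (fun k => k + 1) (R.coeff i) * MvPolynomial.X 0 ^ (n * d - i)) n hn
    refine ((h0.not.and h1).or (h0.and h2)).congr fun z => ?_
    show _ ↔ IsPow n (MvPolynomial.eval (pcons (z 0)⁻¹ fun k => z (k + 1)) Q)
    rw [← eval_splitPoly, ← hR]
    by_cases hz : z 0 = 0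
    · simp only [hz, ne_eq, not_true_eq_false, not_false_eq_true, true_and, false_and, or_false,
        inv_zero]
      rw [← Polynomial.coeff_zero_eq_eval_zero, Polynomial.coeff_map, MvPolynomial.eval_rename]
      rfl
    · simp only [hz, ne_eq, not_true_eq_false, not_false_eq_true, true_and, false_and, false_or]
      have : MvPolynomial.eval z (∑ i ∈ Finset.range (d + 1),
          MvPolynomial.rename (fun k => k + 1) (R.coeff i) * MvPolynomial.X 0 ^ (n * d - i)) =
          z 0 ^ (n * d) * Polynomial.eval (z 0)⁻¹
            (Polynomial.map (MvPolynomial.eval fun k => z (k + 1)) R) := by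
        rw [Polynomial.eval_eq_sum_range' (n := d + 1)
          (Nat.lt_succ_of_le Polynomial.natDegree_map_le), Finset.mul_sum, map_sum]
        refine Finset.sum_congr rfl fun i hi => ?_
        have hi' : i ≤ n * d :=
          (Nat.lt_succ_iff.1 (Finset.mem_range.1 hi)).trans (Nat.le_mul_of_pos_left d hn)
        rw [map_mul, map_pow, MvPolynomial.eval_X, MvPolynomial.eval_rename, Polynomial.coeff_map,
          pow_sub₀ _ hz hi', inv_pow]
        simp only [Function.comp_def]
        ring
      rw [this, isPow_mul_iff (isPow_pow_of_dvd hz (dvd_mul_right n d))]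
  | not _ ih => exact ih.not
  | and _ _ ih1 ih2 => exact ih1.and ih2

namespace Good

variable {f g : (ℕ → ℚ_[p]) → ℚ_[p]}

lemma comp (hf : Good f) (σ : ℕ → ℕ) : Good (fun y => f fun i => y (σ i)) :=
  fun τ B hB => hf (fun i => τ (σ i)) B hB

lemma of_poly (Q : MvPolynomial ℕ ℚ_[p]) : Good (fun y => MvPolynomial.eval y Q) := by
  intro σ B hB
  refine (hB.comp_poly fun i => Nat.casesOn i (MvPolynomial.rename σ Q)
    fun k => MvPolynomial.X k).congr fun y => ?_
  apply iff_of_eq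
  congr 1
  funext i
  cases i <;> simp [MvPolynomial.eval_rename, Function.comp_def]

lemma coord (i : ℕ) : Good (fun y : ℕ → ℚ_[p] => y i) := by
  simpa using of_poly (MvPolynomial.X i : MvPolynomial ℕ ℚ_[p])

lemma const (c : ℚ_[p]) : Good (fun _ : ℕ → ℚ_[p] => c) := by
  simpa using of_poly (MvPolynomial.C c : MvPolynomial ℕ ℚ_[p])

lemma poly₂ (hf : Good f) (hg : Good g) (Q : MvPolynomial (Fin 2) ℚ_[p]) :
    Good (fun y => MvPolynomial.eval ![f y, g y] Q) := by
  intro σ B hB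
  have h1 := hB.comp_poly fun i => Nat.casesOn i
    (MvPolynomial.rename (fun j : Fin 2 => (j : ℕ)) Q) fun k => MvPolynomial.X (k + 2)
  have h2 := hf (fun i => σ i + 1) _ h1
  refine (hg σ _ h2).congr fun y => ?_
  apply iff_of_eq
  congr 1
  funext i
  cases i with
  | zero =>
    show MvPolynomial.eval _ (MvPolynomial.rename (fun j : Fin 2 => (j : ℕ)) Q) =
      MvPolynomial.eval _ Q
    rw [MvPolynomial.eval_rename]
    apply congrArg (fun z => MvPolynomial.eval z Q)
    funext j
    fin_cases j <;> rfl
  | succ k =>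
    simp only [MvPolynomial.eval_X]
    rfl

lemma add (hf : Good f) (hg : Good g) : Good (fun y => f y + g y) := by
  have h := poly₂ hf hg (MvPolynomial.X 0 + MvPolynomial.X 1)
  simp only [map_add, MvPolynomial.eval_X] at h
  exact h

lemma mul (hf : Good f) (hg : Good g) : Good (fun y => f y * g y) := by
  have h := poly₂ hf hg (MvPolynomial.X 0 * MvPolynomial.X 1)
  simp only [map_mul, MvPolynomial.eval_X] at h
  exact h

lemma neg (hf : Good f) : Good (fun y => -f y) := by
  simpa using (const (-1)).mul hf

lemma sub (hf : Good f) (hg : Good g) : Good (fun y => f y - g y) := by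
  simpa [sub_eq_add_neg] using hf.add hg.neg

lemma pow (hf : Good f) (n : ℕ) : Good (fun y => f y ^ n) := by
  induction n with
  | zero => simpa using const 1
  | succ n ih => simpa [pow_succ] using ih.mul hf

lemma sum {ι : Type*} (s : Finset ι) {F : ι → (ℕ → ℚ_[p]) → ℚ_[p]} (h : ∀ i ∈ s, Good (F i)) :
    Good (fun y => ∑ i ∈ s, F i y) := by
  classical
  induction s using Finset.induction_on with
  | empty => simpa using const 0
  | insert a s ha ih =>
    simp only [Finset.sum_insert ha]
    exact (h a (by simp)).add (ih fun i hi => h i (by simp [hi]))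

lemma inv (hf : Good f) : Good (fun y => (f y)⁻¹) := by
  intro σ B hB
  refine (hf σ _ (sa_subst_inv hB)).congr fun y => ?_
  simp only [pcons_zero, pcons_succ]

lemma div (hf : Good f) (hg : Good g) : Good (fun y => f y / g y) := by
  simpa [div_eq_mul_inv] using hf.mul hg.inv

open Classical in
lemma ite {C : (ℕ → ℚ_[p]) → Prop} (hC : SA C) (hf : Good f) (hg : Good g) :
    Good (fun y => if C y then f y else g y) := by
  intro σ B hB
  refine (((hC.comp σ).and (hf σ B hB)).or ((hC.comp σ).not.and (hg σ B hB))).congr fun y => ?_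
  by_cases h : C fun i => y (σ i) <;> simp [h]

lemma sa_isPow (hf : Good f) {n : ℕ} (hn : 0 < n) : SA (fun y => IsPow n (f y)) :=
  (hf.subst (SA.basic (MvPolynomial.X 0) n hn)).congr fun y => by simp

lemma sa_ne_zero (hf : Good f) : SA (fun y => f y ≠ 0) :=
  (hf.sa_isPow one_pos).congr fun _ => isPow_one_iff

lemma sa_eq_zero (hf : Good f) : SA (fun y => f y = 0) :=
  hf.sa_ne_zero.not.congr fun _ => not_not

lemma sa_norm_le (hf : Good f) (hg : Good g) : SA (fun y => ‖f y‖ ≤ ‖g y‖) :=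
  (hf.sa_eq_zero.or (((hg.pow 4).add ((const _).mul (hf.pow 4))).sa_isPow
    (by norm_num : 0 < 2))).congr fun _ => (norm_le_iff_isPow _ _).symm

lemma sa_norm_eq (hf : Good f) (hg : Good g) : SA (fun y => ‖f y‖ = ‖g y‖) :=
  ((hf.sa_norm_le hg).and (hg.sa_norm_le hf)).congr fun _ => le_antisymm_iff.symm

end Good

/-! ### Polynomials in one variable with good coefficients -/

/-- Families of polynomials of degree at most `d` with good coefficients. -/
structure GoodPoly (d : ℕ) (P : (ℕ → ℚ_[p]) → Polynomial ℚ_[p]) : Prop where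
  natDegree_le : ∀ y, (P y).natDegree ≤ d
  coeff : ∀ i, Good (fun y => (P y).coeff i)

lemma exists_goodPoly (Q : MvPolynomial ℕ ℚ_[p]) :
    ∃ d P, GoodPoly d P ∧ ∀ t y, (P y).eval t = MvPolynomial.eval (pcons t y) Q := by
  refine ⟨(splitPoly Q).natDegree, fun y => (splitPoly Q).map (MvPolynomial.eval y),
    ⟨fun y => Polynomial.natDegree_map_le, fun i => ?_⟩, fun t y => eval_splitPoly Q t y⟩
  simpa [Polynomial.coeff_map] using Good.of_poly ((splitPoly Q).coeff i)

namespace GoodPoly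

variable {d : ℕ} {P : (ℕ → ℚ_[p]) → Polynomial ℚ_[p]} {c ρ : (ℕ → ℚ_[p]) → ℚ_[p]}

lemma mono {d' : ℕ} (h : GoodPoly d P) (hd : d ≤ d') : GoodPoly d' P :=
  ⟨fun y => (h.natDegree_le y).trans hd, h.coeff⟩

lemma comp (h : GoodPoly d P) (σ : ℕ → ℕ) : GoodPoly d (fun y => P fun i => y (σ i)) :=
  ⟨fun _ => h.natDegree_le _, fun i => (h.coeff i).comp σ⟩

lemma eval (h : GoodPoly d P) (hc : Good c) : Good (fun y => (P y).eval (c y)) := by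
  have : (fun y => (P y).eval (c y)) =
      fun y => ∑ i ∈ Finset.range (d + 1), (P y).coeff i * c y ^ i := by
    funext y
    exact Polynomial.eval_eq_sum_range' (Nat.lt_succ_of_le (h.natDegree_le y)) _
  rw [this]
  exact Good.sum _ fun i _ => (h.coeff i).mul (hc.pow i)

lemma derivative (h : GoodPoly (d + 1) P) : GoodPoly d (fun y => (P y).derivative) := by
  refine ⟨fun y => ?_, fun i => ?_⟩
  · have := Polynomial.natDegree_derivative_le (P y)
    have := h.natDegree_le y
    omega
  · simp only [Polynomial.coeff_derivative]
    exact (h.coeff _).mul (Good.const _)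

lemma taylor (h : GoodPoly d P) (hc : Good c) :
    GoodPoly d (fun y => Polynomial.taylor (c y) (P y)) := by
  refine ⟨fun y => by rw [Polynomial.natDegree_taylor]; exact h.natDegree_le y, fun i => ?_⟩
  simp only [Polynomial.taylor_coeff]
  refine GoodPoly.eval (d := d) ⟨fun y => ?_, fun j => ?_⟩ hc
  · exact (Polynomial.natDegree_hasseDeriv_le _ _).trans
      ((Nat.sub_le _ _).trans (h.natDegree_le y))
  · simp only [Polynomial.hasseDeriv_coeff]
    exact (Good.const _).mul (h.coeff _)

lemma scale (h : GoodPoly d P) (hρ : Good ρ) :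
    GoodPoly d (fun y => (P y).comp (Polynomial.C (ρ y) * Polynomial.X)) := by
  refine ⟨fun y => ?_, fun i => ?_⟩
  · refine Polynomial.natDegree_comp_le.trans ?_
    have h1 := Polynomial.natDegree_C_mul_X_pow_le (ρ y) 1
    rw [pow_one] at h1
    have h2 := h.natDegree_le y
    nlinarith
  · simp only [Polynomial.comp_C_mul_X_coeff]
    exact (h.coeff i).mul (hρ.pow i)

end GoodPoly

lemma goodPoly_of_coeff (k : ℕ) {r : ℕ → (ℕ → ℚ_[p]) → ℚ_[p]} (h : ∀ i, Good (r i)) :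
    GoodPoly (k - 1)
      (fun y => ∑ i ∈ Finset.range k, Polynomial.C (r i y) * Polynomial.X ^ i) := by
  refine ⟨fun y => ?_, fun i => ?_⟩
  · refine Polynomial.natDegree_sum_le_of_forall_le _ _ fun i hi => ?_
    have := Finset.mem_range.1 hi
    exact (Polynomial.natDegree_C_mul_X_pow_le _ _).trans (by omega)
  · have : (fun y => (∑ i ∈ Finset.range k, Polynomial.C (r i y) * Polynomial.X ^ i).coeff i) =
        fun y => if i ∈ Finset.range k then r i y else 0 := by
      funext y
      simp [Polynomial.finsetSum_coeff, Polynomial.coeff_C_mul, Polynomial.coeff_X_pow]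
    rw [this]
    split_ifs
    · exact h i
    · exact Good.const 0

/-! ### Cells -/

/-- Cells with centre `c`, described by comparing norms of monomials in `t - c`. -/
inductive Ann (c : (ℕ → ℚ_[p]) → ℚ_[p]) : ((ℕ → ℚ_[p]) → ℚ_[p] → Prop) → Prop
  | base {B : (ℕ → ℚ_[p]) → Prop} (hB : SA B) : Ann c (fun y _ => B y)
  | mono {k a : (ℕ → ℚ_[p]) → ℚ_[p]} (hk : Good k) (ha : Good a) (i j : ℕ) :
      Ann c (fun y t => ‖k y * (t - c y) ^ i‖ ≤ ‖a y * (t - c y) ^ j‖)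
  | and {V W : (ℕ → ℚ_[p]) → ℚ_[p] → Prop} (hV : Ann c V) (hW : Ann c W) :
      Ann c (fun y t => V y t ∧ W y t)

lemma Ann.congr {c : (ℕ → ℚ_[p]) → ℚ_[p]} {V W : (ℕ → ℚ_[p]) → ℚ_[p] → Prop} (h : Ann c V)
    (hVW : ∀ y t, V y t ↔ W y t) : Ann c W := by
  have : V = W := funext fun y => funext fun t => propext (hVW y t)
  rwa [← this]

lemma Ann.ball {c k a : (ℕ → ℚ_[p]) → ℚ_[p]} (hk : Good k) (ha : Good a) :
    Ann c (fun y t => ‖k y * (t - c y)‖ ≤ ‖a y‖) :=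
  (Ann.mono hk ha 1 0).congr fun y t => by simp

lemma Ann.coball {c k a : (ℕ → ℚ_[p]) → ℚ_[p]} (hk : Good k) (ha : Good a) :
    Ann c (fun y t => ‖a y‖ ≤ ‖k y * (t - c y)‖) :=
  (Ann.mono ha hk 0 1).congr fun y t => by simp

/-- Finite coverings of `D` by cells satisfying `N`. -/
def Cov (N : ((ℕ → ℚ_[p]) → ℚ_[p]) → ((ℕ → ℚ_[p]) → ℚ_[p] → Prop) → Prop)
    (D : (ℕ → ℚ_[p]) → ℚ_[p] → Prop) : Prop :=
  ∃ S : Set (((ℕ → ℚ_[p]) → ℚ_[p]) × ((ℕ → ℚ_[p]) → ℚ_[p] → Prop)), S.Finite ∧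
    (∀ s ∈ S, N s.1 s.2) ∧ ∀ y t, D y t → ∃ s ∈ S, s.2 y t

namespace Cov

variable {N N' : ((ℕ → ℚ_[p]) → ℚ_[p]) → ((ℕ → ℚ_[p]) → ℚ_[p] → Prop) → Prop}
  {D D' : (ℕ → ℚ_[p]) → ℚ_[p] → Prop} {c : (ℕ → ℚ_[p]) → ℚ_[p]}

lemma mono (h : Cov N D) (hN : ∀ c W, N c W → N' c W) (hD : ∀ y t, D' y t → D y t) :
    Cov N' D' := by
  obtain ⟨S, hS, h1, h2⟩ := h
  exact ⟨S, hS, fun s hs => hN _ _ (h1 s hs), fun y t ht => h2 y t (hD y t ht)⟩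

lemma single (h : N c D) : Cov N D :=
  ⟨{(c, D)}, Set.finite_singleton _, by simpa using h, by simp⟩

lemma union {ι : Type*} {I : Set ι} (hI : I.Finite) {E : ι → (ℕ → ℚ_[p]) → ℚ_[p] → Prop}
    (h : ∀ i ∈ I, Cov N (E i)) (hD : ∀ y t, D y t → ∃ i ∈ I, E i y t) : Cov N D := by
  have : ∀ i : I, Cov N (E i) := fun i => h i i.2
  choose S hS h1 h2 using this
  have := hI.to_subtype
  refine ⟨⋃ i, S i, Set.finite_iUnion hS, fun s hs => ?_, fun y t ht => ?_⟩
  · obtain ⟨i, hi⟩ := Set.mem_iUnion.1 hs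
    exact h1 i s hi
  · obtain ⟨i, hi, hit⟩ := hD y t ht
    obtain ⟨s, hs, hst⟩ := h2 ⟨i, hi⟩ y t hit
    exact ⟨s, Set.mem_iUnion.2 ⟨_, hs⟩, hst⟩

lemma or (h : Cov N D) (h' : Cov N D') : Cov N (fun y t => D y t ∨ D' y t) :=
  union (I := Set.univ) (E := fun b : Bool => cond b D D') Set.finite_univ
    (by rintro (_ | _) - <;> assumption)
    (by
      rintro y t (ht | ht)
      · exact ⟨true, trivial, ht⟩
      · exact ⟨false, trivial, ht⟩)

lemma bind (h : Cov N D) (hN : ∀ c W, N c W → Cov N' W) : Cov N' D := by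
  obtain ⟨S, hS, h1, h2⟩ := h
  exact union hS (E := fun s => s.2) (fun s hs => hN _ _ (h1 s hs)) h2

end Cov

/-- On the cell `W` with centre `c`, the function `F` is a monomial in `t - c` up to factors
close to `1`. -/
def NearOn (e : ℕ) (c : (ℕ → ℚ_[p]) → ℚ_[p]) (W : (ℕ → ℚ_[p]) → ℚ_[p] → Prop)
    (F : (ℕ → ℚ_[p]) → ℚ_[p] → ℚ_[p]) : Prop :=
  ∃ h : (ℕ → ℚ_[p]) → ℚ_[p], ∃ ν : ℕ, Good h ∧
    ∀ y t, W y t → Near e (F y t) (h y * (t - c y) ^ ν)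

/-- Cells with a good centre on which all functions in `𝓕` are nearly monomial. -/
structure Nice (𝓕 : Set ((ℕ → ℚ_[p]) → ℚ_[p] → ℚ_[p])) (e : ℕ)
    (c : (ℕ → ℚ_[p]) → ℚ_[p]) (W : (ℕ → ℚ_[p]) → ℚ_[p] → Prop) : Prop where
  good : Good c
  ann : Ann c W
  nearOn : ∀ F ∈ 𝓕, NearOn e c W F

/-- Cell decomposition for polynomials of degree at most `d`. -/
def CellDec (p : ℕ) [Fact p.Prime] (d : ℕ) : Prop :=
  ∀ P : (ℕ → ℚ_[p]) → Polynomial ℚ_[p], GoodPoly d P → ∀ e, 1 ≤ e →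
    Cov (Nice {fun y t => (P y).eval t} e) (fun _ _ => True)

/-! ### Tame functions -/

/-- On `B`, norm comparisons of monomials in `φ` and power residue conditions on `φ` of
precision `e` are semialgebraic. -/
def TameAt (e : ℕ) (B : (ℕ → ℚ_[p]) → Prop) (φ : (ℕ → ℚ_[p]) → ℚ_[p]) : Prop :=
  (∀ N, 0 < N → (∀ a b : ℚ_[p], Near e a b → (IsPow N a ↔ IsPow N b)) →
    ∀ l : ℚ_[p], SA (fun y => B y ∧ IsPow N (l * φ y))) ∧
  ∀ k a : (ℕ → ℚ_[p]) → ℚ_[p], Good k → Good a → ∀ i j : ℕ,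
    SA (fun y => B y ∧ ‖k y * φ y ^ i‖ ≤ ‖a y * φ y ^ j‖)

namespace TameAt

variable {e : ℕ} {B C : (ℕ → ℚ_[p]) → Prop} {φ ψ : (ℕ → ℚ_[p]) → ℚ_[p]}

lemma of_good (hB : SA B) (hφ : Good φ) : TameAt e B φ :=
  ⟨fun _ hN _ _ => hB.and (((Good.const _).mul hφ).sa_isPow hN),
    fun _ _ hk ha i j => hB.and ((hk.mul (hφ.pow i)).sa_norm_le (ha.mul (hφ.pow j)))⟩

lemma near (h : TameAt e B ψ) (he : 1 ≤ e) (hn : ∀ y, B y → Near e (φ y) (ψ y)) :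
    TameAt e B φ := by
  refine ⟨fun N hN hc l => (h.1 N hN hc l).congr fun y => ?_,
    fun k a hk ha i j => (h.2 k a hk ha i j).congr fun y => ?_⟩
  · refine and_congr_right fun hy => (hc _ _ ((hn y hy).mul_left l he)).symm
  · refine and_congr_right fun hy => ?_
    rw [norm_mul, norm_mul, norm_mul, norm_mul, norm_pow, norm_pow, norm_pow, norm_pow,
      (hn y hy).norm_eq he]

lemma restrict (h : TameAt e B φ) (hC : SA C) : TameAt e (fun y => B y ∧ C y) φ :=
  ⟨fun N hN hc l => ((h.1 N hN hc l).and hC).congr fun y => by tauto,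
    fun k a hk ha i j => ((h.2 k a hk ha i j).and hC).congr fun y => by tauto⟩

lemma cover {ι : Type*} (s : Finset ι) {C : ι → (ℕ → ℚ_[p]) → Prop}
    (hcov : ∀ y, B y → ∃ i ∈ s, C i y) (h : ∀ i ∈ s, TameAt e (fun y => B y ∧ C i y) φ) :
    TameAt e B φ := by
  have key : ∀ X : (ℕ → ℚ_[p]) → Prop, (∀ i ∈ s, SA fun y => (B y ∧ C i y) ∧ X y) →
      SA fun y => B y ∧ X y := fun X hX => (SA.exists_finset s hX).congr fun y => by
    constructor
    · rintro ⟨i, -, ⟨h1, -⟩, h2⟩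
      exact ⟨h1, h2⟩
    · rintro ⟨h1, h2⟩
      obtain ⟨i, hi, h3⟩ := hcov y h1
      exact ⟨i, hi, ⟨h1, h3⟩, h2⟩
  exact ⟨fun N hN hc l => key _ fun i hi => (h i hi).1 N hN hc l,
    fun k a hk ha m n => key _ fun i hi => (h i hi).2 k a hk ha m n⟩

lemma cases (C : (ℕ → ℚ_[p]) → Prop) (h1 : TameAt e (fun y => B y ∧ C y) φ)
    (h2 : TameAt e (fun y => B y ∧ ¬ C y) φ) : TameAt e B φ := by
  refine cover (Finset.univ : Finset Bool) (C := fun b y => cond b (C y) (¬ C y)) ?_ ?_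
  · intro y _
    by_cases hy : C y
    · exact ⟨true, Finset.mem_univ _, hy⟩
    · exact ⟨false, Finset.mem_univ _, hy⟩
  · rintro (_ | _) -
    · exact h2
    · exact h1

end TameAt

/-- Functions which are tame at any precision. -/
def Tame (φ : (ℕ → ℚ_[p]) → ℚ_[p]) : Prop := ∀ e, 1 ≤ e → TameAt e (fun _ => True) φ

namespace Tame

variable {φ θ c : (ℕ → ℚ_[p]) → ℚ_[p]}

lemma sa_isPow (h : Tame φ) {N : ℕ} (hN : 0 < N) (l : ℚ_[p]) :
    SA (fun y => IsPow N (l * φ y)) := by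
  obtain ⟨e, he, h1⟩ := exists_isPow_congr (p := p) N hN
  exact ((h e he).1 N hN (h1 e le_rfl) l).congr fun y => by simp

lemma sa_norm_le (h : Tame φ) {k a : (ℕ → ℚ_[p]) → ℚ_[p]} (hk : Good k) (ha : Good a)
    (i j : ℕ) : SA (fun y => ‖k y * φ y ^ i‖ ≤ ‖a y * φ y ^ j‖) :=
  ((h 1 le_rfl).2 k a hk ha i j).congr fun y => by simp

lemma sa_ann (h : Tame fun y => θ y - c y) {W : (ℕ → ℚ_[p]) → ℚ_[p] → Prop} (hW : Ann c W) :
    SA (fun y => W y (θ y)) := by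
  induction hW with
  | base hB => exact hB
  | mono hk ha i j => exact h.sa_norm_le hk ha i j
  | and _ _ ih1 ih2 => exact ih1.and ih2

lemma sa_isPow_mul_pow (h : Tame φ) {g : (ℕ → ℚ_[p]) → ℚ_[p]} (hg : Good g) {N : ℕ}
    (hN : 0 < N) (ν : ℕ) : SA (fun y => IsPow N (g y * φ y ^ ν)) := by
  obtain ⟨R, hR0, hR⟩ := exists_pow_reps (p := p) N hN
  have h1 : SA fun y => φ y ≠ 0 :=
    (h.sa_isPow one_pos 1).congr fun y => by simp [isPow_one_iff]
  have h2 := (h1.not.and ((hg.mul (Good.const (0 ^ ν))).sa_isPow hN)).or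
    (SA.exists_finset R fun r _ => (h.sa_isPow hN r).and
      ((hg.mul (Good.const (r⁻¹ ^ ν))).sa_isPow hN))
  refine h2.congr fun y => ?_
  by_cases hy : φ y = 0
  · simp only [hy, ne_eq, not_true_eq_false, not_false_eq_true, true_and, mul_zero,
      or_iff_left_iff_imp, forall_exists_index, and_imp]
    exact fun r _ h => absurd rfl h.1
  · simp only [hy, ne_eq, not_false_eq_true, not_true_eq_false, false_and, false_or]
    have key : ∀ r, IsPow N (r * φ y) → r ≠ 0 →
        (IsPow N (g y * r⁻¹ ^ ν) ↔ IsPow N (g y * φ y ^ ν)) := by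
      intro r hr hr0
      rw [← isPow_mul_iff (hr.pow ν)]
      have : (r * φ y) ^ ν * (g y * r⁻¹ ^ ν) = g y * φ y ^ ν := by
        rw [mul_pow, inv_pow]
        field_simp
      rw [this]
    constructor
    · rintro ⟨r, hr, h3, h4⟩
      exact (key r h3 (hR0 r hr)).1 h4
    · intro h3
      obtain ⟨r, hr, h4⟩ := hR _ hy
      exact ⟨r, hr, h4, (key r h4 (hR0 r hr)).2 h3⟩

end Tame

/-! ### Roots of polynomials with good coefficients -/

/-- The coefficients of the remainder of `X ^ m` modulo a polynomial of degree `k` with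
coefficients `g`. -/
noncomputable def remCoeff (g : ℕ → ℚ_[p]) (k : ℕ) : ℕ → ℕ → ℚ_[p]
  | 0, i => if i = 0 then 1 else 0
  | m + 1, 0 => - remCoeff g k m (k - 1) * g 0 / g k
  | m + 1, i + 1 => remCoeff g k m i - remCoeff g k m (k - 1) * g (i + 1) / g k

lemma sum_remCoeff (g : ℕ → ℚ_[p]) (k : ℕ) (hg : g (k + 1) ≠ 0) (x : ℚ_[p])
    (hx : ∑ i ∈ Finset.range (k + 2), g i * x ^ i = 0) (m : ℕ) :
    ∑ i ∈ Finset.range (k + 1), remCoeff g (k + 1) m i * x ^ i = x ^ m := by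
  induction m with
  | zero =>
    rw [Finset.sum_eq_single 0]
    · simp [remCoeff]
    · intro i _ hi
      simp [remCoeff, hi]
    · simp
  | succ m ih =>
    rw [Finset.sum_range_succ] at hx ih
    rw [Finset.sum_range_succ'] at hx ⊢
    set r := remCoeff g (k + 1) m k with hr
    have hr' : remCoeff g (k + 1) m (k + 1 - 1) = r := rfl
    simp only [remCoeff, hr']
    rw [pow_succ, ← ih]
    have h1 : ∑ i ∈ Finset.range k, (remCoeff g (k + 1) m i - r * g (i + 1) / g (k + 1)) *
        x ^ (i + 1) = (∑ i ∈ Finset.range k, remCoeff g (k + 1) m i * x ^ i) * x -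
        r / g (k + 1) * ∑ i ∈ Finset.range k, g (i + 1) * x ^ (i + 1) := by
      rw [Finset.sum_mul, Finset.mul_sum, ← Finset.sum_sub_distrib]
      refine Finset.sum_congr rfl fun i _ => ?_
      ring
    rw [h1]
    have h2 : ∑ i ∈ Finset.range k, g (i + 1) * x ^ (i + 1) =
        - (g 0 * x ^ 0 + g (k + 1) * x ^ (k + 1)) := by linear_combination hx
    rw [h2]
    field_simp
    ring

lemma good_remCoeff {g : ℕ → (ℕ → ℚ_[p]) → ℚ_[p]} (hg : ∀ i, Good (g i)) (k m i : ℕ) :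
    Good (fun y => remCoeff (fun i => g i y) k m i) := by
  induction m generalizing i with
  | zero => simpa [remCoeff] using Good.const _
  | succ m ih =>
    cases i with
    | zero => simpa only [remCoeff] using ((ih _).neg.mul (hg 0)).div (hg k)
    | succ i => simpa only [remCoeff] using (ih _).sub (((ih _).mul (hg _)).div (hg k))

/-- A root of a polynomial of degree `d + 1` is good if all its differences with good functions
are tame. -/
lemma good_of_root {d : ℕ} (hd : CellDec p d) {G : (ℕ → ℚ_[p]) → Polynomial ℚ_[p]}
    (hG : GoodPoly (d + 1) G) (hG0 : ∀ y, G y ≠ 0) {θ : (ℕ → ℚ_[p]) → ℚ_[p]}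
    (hθ : ∀ y, (G y).eval (θ y) = 0)
    (ht : ∀ (σ : ℕ → ℕ) c, Good c → Tame fun y => θ (fun i => y (σ i)) - c y) : Good θ := by
  refine good_of_basic fun σ Q n hn => ?_
  obtain ⟨D, P, hP, hPQ⟩ := exists_goodPoly Q
  simp only [← hPQ]
  set θ' := fun y : ℕ → ℚ_[p] => θ fun i => y (σ i) with hθ'
  set g := fun i (y : ℕ → ℚ_[p]) => (G fun i => y (σ i)).coeff i with hgdef
  have hg : ∀ i, Good (g i) := (hG.comp σ).coeff
  have hsum : ∀ y, ∑ i ∈ Finset.range (d + 2), g i y * θ' y ^ i = 0 := fun y => by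
    rw [← hθ fun i => y (σ i)]
    exact (Polynomial.eval_eq_sum_range' (Nat.lt_succ_of_le (hG.natDegree_le _)) _).symm
  have hg0 : ∀ y, ∃ k ∈ Finset.range (d + 1), g (k + 1) y ≠ 0 ∧
      ∀ i ∈ Finset.range (d + 2), k + 1 < i → g i y = 0 := by
    intro y
    have h1 : (G fun i => y (σ i)).natDegree ≠ 0 := by
      intro h0
      rw [Polynomial.natDegree_eq_zero] at h0
      obtain ⟨x, hx⟩ := h0
      have := hθ fun i => y (σ i)
      rw [← hx, Polynomial.eval_C] at this
      exact hG0 (fun i => y (σ i)) (by rw [← hx, this, Polynomial.C_0])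
    obtain ⟨k, hk⟩ := Nat.exists_eq_succ_of_ne_zero h1
    have h2 := hG.natDegree_le fun i => y (σ i)
    refine ⟨k, Finset.mem_range.2 (by omega), ?_, fun i _ hi =>
      Polynomial.coeff_eq_zero_of_natDegree_lt (by omega)⟩
    have := Polynomial.leadingCoeff_ne_zero.2 (hG0 fun i => y (σ i))
    rw [Polynomial.leadingCoeff, hk] at this
    exact this
  set r := fun k i (y : ℕ → ℚ_[p]) =>
    ∑ m ∈ Finset.range (D + 1), (P y).coeff m * remCoeff (fun i => g i y) (k + 1) m i with hrdef
  have hr : ∀ k i, Good (r k i) := fun k i =>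
    Good.sum _ fun m _ => (hP.coeff m).mul (good_remCoeff hg _ _ _)
  set P' := fun k (y : ℕ → ℚ_[p]) =>
    ∑ i ∈ Finset.range (k + 1), Polynomial.C (r k i y) * Polynomial.X ^ i with hP'
  have hP'good : ∀ k ∈ Finset.range (d + 1), GoodPoly d (P' k) := fun k hk =>
    (goodPoly_of_coeff (k + 1) (hr k)).mono (by have := Finset.mem_range.1 hk; omega)
  have heval : ∀ k ∈ Finset.range (d + 1), ∀ y, g (k + 1) y ≠ 0 →
      (∀ i ∈ Finset.range (d + 2), k + 1 < i → g i y = 0) →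
      (P' k y).eval (θ' y) = (P y).eval (θ' y) := by
    intro k hk y h1 h2
    have hk' := Finset.mem_range.1 hk
    have h3 : ∑ i ∈ Finset.range (k + 2), g i y * θ' y ^ i = 0 := by
      rw [← hsum y]
      refine Finset.sum_subset (Finset.range_subset_range.2 (by omega)) fun i hi hi' => ?_
      rw [h2 i hi (by have := Finset.mem_range.not.1 hi'; omega), zero_mul]
    rw [Polynomial.eval_eq_sum_range' (Nat.lt_succ_of_le (hP.natDegree_le y))]
    simp only [hP', Polynomial.eval_finsetSum, Polynomial.eval_mul, Polynomial.eval_C,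
      Polynomial.eval_pow, Polynomial.eval_X, hrdef, Finset.sum_mul]
    rw [Finset.sum_comm]
    refine Finset.sum_congr rfl fun m _ => ?_
    rw [← sum_remCoeff (fun i => g i y) k h1 _ h3 m, Finset.mul_sum]
    exact Finset.sum_congr rfl fun i _ => mul_assoc _ _ _
  have hSA : ∀ k ∈ Finset.range (d + 1), SA fun y => IsPow n ((P' k y).eval (θ' y)) := by
    intro k hk
    obtain ⟨e, he, h1⟩ := exists_isPow_congr (p := p) n hn
    obtain ⟨S, hS, hN, hcov⟩ := hd _ (hP'good k hk) e he
    have h2 : ∀ s ∈ S, SA fun y => s.2 y (θ' y) ∧ IsPow n ((P' k y).eval (θ' y)) := by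
      intro s hs
      obtain ⟨hc, hW, hF⟩ := hN s hs
      obtain ⟨h, ν, hh, hnear⟩ := hF _ rfl
      have htame := ht σ s.1 hc
      refine ((htame.sa_ann hW).and (htame.sa_isPow_mul_pow hh hn ν)).congr fun y => ?_
      exact and_congr_right fun hy => (h1 e le_rfl _ _ (hnear y _ hy)).symm
    refine (SA.exists_finite hS h2).congr fun y => ⟨fun ⟨s, _, _, h⟩ => h, fun h => ?_⟩
    obtain ⟨s, hs, hsy⟩ := hcov y (θ' y) trivial
    exact ⟨s, hs, hsy, h⟩
  have hB : ∀ k ∈ Finset.range (d + 1), SA fun y => (g (k + 1) y ≠ 0 ∧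
      ∀ i ∈ Finset.range (d + 2), k + 1 < i → g i y = 0) ∧
      IsPow n ((P' k y).eval (θ' y)) := by
    intro k hk
    refine ((hg _).sa_ne_zero.and (SA.forall_finset _ fun i _ => ?_)).and (hSA k hk)
    by_cases hi : k + 1 < i
    · exact (hg i).sa_eq_zero.congr fun y => by simp [hi]
    · exact SA.true.congr fun y => by simp [hi]
  refine (SA.exists_finset _ hB).congr fun y => ⟨?_, fun h => ?_⟩
  · rintro ⟨k, hk, ⟨h1, h2⟩, h3⟩
    rwa [heval k hk y h1 h2] at h3
  · obtain ⟨k, hk, h1, h2⟩ := hg0 y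
    exact ⟨k, hk, ⟨h1, h2⟩, by rwa [heval k hk y h1 h2]⟩

/-! ### Henselian roots -/

lemma exists_lift {H : Polynomial ℚ_[p]} (hH : ∀ i, ‖H.coeff i‖ ≤ 1) :
    ∃ F : Polynomial ℤ_[p], F.map PadicInt.Coe.ringHom = H := by
  rw [← Polynomial.mem_lifts, Polynomial.lifts_iff_coeff_lifts]
  exact fun i => ⟨⟨H.coeff i, hH i⟩, rfl⟩

lemma norm_eval_le {H : Polynomial ℚ_[p]} {r : ℝ} (hr : 0 ≤ r) (hH : ∀ i, ‖H.coeff i‖ ≤ r)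
    {x : ℚ_[p]} (hx : ‖x‖ ≤ 1) : ‖H.eval x‖ ≤ r := by
  rw [Polynomial.eval_eq_sum_range]
  refine IsUltrametricDist.norm_sum_le_of_forall_le_of_nonneg hr fun i _ => ?_
  rw [norm_mul, norm_pow]
  exact (mul_le_mul (hH i) (pow_le_one₀ (norm_nonneg _) hx) (by positivity) hr).trans
    (mul_one r).le

lemma norm_eval_sub_le {H : Polynomial ℚ_[p]} (hH : ∀ i, ‖H.coeff i‖ ≤ 1) {x y : ℚ_[p]}
    (hx : ‖x‖ ≤ 1) (hy : ‖y‖ ≤ 1) :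
    ‖H.eval x - H.eval y - H.derivative.eval y * (x - y)‖ ≤ ‖(x - y) ^ 2‖ := by
  obtain ⟨F, rfl⟩ := exists_lift hH
  obtain ⟨X, rfl⟩ : ∃ X : ℤ_[p], (X : ℚ_[p]) = x := ⟨⟨x, hx⟩, rfl⟩
  obtain ⟨Y, rfl⟩ : ∃ Y : ℤ_[p], (Y : ℚ_[p]) = y := ⟨⟨y, hy⟩, rfl⟩
  obtain ⟨k, hk⟩ := F.binomExpansion Y (X - Y)
  rw [add_sub_cancel] at hk
  have h1 : ∀ (P : Polynomial ℤ_[p]) (Z : ℤ_[p]),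
      (P.map PadicInt.Coe.ringHom).eval (Z : ℚ_[p]) = ((P.eval Z : ℤ_[p]) : ℚ_[p]) :=
    fun P Z => Polynomial.eval_map_apply (f := PadicInt.Coe.ringHom) (p := P) Z
  rw [Polynomial.derivative_map, h1, h1, h1, hk]
  push_cast
  rw [show ∀ a b c : ℚ_[p], a + b + c - a - b = c from fun a b c => by ring, norm_mul]
  exact mul_le_of_le_one_left (norm_nonneg _) k.2

/-- Polynomials to which Hensel's lemma applies at `0`. -/
def Henselian (H : Polynomial ℚ_[p]) : Prop :=
  (H.coeff 1 = 1 ∧ ‖H.coeff 0‖ ≤ ‖(p : ℚ_[p])‖) ∧ ∀ i, 2 ≤ i → ‖H.coeff i‖ ≤ ‖(p : ℚ_[p])‖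

namespace Henselian

variable {H : Polynomial ℚ_[p]}

lemma norm_coeff_le (h : Henselian H) (i : ℕ) : ‖H.coeff i‖ ≤ 1 := by
  match i with
  | 0 => exact h.1.2.trans norm_p_lt_one.le
  | 1 => rw [h.1.1, norm_one]
  | i + 2 => exact (h.2 _ (by omega)).trans norm_p_lt_one.le

lemma norm_derivative_sub_one_le (h : Henselian H) {y : ℚ_[p]} (hy : ‖y‖ ≤ 1) :
    ‖H.derivative.eval y - 1‖ ≤ ‖(p : ℚ_[p])‖ := by
  have : H.derivative.eval y - 1 = (H.derivative - Polynomial.C 1).eval y := by simp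
  rw [this]
  refine norm_eval_le (norm_nonneg _) (fun i => ?_) hy
  rw [Polynomial.coeff_sub, Polynomial.coeff_derivative]
  cases i with
  | zero => simp [h.1.1]
  | succ i =>
    rw [Polynomial.coeff_C_succ, sub_zero, norm_mul]
    refine (mul_le_of_le_one_right (norm_nonneg _) ?_).trans (h.2 _ (by omega))
    exact_mod_cast Padic.norm_int_le_one (p := p) (i + 1 + 1 : ℤ)

lemma norm_derivative (h : Henselian H) {y : ℚ_[p]} (hy : ‖y‖ ≤ 1) :
    ‖H.derivative.eval y‖ = 1 := by
  rw [← norm_one (α := ℚ_[p])]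
  refine norm_eq_of_sub_lt ((h.norm_derivative_sub_one_le hy).trans_lt ?_)
  rw [norm_one]
  exact norm_p_lt_one

lemma exists_root (h : Henselian H) : ∃ x, ‖x‖ ≤ ‖(p : ℚ_[p])‖ ∧ H.eval x = 0 := by
  obtain ⟨F, rfl⟩ := exists_lift h.norm_coeff_le
  have h0 : ((F.eval 0 : ℤ_[p]) : ℚ_[p]) = (F.map PadicInt.Coe.ringHom).coeff 0 := by
    rw [Polynomial.coeff_map, Polynomial.coeff_zero_eq_eval_zero]; rfl
  have h1 : F.derivative.eval 0 = 1 := by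
    have : ((F.coeff 1 : ℤ_[p]) : ℚ_[p]) = 1 := by
      rw [← h.1.1, Polynomial.coeff_map]; rfl
    rw [← Polynomial.coeff_zero_eq_eval_zero, Polynomial.coeff_derivative]
    simpa using PadicInt.ext (by simpa using this)
  obtain ⟨z, hz, hz1, -⟩ := hensels_lemma (p := p) (R := ℤ_[p]) (F := F) (a := 0) (by
    simp only [Polynomial.coe_aeval_eq_eval, h1, norm_one, one_pow]
    rw [PadicInt.norm_def, h0]
    exact h.1.2.trans_lt norm_p_lt_one)
  refine ⟨z, ?_, ?_⟩
  · have : ‖(z : ℚ_[p])‖ < ‖(1 : ℚ_[p])‖ := by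
      rw [sub_zero, Polynomial.coe_aeval_eq_eval, h1, norm_one] at hz1
      rwa [norm_one, ← PadicInt.norm_def]
    simpa using norm_le_p_mul_of_lt this
  · have h2 : (F.map PadicInt.Coe.ringHom).eval (z : ℚ_[p]) = ((F.eval z : ℤ_[p]) : ℚ_[p]) :=
      Polynomial.eval_map_apply (f := PadicInt.Coe.ringHom) (p := F) z
    rw [h2, ← Polynomial.coe_aeval_eq_eval, hz]
    simp

lemma near_sub (h : Henselian H) {x y : ℚ_[p]} (hx : ‖x‖ ≤ ‖(p : ℚ_[p])‖)
    (hy : ‖y‖ ≤ ‖(p : ℚ_[p])‖) : Near 1 (H.eval x - H.eval y) (x - y) := by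
  have hx1 := hx.trans norm_p_lt_one.le
  have hy1 := hy.trans norm_p_lt_one.le
  have h1 := norm_eval_sub_le h.norm_coeff_le hx1 hy1
  unfold Near
  rw [show H.eval x - H.eval y - (x - y) = (H.eval x - H.eval y - H.derivative.eval y * (x - y)) +
    (H.derivative.eval y - 1) * (x - y) by ring]
  refine norm_add_le_of_le (h1.trans ?_) ?_
  · rw [norm_pow, norm_mul, sq, pow_one]
    exact mul_le_mul_of_nonneg_right (norm_sub_le_of_le hx hy) (norm_nonneg _)
  · rw [norm_mul, norm_mul, pow_one]
    exact mul_le_mul_of_nonneg_right (h.norm_derivative_sub_one_le hy1) (norm_nonneg _)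

lemma near_newton (h : Henselian H) {x c : ℚ_[p]} (hx : ‖x‖ ≤ 1) (hc : ‖c‖ ≤ 1)
    (h0 : H.eval x = 0) {e : ℕ} (he : 1 ≤ e) (hxc : ‖x - c‖ ≤ ‖(p : ℚ_[p]) ^ e‖) :
    Near e (x - c) (-H.eval c / H.derivative.eval c) := by
  have h1 := norm_eval_sub_le h.norm_coeff_le hx hc
  have h2 := h.norm_derivative hc
  have h3 : H.derivative.eval c ≠ 0 := norm_pos_iff.1 (h2 ▸ one_pos)
  have h4 : Near e (-H.eval c) (H.derivative.eval c * (x - c)) := by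
    unfold Near
    rw [h0, zero_sub] at h1
    refine h1.trans ?_
    rw [norm_pow, sq, norm_mul, norm_mul, h2, one_mul]
    exact mul_le_mul_of_nonneg_right hxc (norm_nonneg _)
  have h5 := (h4.mul_left (H.derivative.eval c)⁻¹ he).symm he
  rwa [inv_mul_cancel_left₀ h3, mul_comm, ← div_eq_mul_inv] at h5

end Henselian

open Classical in
/-- The root in `p ℤ_[p]` of a Henselian polynomial. -/
noncomputable def henselRoot (H : Polynomial ℚ_[p]) : ℚ_[p] :=
  if h : Henselian H then h.exists_root.choose else 0

lemma Henselian.norm_henselRoot {H : Polynomial ℚ_[p]} (h : Henselian H) :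
    ‖henselRoot H‖ ≤ ‖(p : ℚ_[p])‖ := by
  rw [henselRoot, dif_pos h]
  exact h.exists_root.choose_spec.1

lemma Henselian.eval_henselRoot {H : Polynomial ℚ_[p]} (h : Henselian H) :
    H.eval (henselRoot H) = 0 := by
  rw [henselRoot, dif_pos h]
  exact h.exists_root.choose_spec.2

lemma GoodPoly.sa_henselian {d : ℕ} {H : (ℕ → ℚ_[p]) → Polynomial ℚ_[p]} (hH : GoodPoly d H) :
    SA fun y => Henselian (H y) := by
  have h1 := (((hH.coeff 1).sub (Good.const 1)).sa_eq_zero.and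
    ((hH.coeff 0).sa_norm_le (Good.const (p : ℚ_[p])))).and
    (SA.forall_finset (Finset.Icc 2 d) fun i _ => (hH.coeff i).sa_norm_le (Good.const (p : ℚ_[p])))
  refine h1.congr fun y => and_congr (and_congr_left fun _ => sub_eq_zero) ?_
  refine ⟨fun h i hi => ?_, fun h i hi => h i (Finset.mem_Icc.1 hi).1⟩
  by_cases hid : i ≤ d
  · exact h i (Finset.mem_Icc.2 ⟨hi, hid⟩)
  · rw [Polynomial.coeff_eq_zero_of_natDegree_lt ((hH.natDegree_le y).trans_lt (not_le.1 hid)),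
      norm_zero]
    exact norm_nonneg _

lemma tame_henselRoot_sub {d : ℕ} {H : (ℕ → ℚ_[p]) → Polynomial ℚ_[p]}
    (hH : GoodPoly (d + 1) H) {c : (ℕ → ℚ_[p]) → ℚ_[p]} (hc : Good c) :
    Tame fun y => henselRoot (H y) - c y := by
  intro e he
  have hA := hH.sa_henselian
  refine TameAt.cases (fun y => Henselian (H y)) ?_ ?_
  swap
  · refine (TameAt.of_good (SA.true.and hA.not) hc.neg).near he fun y hy => ?_
    rw [henselRoot, dif_neg hy.2, zero_sub]
    exact Near.refl _ _
  obtain ⟨R, -, hR⟩ := exists_int_reps (p := p) (2 * e)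
  classical
  refine TameAt.cover (R.filter fun r => ‖r‖ ≤ ‖(p : ℚ_[p])‖)
    (C := fun r y => ‖(H y).eval r‖ ≤ ‖(p : ℚ_[p]) ^ (2 * e)‖) ?_ ?_
  · rintro y ⟨-, hy⟩
    have h1 := hy.norm_henselRoot
    obtain ⟨r, hr, h2⟩ := hR (henselRoot (H y)) (h1.trans norm_p_lt_one.le)
    have h3 : ‖r‖ ≤ ‖(p : ℚ_[p])‖ := by
      rw [← sub_sub_cancel (henselRoot (H y)) r]
      refine norm_sub_le_of_le h1 (h2.trans ?_)
      simpa using norm_pow_p_le (p := p) (show 1 ≤ 2 * e by omega)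
    refine ⟨r, Finset.mem_filter.2 ⟨hr, h3⟩, ?_⟩
    have h4 := (hy.near_sub h1 h3).norm_eq le_rfl
    rw [hy.eval_henselRoot, zero_sub, norm_neg] at h4
    rwa [h4]
  intro r hr
  have hr1 := (Finset.mem_filter.1 hr).2
  have hSA : SA fun y => (True ∧ Henselian (H y)) ∧
      ‖(H y).eval r‖ ≤ ‖(p : ℚ_[p]) ^ (2 * e)‖ :=
    (SA.true.and hA).and ((hH.eval (Good.const r)).sa_norm_le (Good.const _))
  have hdist : ∀ y, Henselian (H y) → ‖(H y).eval r‖ ≤ ‖(p : ℚ_[p]) ^ (2 * e)‖ →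
      ‖henselRoot (H y) - r‖ ≤ ‖(p : ℚ_[p]) ^ (2 * e)‖ := by
    intro y hy h
    have h4 := (hy.near_sub hy.norm_henselRoot hr1).norm_eq le_rfl
    rw [hy.eval_henselRoot, zero_sub, norm_neg] at h4
    rwa [← h4]
  have hsplit : SA fun y => ‖(p : ℚ_[p]) ^ (2 * e)‖ ≤ ‖(p : ℚ_[p]) ^ e * (r - c y)‖ :=
    (Good.const _).sa_norm_le ((Good.const _).mul ((Good.const r).sub hc))
  refine TameAt.cases (fun y => ‖(p : ℚ_[p]) ^ (2 * e)‖ ≤ ‖(p : ℚ_[p]) ^ e * (r - c y)‖) ?_ ?_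
  · refine (TameAt.of_good (hSA.and hsplit) ((Good.const r).sub hc)).near he fun y hy => ?_
    have := Near.add_right_of_le ((hdist y hy.1.1.2 hy.1.2).trans hy.2)
    rwa [add_comm, sub_add_sub_cancel] at this
  · refine (TameAt.of_good (hSA.and hsplit.not)
      ((hH.eval hc).neg.div (hH.derivative.mono (Nat.le_succ d) |>.eval hc))).near he
      fun y hy => ?_
    have h1 : ‖r - c y‖ ≤ ‖(p : ℚ_[p]) ^ e‖ := by
      have h2 := not_le.1 hy.2
      rw [two_mul, pow_add, norm_mul, norm_mul] at h2
      exact (lt_of_mul_lt_mul_left h2 (norm_nonneg _)).le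
    have h2 : ‖henselRoot (H y) - c y‖ ≤ ‖(p : ℚ_[p]) ^ e‖ := by
      rw [← sub_add_sub_cancel _ r]
      exact norm_add_le_of_le ((hdist y hy.1.1.2 hy.1.2).trans (norm_pow_p_le (by omega))) h1
    have h3 : ‖c y‖ ≤ 1 := by
      rw [← sub_sub_cancel r (c y)]
      exact norm_sub_le_of_le (hr1.trans norm_p_lt_one.le) (h1.trans (norm_pow_p_le_one e))
    exact hy.1.1.2.near_newton (hy.1.1.2.norm_henselRoot.trans norm_p_lt_one.le) h3
      hy.1.1.2.eval_henselRoot he h2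

lemma good_henselRoot {d : ℕ} (hd : CellDec p d) {H : (ℕ → ℚ_[p]) → Polynomial ℚ_[p]}
    (hH : GoodPoly (d + 1) H) : Good fun y => henselRoot (H y) := by
  classical
  have hG : GoodPoly (d + 1) fun y => if Henselian (H y) then H y else Polynomial.X := by
    refine ⟨fun y => ?_, fun i => ?_⟩
    · split_ifs
      · exact hH.natDegree_le y
      · exact Polynomial.natDegree_X_le.trans (by omega)
    · have : (fun y => (if Henselian (H y) then H y else Polynomial.X).coeff i) = fun y =>
          if Henselian (H y) then (H y).coeff i else (Polynomial.X : Polynomial ℚ_[p]).coeff i := by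
        funext y
        split_ifs <;> rfl
      rw [this]
      exact Good.ite hH.sa_henselian (hH.coeff i) (Good.const _)
  refine good_of_root hd hG (fun y => ?_) (fun y => ?_) fun σ c hc =>
    tame_henselRoot_sub (hH.comp σ) hc
  · split_ifs with h
    · intro h0
      have := h.1.1
      simp [h0] at this
    · exact Polynomial.X_ne_zero
  · split_ifs with h
    · exact h.eval_henselRoot
    · rw [henselRoot, dif_neg h, Polynomial.eval_X]

/-! ### Roots of monomials -/

lemma exists_pow_near_one (E : ℕ) : ∃ q : ℕ, 0 < q ∧
    ∀ u : ℚ_[p], ‖u‖ = 1 → ‖u ^ q - 1‖ ≤ ‖(p : ℚ_[p]) ^ E‖ := by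
  refine ⟨(p ^ E).totient, Nat.totient_pos.2 (pow_pos (Fact.out : p.Prime).pos _), fun u hu => ?_⟩
  obtain ⟨U, rfl⟩ : ∃ U : ℤ_[p], (U : ℚ_[p]) = u := ⟨⟨u, hu.le⟩, rfl⟩
  have hU : IsUnit U := PadicInt.isUnit_iff.2 hu
  have h1 : U ^ (p ^ E).totient - 1 ∈ RingHom.ker (PadicInt.toZModPow (p := p) E) := by
    obtain ⟨V, rfl⟩ := hU
    have := congrArg Units.val (ZMod.pow_totient
      (Units.map (PadicInt.toZModPow (p := p) E).toMonoidHom V))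
    rw [Units.val_pow_eq_pow_val, Units.coe_map, Units.val_one] at this
    rw [RingHom.mem_ker, map_sub, map_pow, map_one, sub_eq_zero]
    exact this
  rw [PadicInt.ker_toZModPow, ← PadicInt.norm_le_pow_iff_mem_span_pow, PadicInt.norm_def,
    zpow_neg, zpow_natCast] at h1
  rw [norm_pow, Padic.norm_p, inv_pow]
  push_cast at h1
  exact h1

lemma near_pow_sub_pow {n : ℕ} {x c : ℚ_[p]} {e : ℕ} (he : 1 ≤ e) (hn : 0 < n) (hc : c ≠ 0)
    (h : ‖x - c‖ ≤ ‖(p : ℚ_[p]) ^ e * n * c‖) :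
    Near e (x - c) ((x ^ n - c ^ n) / (n * c ^ (n - 1))) := by
  have hn0 : (n : ℚ_[p]) ≠ 0 := by exact_mod_cast hn.ne'
  have hle : ‖(p : ℚ_[p]) ^ e * n‖ ≤ 1 := by
    rw [norm_mul]
    exact mul_le_one₀ (norm_pow_p_le_one e) (norm_nonneg _)
      (by exact_mod_cast Padic.norm_int_le_one (p := p) (n : ℤ))
  set u := x / c with hu
  have hx : x = u * c := by rw [hu]; field_simp
  have h1 : ‖u - 1‖ ≤ ‖(p : ℚ_[p]) ^ e * n‖ := by
    rw [hx, show u * c - c = (u - 1) * c by ring, norm_mul, norm_mul _ c] at h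
    exact le_of_mul_le_mul_right h (norm_pos_iff.2 hc)
  have h2 : ‖u‖ ≤ 1 := by
    rw [← sub_add_cancel u 1]
    exact norm_add_le_of_le (h1.trans hle) norm_one.le
  have h3 := norm_eval_sub_le (H := Polynomial.X ^ n) (x := u) (y := 1) (fun i => by
    rw [Polynomial.coeff_X_pow]; split_ifs <;> simp) h2 norm_one.le
  simp only [Polynomial.eval_pow, Polynomial.eval_X, one_pow, Polynomial.derivative_X_pow,
    Polynomial.eval_mul, Polynomial.eval_C, mul_one] at h3
  have h4 : Near e (u ^ n - 1) ((n : ℚ_[p]) * (u - 1)) := by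
    refine h3.trans ?_
    rw [sq, ← mul_assoc, norm_mul, norm_mul _ (u - 1)]
    exact mul_le_mul_of_nonneg_right h1 (norm_nonneg _)
  have h5 := (h4.mul_left (c / (n : ℚ_[p])) he).symm he
  have e1 : c / (n : ℚ_[p]) * ((n : ℚ_[p]) * (u - 1)) = x - c := by rw [hx]; field_simp
  have e2 : c / (n : ℚ_[p]) * (u ^ n - 1) = (x ^ n - c ^ n) / (n * c ^ (n - 1)) := by
    obtain ⟨m, rfl⟩ : ∃ m, n = m + 1 := ⟨n - 1, by omega⟩
    rw [hx, Nat.add_sub_cancel]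
    have hn0' : (((m + 1 : ℕ) : ℚ_[p])) ≠ 0 := hn0
    rw [eq_div_iff (mul_ne_zero hn0' (pow_ne_zero _ hc)), div_mul_eq_mul_div, div_mul_eq_mul_div,
      div_eq_iff hn0']
    ring
  rwa [e1, e2] at h5

/-- Every `n`-th root is unique among `q`-th powers. -/
def UniqueRoot (p : ℕ) [Fact p.Prime] (n q : ℕ) : Prop :=
  ∀ s s' : ℚ_[p], s ≠ 0 → s' ≠ 0 → (s ^ q) ^ n = (s' ^ q) ^ n → s ^ q = s' ^ q

lemma exists_uniqueRoot (n : ℕ) (hn : 0 < n) : ∃ q, 0 < q ∧ UniqueRoot p n q := by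
  have hn0 : (n : ℚ_[p]) ≠ 0 := by exact_mod_cast hn.ne'
  obtain ⟨e, he⟩ := exists_pow_norm_lt (p := p) (norm_pos_iff.2 hn0)
  obtain ⟨q, hq, h⟩ := exists_pow_near_one (p := p) (1 + e)
  refine ⟨q, hq, fun s s' hs hs' hss => ?_⟩
  have hu : ‖s / s'‖ = 1 := by
    have h1 : ‖s / s'‖ ^ (q * n) = 1 := by
      rw [← norm_pow, div_pow, pow_mul, pow_mul, hss, div_self (by positivity), norm_one]
    exact (pow_eq_one_iff_of_nonneg (norm_nonneg _) (by positivity)).1 h1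
  have h2 := h _ hu
  rw [div_pow] at h2
  have h0 : s' ^ q ≠ 0 := pow_ne_zero _ hs'
  have h3 : ‖s ^ q - s' ^ q‖ ≤ ‖(p : ℚ_[p]) ^ 1 * n * s' ^ q‖ := by
    have h4 : ‖(p : ℚ_[p]) ^ (1 + e)‖ ≤ ‖(p : ℚ_[p]) ^ 1 * n‖ := by
      rw [pow_add, norm_mul, norm_mul]
      exact mul_le_mul_of_nonneg_left he.le (norm_nonneg _)
    have h5 : s ^ q - s' ^ q = (s ^ q / s' ^ q - 1) * s' ^ q := by field_simp
    rw [h5, norm_mul, norm_mul _ (s' ^ q)]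
    exact mul_le_mul_of_nonneg_right (h2.trans h4) (norm_nonneg _)
  have h6 := near_pow_sub_pow le_rfl hn h0 h3
  rw [hss, sub_self, zero_div] at h6
  exact sub_eq_zero.1 ((h6.eq_zero_iff le_rfl).2 rfl)

open Classical in
/-- The `n`-th root of `w` which is a `q`-th power. -/
noncomputable def powRoot (n q : ℕ) (w : ℚ_[p]) : ℚ_[p] :=
  if h : IsPow (q * n) w then h.2.choose ^ q else 0

section powRoot

variable {n q : ℕ} {w : ℚ_[p]}

lemma powRoot_pow (h : IsPow (q * n) w) : powRoot n q w ^ n = w := by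
  rw [powRoot, dif_pos h, ← pow_mul]
  exact h.2.choose_spec

lemma powRoot_of_not (h : ¬ IsPow (q * n) w) : powRoot n q w = 0 := by
  rw [powRoot, dif_neg h]

lemma powRoot_eq (hq : 0 < q) (hn : 0 < n) (hu : UniqueRoot p n q) {s : ℚ_[p]} (hs : s ≠ 0) :
    powRoot n q ((s ^ q) ^ n) = s ^ q := by
  have h : IsPow (q * n) ((s ^ q) ^ n) := by
    rw [← pow_mul]
    exact isPow_pow hs _
  have h1 := powRoot_pow h
  rw [powRoot, dif_pos h] at h1 ⊢
  refine hu _ _ (fun h0 => ?_) hs h1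
  rw [h0, zero_pow hq.ne', zero_pow hn.ne'] at h1
  exact h.1 h1.symm

variable {W : (ℕ → ℚ_[p]) → ℚ_[p]}

lemma tame_powRoot (hq : 0 < q) (hn : 0 < n) (hu : UniqueRoot p n q) (hW : Good W) :
    Tame fun y => powRoot n q (W y) := by
  intro e he
  have hA : SA fun y => IsPow (q * n) (W y) := hW.sa_isPow (by positivity)
  refine TameAt.cases (fun y => IsPow (q * n) (W y)) ?_ ?_
  swap
  · exact (TameAt.of_good (SA.true.and hA.not) (Good.const 0)).near he fun y hy => by
      rw [powRoot_of_not hy.2]; exact Near.refl _ _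
  constructor
  · intro N hN _ l
    obtain ⟨R, hR0, hR⟩ := exists_pow_reps (p := p) (q * N * n) (by positivity)
    classical
    have h1 := (SA.true.and hA).and (SA.exists_finset
      (R.filter fun r => IsPow N (l * powRoot n q r⁻¹))
      fun r _ => ((Good.const r).mul hW).sa_isPow (n := q * N * n) (by positivity))
    refine h1.congr fun y => and_congr_right fun hy => ?_
    have key : ∀ r ∈ R, IsPow (q * N * n) (r * W y) →
        (IsPow N (l * powRoot n q r⁻¹) ↔ IsPow N (l * powRoot n q (W y))) := by
      rintro r hr ⟨h0, z, hz⟩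
      have hr0 := hR0 r hr
      have hz0 : z ≠ 0 := fun h => h0 (by rw [← hz, h, zero_pow (by positivity)])
      obtain ⟨hW0, s, hs⟩ := hy.2
      have hs0 : s ≠ 0 := fun h => hW0 (by rw [← hs, h, zero_pow (by positivity)])
      have e1 : powRoot n q (W y) = s ^ q := by
        rw [← hs, pow_mul, powRoot_eq hq hn hu hs0]
      have e2 : r⁻¹ = ((s / z ^ N) ^ q) ^ n := by
        rw [div_pow, div_pow, ← pow_mul, hs, ← pow_mul, ← pow_mul,
          show N * (q * n) = q * N * n by ring, hz]
        field_simp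
      rw [e1, e2, powRoot_eq hq hn hu (div_ne_zero hs0 (pow_ne_zero _ hz0)),
        ← isPow_mul_iff (isPow_pow_of_dvd hz0 (dvd_mul_right N q)), div_pow, ← pow_mul]
      have : z ^ (N * q) * (l * (s ^ q / z ^ (N * q))) = l * s ^ q := by field_simp
      rw [this]
    constructor
    · rintro ⟨r, hr, h⟩
      obtain ⟨hr1, hr2⟩ := Finset.mem_filter.1 hr
      exact (key r hr1 h).1 hr2
    · intro h
      obtain ⟨r, hr, h1⟩ := hR _ hy.2.1
      exact ⟨r, Finset.mem_filter.2 ⟨hr, (key r hr h1).2 h⟩, h1⟩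
  · intro k a hk ha i j
    have h1 := (SA.true.and hA).and
      (((hk.pow n).mul (hW.pow i)).sa_norm_le ((ha.pow n).mul (hW.pow j)))
    refine h1.congr fun y => and_congr_right fun hy => ?_
    have h2 : ∀ (b : ℚ_[p]) (m : ℕ), ‖b ^ n * W y ^ m‖ = ‖b * powRoot n q (W y) ^ m‖ ^ n := by
      intro b m
      rw [← norm_pow, mul_pow, ← pow_mul, mul_comm m n, pow_mul, powRoot_pow hy.2]
    rw [h2, h2]
    exact pow_le_pow_iff_left₀ (norm_nonneg _) (norm_nonneg _) hn.ne'

end powRoot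

lemma exists_annulus_reps (e E : ℕ) : ∃ M, 0 < M ∧ ∃ R : Finset ℚ_[p], (∀ r ∈ R, r ≠ 0) ∧
    (∀ x : ℚ_[p], ‖(p : ℚ_[p]) ^ e‖ ≤ ‖x‖ → ‖(p : ℚ_[p]) ^ e * x‖ ≤ 1 →
      ∃ r ∈ R, IsPow M (r⁻¹ * x) ∧ ‖x‖ = ‖r‖) ∧
    ∀ z : ℚ_[p], IsPow M z → ‖z‖ = 1 → Near E z 1 := by
  classical
  obtain ⟨M, hM, hM1⟩ := exists_pow_near_one (p := p) E
  obtain ⟨e0, he0, h0⟩ := exists_isPow_congr (p := p) M hM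
  obtain ⟨R, -, hR⟩ := exists_int_reps (p := p) (e0 + 2 * e)
  have hp := p_ne_zero (p := p)
  refine ⟨M, hM, (R.image fun r => ((p : ℚ_[p]) ^ e)⁻¹ * r).filter (· ≠ 0),
    fun r hr => (Finset.mem_filter.1 hr).2, fun x hx1 hx2 => ?_, ?_⟩
  · obtain ⟨r, hr, h1⟩ := hR _ hx2
    have hx0 : x ≠ 0 := norm_pos_iff.1 ((norm_pow_p_pos e).trans_le hx1)
    have h2 : Near e0 r ((p : ℚ_[p]) ^ e * x) := by
      unfold Near
      rw [norm_sub_rev]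
      refine h1.trans ?_
      rw [pow_add, norm_mul, norm_mul, two_mul, pow_add, norm_mul, norm_mul]
      gcongr
    have h3 := h2.mul_left ((p : ℚ_[p]) ^ e)⁻¹ he0
    rw [inv_mul_cancel_left₀ (pow_ne_zero _ hp)] at h3
    have h5 : ((p : ℚ_[p]) ^ e)⁻¹ * r ≠ 0 := fun h => hx0 ((h3.eq_zero_iff he0).1 h)
    refine ⟨((p : ℚ_[p]) ^ e)⁻¹ * r, Finset.mem_filter.2 ⟨Finset.mem_image_of_mem _ hr, h5⟩, ?_,
      (h3.norm_eq he0).symm⟩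
    have h6 := h3.mul_left (((p : ℚ_[p]) ^ e)⁻¹ * r)⁻¹ he0
    rw [inv_mul_cancel₀ h5] at h6
    exact (h0 e0 le_rfl _ _ h6).1 ⟨one_ne_zero, 1, one_pow _⟩
  · rintro z ⟨hz0, u, rfl⟩ hz
    have hu : ‖u‖ = 1 := by
      rw [norm_pow] at hz
      exact (pow_eq_one_iff_of_nonneg (norm_nonneg _) hM.ne').1 hz
    simpa [Near] using hM1 u hu

lemma tame_powRoot_sub {n q : ℕ} {W c : (ℕ → ℚ_[p]) → ℚ_[p]} (hq : 0 < q) (hn : 0 < n)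
    (hu : UniqueRoot p n q) (hW : Good W) (hc : Good c) :
    Tame fun y => powRoot n q (W y) - c y := by
  intro e he
  have ht := tame_powRoot hq hn hu hW
  set θ := fun y => powRoot n q (W y) with hθ
  have hn0 : (n : ℚ_[p]) ≠ 0 := by exact_mod_cast hn.ne'
  have hC1 : SA fun y => ‖θ y‖ ≤ ‖(p : ℚ_[p]) ^ e * c y‖ :=
    (ht.sa_norm_le (Good.const 1) ((Good.const ((p : ℚ_[p]) ^ e)).mul hc) 1 0).congr fun y => by simp
  have hC2 : SA fun y => ‖c y‖ ≤ ‖(p : ℚ_[p]) ^ e * θ y‖ :=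
    (ht.sa_norm_le hc (Good.const ((p : ℚ_[p]) ^ e)) 0 1).congr fun y => by simp
  refine TameAt.cases (fun y => ‖θ y‖ ≤ ‖(p : ℚ_[p]) ^ e * c y‖) ?_ ?_
  · refine (TameAt.of_good (SA.true.and hC1) hc.neg).near he fun y hy => ?_
    have := Near.add_right_of_le (a := -c y) (b := θ y) (e := e) (by simpa using hy.2)
    rwa [neg_add_eq_sub] at this
  refine TameAt.cases (fun y => ‖c y‖ ≤ ‖(p : ℚ_[p]) ^ e * θ y‖) ?_ ?_
  · refine (((ht e he).restrict hC1.not).restrict hC2).near he fun y hy => ?_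
    have := Near.add_right_of_le (a := θ y) (b := -c y) (e := e) (by simpa using hy.2)
    rwa [← sub_eq_add_neg] at this
  obtain ⟨e1, he1⟩ := exists_pow_norm_lt (p := p) (norm_pos_iff.2 hn0)
  set E := e + (e + e1) with hE
  obtain ⟨M, hM, R, hR0, hR, hM1⟩ := exists_annulus_reps (p := p) e E
  have hne : ∀ y, (True ∧ ¬ ‖θ y‖ ≤ ‖(p : ℚ_[p]) ^ e * c y‖) ∧
      ¬ ‖c y‖ ≤ ‖(p : ℚ_[p]) ^ e * θ y‖ → θ y ≠ 0 ∧ c y ≠ 0 := fun y hy =>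
    ⟨fun h => hy.1.2 (by rw [h, norm_zero]; exact norm_nonneg _),
      fun h => hy.2 (by rw [h, norm_zero]; exact norm_nonneg _)⟩
  refine TameAt.cover R (C := fun r y => IsPow M ((r⁻¹ * (c y)⁻¹) * θ y ^ 1) ∧
    (‖θ y‖ ≤ ‖r * c y‖ ∧ ‖r * c y‖ ≤ ‖θ y‖)) ?_ ?_
  · intro y hy
    obtain ⟨h1, h2⟩ := hne y hy
    obtain ⟨r, hr, h3, h4⟩ := hR (θ y / c y) (by
        rw [norm_div, le_div_iff₀ (norm_pos_iff.2 h2), ← norm_mul]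
        exact (not_le.1 hy.1.2).le) (by
        rw [← mul_div_assoc, norm_div, div_le_one (norm_pos_iff.2 h2)]
        exact (not_le.1 hy.2).le)
    refine ⟨r, hr, ?_, le_antisymm_iff.1 ?_⟩
    · rwa [pow_one, mul_assoc, mul_comm _ (θ y), ← div_eq_mul_inv]
    · rw [norm_mul, ← h4, norm_div, div_mul_cancel₀ _ (norm_ne_zero_iff.2 h2)]
  intro r hr
  have hr0 := hR0 r hr
  have hSA : SA fun y => ((True ∧ ¬ ‖θ y‖ ≤ ‖(p : ℚ_[p]) ^ e * c y‖) ∧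
      ¬ ‖c y‖ ≤ ‖(p : ℚ_[p]) ^ e * θ y‖) ∧ IsPow M ((r⁻¹ * (c y)⁻¹) * θ y ^ 1) ∧
      (‖θ y‖ ≤ ‖r * c y‖ ∧ ‖r * c y‖ ≤ ‖θ y‖) := by
    refine ((SA.true.and hC1.not).and hC2.not).and
      ((ht.sa_isPow_mul_pow ((Good.const _).mul hc.inv) hM 1).and (.and ?_ ?_))
    · exact (ht.sa_norm_le (Good.const 1) ((Good.const r).mul hc) 1 0).congr fun y => by simp
    · exact (ht.sa_norm_le ((Good.const r).mul hc) (Good.const 1) 0 1).congr fun y => by simp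
  have hnear : ∀ y, c y ≠ 0 → IsPow M ((r⁻¹ * (c y)⁻¹) * θ y ^ 1) →
      (‖θ y‖ ≤ ‖r * c y‖ ∧ ‖r * c y‖ ≤ ‖θ y‖) → Near E (θ y) (r * c y) := by
    intro y h0 h1 h2
    have h3 : r * c y ≠ 0 := mul_ne_zero hr0 h0
    have h4 : (r * c y) * (r⁻¹ * (c y)⁻¹ * θ y ^ 1) = θ y := by field_simp
    have h5 := (hM1 _ h1 (by
      rw [← mul_inv, pow_one, norm_mul, norm_inv, ← le_antisymm h2.1 h2.2,
        inv_mul_cancel₀]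
      rw [le_antisymm h2.1 h2.2]
      exact norm_ne_zero_iff.2 h3)).mul_left (r * c y) (by omega)
    rwa [h4, mul_one] at h5
  by_cases hr1 : ‖(p : ℚ_[p]) ^ E * r‖ ≤ ‖(p : ℚ_[p]) ^ e * (r - 1)‖
  · refine (TameAt.of_good hSA ((Good.const (r - 1)).mul hc)).near he fun y hy => ?_
    have h0 := (hne y hy.1).2
    have h1 := hnear y h0 hy.2.1 hy.2.2
    have h2 : θ y - c y = (r - 1) * c y + (θ y - r * c y) := by ring
    show Near e (θ y - c y) _
    rw [h2]
    refine Near.add_right_of_le (le_trans h1 ?_)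
    rw [← mul_assoc, ← mul_assoc, norm_mul, norm_mul _ (c y)]
    exact mul_le_mul_of_nonneg_right hr1 (norm_nonneg _)
  · refine (TameAt.of_good hSA ((hW.sub (hc.pow n)).div
      ((Good.const (n : ℚ_[p])).mul (hc.pow (n - 1))))).near he fun y hy => ?_
    obtain ⟨hθ0, h0⟩ := hne y hy.1
    have h1 := hnear y h0 hy.2.1 hy.2.2
    have hWp : IsPow (q * n) (W y) := by
      by_contra h
      exact hθ0 (powRoot_of_not h)
    have h2 : Near (e + e1) 1 r := by
      have h3 := not_le.1 hr1
      rw [hE, pow_add, mul_assoc, norm_mul, norm_mul] at h3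
      have := (lt_of_mul_lt_mul_left h3 (norm_nonneg _)).le
      rwa [Near, norm_sub_rev]
    have h3 : Near (e + e1) (θ y) (c y) := by
      have h4 := (h2.symm (by omega)).mul (Near.refl _ (c y)) (by omega)
      rw [one_mul] at h4
      exact (h1.mono (by omega)).trans h4 (by omega)
    have h5 := near_pow_sub_pow (n := n) he hn h0 (x := θ y) (le_trans h3 (by
      rw [pow_add, norm_mul, norm_mul, norm_mul _ (c y), norm_mul]
      gcongr))
    rw [show θ y ^ n = W y from powRoot_pow hWp] at h5
    exact h5

lemma good_powRoot {d n q : ℕ} (hd : CellDec p d) (hn : 0 < n) (hnd : n ≤ d + 1) (hq : 0 < q)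
    (hu : UniqueRoot p n q) {W : (ℕ → ℚ_[p]) → ℚ_[p]} (hW : Good W) :
    Good fun y => powRoot n q (W y) := by
  classical
  set w' := fun y => if IsPow (q * n) (W y) then W y else 0 with hw'
  have hw'g : Good w' := Good.ite (hW.sa_isPow (by positivity)) hW (Good.const 0)
  have hdeg : ∀ y, (Polynomial.X ^ n - Polynomial.C (w' y)).natDegree = n := fun y =>
    Polynomial.natDegree_X_pow_sub_C
  have hG : GoodPoly (d + 1) fun y => Polynomial.X ^ n - Polynomial.C (w' y) := by
    refine ⟨fun y => (hdeg y).trans_le hnd, fun i => ?_⟩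
    simp only [Polynomial.coeff_sub, Polynomial.coeff_C]
    refine (Good.const _).sub ?_
    by_cases hi : i = 0
    · simpa [hi] using hw'g
    · simpa [hi] using Good.const 0
  refine good_of_root hd hG (fun y h => ?_) (fun y => ?_) fun σ c hc =>
    tame_powRoot_sub hq hn hu (hW.comp σ) hc
  · have := hdeg y
    rw [h, Polynomial.natDegree_zero] at this
    omega
  · by_cases h : IsPow (q * n) (W y)
    · simp [hw', h, powRoot_pow h]
    · simp [hw', h, powRoot_of_not h, hn.ne']

/-- Norms which are `n`-th powers are `n`-th powers of norms of finitely many good functions. -/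
lemma exists_norm_root {d n : ℕ} (hd : CellDec p d) (hn : 0 < n) (hnd : n ≤ d + 1)
    {W : (ℕ → ℚ_[p]) → ℚ_[p]} (hW : Good W) :
    ∃ Θ : Set ((ℕ → ℚ_[p]) → ℚ_[p]), Θ.Finite ∧ (∀ θ ∈ Θ, Good θ) ∧
      ∀ y (s : ℚ_[p]), s ≠ 0 → ‖s‖ ^ n = ‖W y‖ → ∃ θ ∈ Θ, ‖θ y‖ = ‖s‖ := by
  classical
  obtain ⟨q, hq, hu⟩ := exists_uniqueRoot (p := p) n hn
  obtain ⟨R, hR0, hR⟩ := exists_pow_reps (p := p) (q * n) (by positivity)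
  have hx : ∀ r : ℚ_[p], ∃ x : ℚ_[p], (∃ x' : ℚ_[p], ‖x'‖ ^ n = ‖r‖) → ‖x‖ ^ n = ‖r‖ := fun r => by
    by_cases h : ∃ x' : ℚ_[p], ‖x'‖ ^ n = ‖r‖
    · exact ⟨h.choose, fun _ => h.choose_spec⟩
    · exact ⟨0, fun h' => absurd h' h⟩
  choose x hx using hx
  refine ⟨(fun r y => (x r)⁻¹ * powRoot n q (r * W y)) '' (R : Set ℚ_[p]),
    R.finite_toSet.image _, ?_, fun y s hs hsW => ?_⟩
  · rintro _ ⟨r, -, rfl⟩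
    exact (Good.const _).mul (good_powRoot hd hn hnd hq hu ((Good.const r).mul hW))
  · have hW0 : W y ≠ 0 := by
      rw [← norm_pos_iff, ← hsW]
      exact pow_pos (norm_pos_iff.2 hs) n
    obtain ⟨r, hr, h1⟩ := hR _ hW0
    refine ⟨_, ⟨r, hr, rfl⟩, ?_⟩
    have h2 : ‖powRoot n q (r * W y)‖ ^ n = ‖r‖ * ‖s‖ ^ n := by
      rw [← norm_pow, powRoot_pow h1, norm_mul, hsW]
    have hs' : ‖s‖ ≠ 0 := norm_ne_zero_iff.2 hs
    have h3 := hx r ⟨powRoot n q (r * W y) / s, by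
      rw [norm_div, div_pow, h2, mul_div_cancel_right₀ _ (pow_ne_zero _ hs')]⟩
    have h4 : ‖x r‖ ≠ 0 := by
      intro h
      rw [h, zero_pow hn.ne'] at h3
      exact norm_ne_zero_iff.2 (hR0 r hr) h3.symm
    rw [norm_mul, norm_inv]
    refine (pow_left_inj₀ (by positivity) (by positivity) hn.ne').1 ?_
    rw [mul_pow, inv_pow, h3, h2, inv_mul_cancel_left₀ (norm_ne_zero_iff.2 (hR0 r hr))]

/-! ### Cell decomposition for one polynomial -/

lemma exists_coeff_bound (d : ℕ) : ∃ C : ℝ, 0 < C ∧ ∀ K : Polynomial ℚ_[p], K.natDegree ≤ d →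
    ∀ r : ℝ, (∀ z : ℚ_[p], ‖z‖ ≤ 1 → ‖K.eval z‖ ≤ r) → ∀ i, ‖K.coeff i‖ ≤ C * r := by
  set s := Finset.range (d + 1) with hs
  set v : ℕ → ℚ_[p] := fun n => n with hv
  have hinj : Set.InjOn v s := fun a _ b _ h => by simpa [hv] using h
  refine ⟨1 + ∑ i ∈ s, ∑ j ∈ s, ‖(Lagrange.basis s v j).coeff i‖, ?_, ?_⟩
  · positivity
  intro K hK r hr i
  have hr0 : 0 ≤ r := (norm_nonneg _).trans (hr 0 (by simp))
  by_cases hi : i ∈ s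
  swap
  · rw [Polynomial.coeff_eq_zero_of_natDegree_lt, norm_zero]
    · positivity
    · have := Finset.mem_range.not.1 hi
      omega
  have h1 : K = Lagrange.interpolate s v fun j => K.eval (v j) := by
    refine Lagrange.eq_interpolate hinj ?_
    rw [hs, Finset.card_range]
    exact (Polynomial.degree_le_of_natDegree_le hK).trans_lt (by exact_mod_cast Nat.lt_succ_self d)
  have h2 : K.coeff i = ∑ j ∈ s, K.eval (v j) * (Lagrange.basis s v j).coeff i := by
    conv_lhs => rw [h1]
    simp [Lagrange.interpolate_apply]
  rw [h2]
  calc _ ≤ ∑ j ∈ s, ‖K.eval (v j) * (Lagrange.basis s v j).coeff i‖ := norm_sum_le _ _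
    _ ≤ ∑ j ∈ s, ‖(Lagrange.basis s v j).coeff i‖ * r := by
        refine Finset.sum_le_sum fun j _ => ?_
        rw [norm_mul, mul_comm]
        refine mul_le_mul_of_nonneg_left (hr _ ?_) (norm_nonneg _)
        exact_mod_cast Padic.norm_int_le_one (p := p) (j : ℤ)
    _ = (∑ j ∈ s, ‖(Lagrange.basis s v j).coeff i‖) * r := by rw [Finset.sum_mul]
    _ ≤ _ := by
        refine mul_le_mul_of_nonneg_right ?_ hr0
        refine le_add_of_nonneg_of_le zero_le_one ?_
        exact Finset.single_le_sum (f := fun i => ∑ j ∈ s, ‖(Lagrange.basis s v j).coeff i‖)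
          (fun _ _ => by positivity) hi

lemma norm_sum_padic_le {ι : Type*} (s : Finset ι) {f : ι → ℚ_[p]} {r : ℝ} (hr : 0 ≤ r)
    (h : ∀ i ∈ s, ‖f i‖ ≤ r) : ‖∑ i ∈ s, f i‖ ≤ r :=
  IsUltrametricDist.norm_sum_le_of_forall_le_of_nonneg hr h

lemma norm_pow_sub_pow_le {x y : ℚ_[p]} (hx : ‖x‖ ≤ 1) (hy : ‖y‖ ≤ 1) (i : ℕ) :
    ‖x ^ i - y ^ i‖ ≤ ‖x - y‖ := by
  rw [← (Commute.all x y).geom_sum₂_mul, norm_mul]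
  refine mul_le_of_le_one_left (norm_nonneg _) (norm_sum_padic_le _ zero_le_one fun j _ => ?_)
  rw [norm_mul, norm_pow, norm_pow]
  exact mul_le_one₀ (pow_le_one₀ (norm_nonneg _) hx) (by positivity)
    (pow_le_one₀ (norm_nonneg _) hy)

lemma norm_eval_sub_linear_le {H : Polynomial ℚ_[p]} {r : ℝ} (hr : 0 ≤ r)
    (hH : ∀ i, 2 ≤ i → ‖H.coeff i‖ ≤ r) {x y : ℚ_[p]} (hx : ‖x‖ ≤ 1) (hy : ‖y‖ ≤ 1) :
    ‖H.eval x - H.eval y - H.coeff 1 * (x - y)‖ ≤ r * ‖x - y‖ := by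
  have h1 : H.natDegree < H.natDegree + 2 := by omega
  rw [Polynomial.eval_eq_sum_range' h1, Polynomial.eval_eq_sum_range' h1,
    ← Finset.sum_sub_distrib, Finset.sum_range_succ', Finset.sum_range_succ']
  have : ∀ a b c d : ℚ_[p], a + b + c - d = a + (b + c - d) := fun _ _ _ _ => by ring
  simp only [pow_zero, sub_self, zero_add, pow_one, this]
  rw [show H.coeff 1 * x - H.coeff 1 * y + 0 -
    H.coeff 1 * (x - y) = 0 by ring, add_zero]
  refine norm_sum_padic_le _ (by positivity) fun i _ => ?_
  rw [← mul_sub, norm_mul]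
  exact mul_le_mul (hH _ (by omega)) (norm_pow_sub_pow_le hx hy _) (norm_nonneg _) hr

/-- If the derivative of a polynomial is nearly constant on the unit ball, then the polynomial is
nearly linear. -/
lemma exists_coeff_le_of_derivative (d e : ℕ) : ∃ E, 1 ≤ E ∧ ∀ H : Polynomial ℚ_[p],
    H.natDegree ≤ d + 1 → ∀ b, (∀ z : ℚ_[p], ‖z‖ ≤ 1 → Near E (H.derivative.eval z) b) →
    ∀ i, 2 ≤ i → ‖H.coeff i‖ ≤ ‖(p : ℚ_[p]) ^ e * H.coeff 1‖ := by
  obtain ⟨C, hC, h⟩ := exists_coeff_bound (p := p) d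
  have h1 : ∃ m : ℝ, 0 < m ∧ ∀ i ∈ Finset.range (d + 1), m ≤ ‖((i + 1 : ℕ) : ℚ_[p])‖ := by
    obtain ⟨i, -, hi⟩ := Finset.exists_min_image (Finset.range (d + 1))
      (fun i => ‖((i + 1 : ℕ) : ℚ_[p])‖) ⟨0, by simp⟩
    exact ⟨_, norm_pos_iff.2 (by exact_mod_cast i.succ_ne_zero), hi⟩
  obtain ⟨m, hm, hmi⟩ := h1
  obtain ⟨E, hE⟩ := exists_pow_norm_lt (p := p) (r := m * ‖(p : ℚ_[p]) ^ e‖ / C)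
    (by have := norm_pow_p_pos (p := p) e; positivity)
  refine ⟨E + 1, by omega, fun H hH b hb i hi => ?_⟩
  obtain ⟨i, rfl⟩ : ∃ k, i = k + 2 := ⟨i - 2, by omega⟩
  have hb1 : Near (E + 1) (H.coeff 1) b := by
    have := hb 0 (by simp)
    rwa [← Polynomial.coeff_zero_eq_eval_zero, Polynomial.coeff_derivative, zero_add, Nat.cast_zero,
      zero_add, mul_one] at this
  by_cases hid : d + 1 < i + 2
  · rw [Polynomial.coeff_eq_zero_of_natDegree_lt (by omega), norm_zero]
    exact norm_nonneg _
  have h2 := h (H.derivative - Polynomial.C (H.coeff 1)) (by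
    refine (Polynomial.natDegree_sub_le _ _).trans ?_
    rw [Polynomial.natDegree_C, Nat.max_zero]
    exact (Polynomial.natDegree_derivative_le _).trans (by omega)) _ (fun z hz => by
    have := (hb z hz).trans (hb1.symm (by omega)) (by omega)
    rw [Polynomial.eval_sub, Polynomial.eval_C]
    exact this) (i + 1)
  rw [Polynomial.coeff_sub, Polynomial.coeff_C_succ, sub_zero, Polynomial.coeff_derivative] at h2
  have h3 : ‖((i + 2 : ℕ) : ℚ_[p])‖ ≥ m := hmi (i + 1) (Finset.mem_range.2 (by omega))
  have h4 : ‖H.coeff (i + 2)‖ * m ≤ ‖(p : ℚ_[p]) ^ e * H.coeff 1‖ * m := by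
    calc ‖H.coeff (i + 2)‖ * m ≤ ‖H.coeff (i + 2)‖ * ‖((i + 2 : ℕ) : ℚ_[p])‖ :=
          mul_le_mul_of_nonneg_left h3 (norm_nonneg _)
      _ = ‖H.coeff (i + 1 + 1) * (((i + 1 : ℕ) : ℚ_[p]) + 1)‖ := by
          rw [norm_mul]; congr 2; push_cast; ring
      _ ≤ _ := h2
      _ = C * ‖(p : ℚ_[p]) ^ (E + 1)‖ * ‖H.coeff 1‖ := by rw [norm_mul, mul_assoc]
      _ ≤ C * (m * ‖(p : ℚ_[p]) ^ e‖ / C) * ‖H.coeff 1‖ := by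
          gcongr
          exact (norm_pow_p_le (Nat.le_succ E)).trans hE.le
      _ = _ := by rw [norm_mul]; field_simp
  exact le_of_mul_le_mul_right h4 hm

lemma Ann.iff_of_norm_eq {c : (ℕ → ℚ_[p]) → ℚ_[p]} {W : (ℕ → ℚ_[p]) → ℚ_[p] → Prop}
    (h : Ann c W) {y : ℕ → ℚ_[p]} {t t' : ℚ_[p]} (ht : ‖t - c y‖ = ‖t' - c y‖) :
    W y t ↔ W y t' := by
  induction h with
  | base => rfl
  | mono => simp only [norm_mul, norm_pow, ht]
  | and _ _ ih1 ih2 => exact and_congr ih1 ih2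

lemma Tame.of_good {φ : (ℕ → ℚ_[p]) → ℚ_[p]} (h : Good φ) : Tame φ :=
  fun _ _ => TameAt.of_good SA.true h

lemma Good.sa_ann {c θ : (ℕ → ℚ_[p]) → ℚ_[p]} (hθ : Good θ) (hc : Good c)
    {W : (ℕ → ℚ_[p]) → ℚ_[p] → Prop} (hW : Ann c W) : SA fun y => W y (θ y) :=
  (Tame.of_good (hθ.sub hc)).sa_ann hW

/-- Cell decomposition on a ball on which the derivative is nearly constant. -/
lemma cov_ball {d : ℕ} (hd : CellDec p d) {e E : ℕ} (he : 1 ≤ e) (hE1 : 1 ≤ E)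
    (hE : ∀ H : Polynomial ℚ_[p],
      H.natDegree ≤ d + 1 → ∀ b, (∀ z : ℚ_[p], ‖z‖ ≤ 1 → Near E (H.derivative.eval z) b) →
      ∀ i, 2 ≤ i → ‖H.coeff i‖ ≤ ‖(p : ℚ_[p]) ^ e * H.coeff 1‖)
    {P : (ℕ → ℚ_[p]) → Polynomial ℚ_[p]} (hP : GoodPoly (d + 1) P)
    {B : (ℕ → ℚ_[p]) → Prop} (hB : SA B) {c ρ : (ℕ → ℚ_[p]) → ℚ_[p]} (hc : Good c) (hρ : Good ρ)
    (hρ0 : ∀ y, B y → ρ y ≠ 0) {κ : (ℕ → ℚ_[p]) → ℚ_[p]}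
    (hκ : ∀ y, B y → ∀ t, ‖t - c y‖ ≤ ‖ρ y‖ → Near E ((P y).derivative.eval t) (κ y)) :
    Cov (Nice {fun y t => (P y).eval t} e)
      (fun y t => B y ∧ ‖t - c y‖ ≤ ‖(p : ℚ_[p]) ^ e * ρ y‖) := by
  set H := fun y => (Polynomial.taylor (c y) (P y)).comp
    (Polynomial.C (ρ y) * Polynomial.X) with hHd
  have hH : GoodPoly (d + 1) H := (hP.taylor hc).scale hρ
  have hHe : ∀ y z, (H y).eval z = (P y).eval (c y + ρ y * z) := fun y z => by
    simp [hHd, Polynomial.taylor_eval, add_comm]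
  have hHd' : ∀ y z, (H y).derivative.eval z = ρ y * (P y).derivative.eval (c y + ρ y * z) := by
    intro y z
    rw [hHd]
    simp only [Polynomial.derivative_comp, Polynomial.derivative_mul, Polynomial.derivative_C,
      Polynomial.derivative_X, Polynomial.eval_mul, Polynomial.eval_comp, Polynomial.taylor_apply,
      Polynomial.eval_add, Polynomial.eval_C, Polynomial.eval_X]
    simp [add_comm]
  have hcoef : ∀ y, B y → ∀ i, 2 ≤ i →
      ‖(H y).coeff i‖ ≤ ‖(p : ℚ_[p]) ^ e * (H y).coeff 1‖ := by
    intro y hy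
    refine hE _ (hH.natDegree_le y) (ρ y * κ y) fun z hz => ?_
    rw [hHd']
    refine (hκ y hy _ ?_).mul_left (ρ y) hE1
    rw [add_sub_cancel_left, norm_mul]
    exact mul_le_of_le_one_right (norm_nonneg _) hz
  have ht : ∀ y, B y → ∀ t, (P y).eval t = (H y).eval ((t - c y) / ρ y) := by
    intro y hy t
    rw [hHe, mul_div_cancel₀ _ (hρ0 y hy)]
    congr 1
    ring
  set b := fun i y => (H y).coeff i with hb
  set R := fun y => b 1 y ≠ 0 ∧ ‖b 0 y‖ ≤ ‖(p : ℚ_[p]) * b 1 y‖ with hR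
  have hRSA : SA R := (hH.coeff 1).sa_ne_zero.and
    ((hH.coeff 0).sa_norm_le ((Good.const _).mul (hH.coeff 1)))
  set K := fun y => Polynomial.C (b 1 y)⁻¹ * H y with hK
  have hKg : GoodPoly (d + 1) K := ⟨fun y => (Polynomial.natDegree_C_mul_le _ _).trans
    (hH.natDegree_le y), fun i => by
      simpa only [hK, Polynomial.coeff_C_mul] using (hH.coeff 1).inv.mul (hH.coeff i)⟩
  set ζ := fun y => henselRoot (K y) with hζ
  have hζg : Good ζ := good_henselRoot hd hKg
  have hKh : ∀ y, B y → R y → Henselian (K y) := by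
    intro y hy hRy
    have h1 : 0 < ‖b 1 y‖ := norm_pos_iff.2 hRy.1
    simp only [Henselian, hK, Polynomial.coeff_C_mul]
    refine ⟨⟨inv_mul_cancel₀ hRy.1, ?_⟩, fun i hi => ?_⟩
    · rw [norm_mul, norm_inv, inv_mul_le_iff₀ h1, mul_comm, ← norm_mul]
      exact hRy.2
    · rw [norm_mul, norm_inv, inv_mul_le_iff₀ h1, mul_comm, ← norm_mul]
      refine (hcoef y hy i hi).trans ?_
      rw [norm_mul, norm_mul]
      refine mul_le_mul_of_nonneg_right ?_ (norm_nonneg _)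
      simpa using norm_pow_p_le (p := p) he
  refine Cov.mono (Cov.or
    (Cov.single (c := fun y => c y + ρ y * ζ y)
      (D := fun y t => (B y ∧ R y) ∧ ‖1 * (t - (c y + ρ y * ζ y))‖ ≤ ‖ρ y‖) ?_)
    (Cov.single (c := c)
      (D := fun y t => (B y ∧ ¬ R y) ∧ ‖1 * (t - c y)‖ ≤ ‖(p : ℚ_[p]) ^ e * ρ y‖) ?_))
    (fun _ _ h => h) ?_
  · refine ⟨hc.add (hρ.mul hζg), (Ann.base (hB.and hRSA)).and (Ann.ball (Good.const 1) hρ), ?_⟩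
    rintro F rfl
    refine ⟨fun y => b 1 y / ρ y, 1, (hH.coeff 1).div hρ, ?_⟩
    rintro y t ⟨⟨hy, hRy⟩, h2⟩
    have hρy := hρ0 y hy
    have h3 := hKh y hy hRy
    have hζ1 : ‖ζ y‖ ≤ 1 := h3.norm_henselRoot.trans norm_p_lt_one.le
    set z := (t - c y) / ρ y with hz
    have e1 : t - (c y + ρ y * ζ y) = ρ y * (z - ζ y) := by rw [hz]; field_simp; ring
    rw [one_mul, e1, norm_mul, mul_le_iff_le_one_right (norm_pos_iff.2 hρy)] at h2
    have hz1 : ‖z‖ ≤ 1 := by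
      rw [← sub_add_cancel z (ζ y)]
      exact norm_add_le_of_le h2 hζ1
    have h0 : (H y).eval (ζ y) = 0 := by
      have := h3.eval_henselRoot
      rw [hK, Polynomial.eval_mul, Polynomial.eval_C] at this
      exact (mul_eq_zero.1 this).resolve_left (inv_ne_zero hRy.1)
    have h4 := norm_eval_sub_linear_le (norm_nonneg _) (hcoef y hy) hz1 hζ1
    rw [h0, sub_zero] at h4
    simp only [pow_one]
    rw [e1, ht y hy t, show b 1 y / ρ y * (ρ y * (z - ζ y)) = b 1 y * (z - ζ y) by field_simp]
    refine h4.trans_eq ?_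
    rw [← norm_mul, mul_assoc]
  · refine ⟨hc, (Ann.base (hB.and hRSA.not)).and
      (Ann.ball (Good.const 1) ((Good.const _).mul hρ)), ?_⟩
    rintro F rfl
    refine ⟨b 0, 0, hH.coeff 0, ?_⟩
    rintro y t ⟨⟨hy, hRy⟩, h2⟩
    have hρy := hρ0 y hy
    have h10 : ‖b 1 y‖ ≤ ‖b 0 y‖ := by
      by_contra! h
      exact hRy ⟨fun h0 => by rw [h0, norm_zero] at h; exact (norm_nonneg _).not_gt h,
        norm_le_p_mul_of_lt h⟩
    set z := (t - c y) / ρ y with hz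
    have hz1 : ‖z‖ ≤ ‖(p : ℚ_[p]) ^ e‖ := by
      rw [hz, norm_div, div_le_iff₀ (norm_pos_iff.2 hρy), ← norm_mul]
      simpa using h2
    have h4 := norm_eval_sub_linear_le (norm_nonneg _) (hcoef y hy)
      (hz1.trans (norm_pow_p_le_one e)) (y := 0) (by simp)
    rw [← Polynomial.coeff_zero_eq_eval_zero, sub_zero] at h4
    simp only [pow_zero, mul_one]
    rw [ht y hy t, Near, ← sub_add_cancel ((H y).eval z - b 0 y) (b 1 y * z)]
    have h5 : ‖b 1 y * z‖ ≤ ‖(p : ℚ_[p]) ^ e * b 0 y‖ := by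
      rw [norm_mul, norm_mul, mul_comm]
      exact mul_le_mul hz1 h10 (norm_nonneg _) (norm_nonneg _)
    refine norm_add_le_of_le (h4.trans ?_) h5
    rw [norm_mul, norm_mul, mul_assoc]
    refine mul_le_mul_of_nonneg_left ?_ (norm_nonneg _)
    exact (mul_le_of_le_one_right (norm_nonneg _) (hz1.trans (norm_pow_p_le_one e))).trans h10
  · rintro y t ⟨hy, h1⟩
    by_cases hRy : R y
    · left
      refine ⟨⟨hy, hRy⟩, ?_⟩
      rw [one_mul, ← sub_sub]
      refine norm_sub_le_of_le (h1.trans ?_) ?_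
      · rw [norm_mul]
        exact mul_le_of_le_one_left (norm_nonneg _) (norm_pow_p_le_one e)
      · rw [norm_mul]
        exact mul_le_of_le_one_right (norm_nonneg _)
          ((hKh y hy hRy).norm_henselRoot.trans norm_p_lt_one.le)
    · exact Or.inr ⟨⟨hy, hRy⟩, by simpa using h1⟩

lemma exists_norm_eq_pow_mul {w x : ℚ_[p]} {e : ℕ} (h1 : ‖(p : ℚ_[p]) ^ e * x‖ < ‖w‖)
    (h2 : ‖w‖ ≤ ‖x‖) : ∃ k < e, ‖w‖ = ‖(p : ℚ_[p]) ^ k * x‖ := by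
  induction e with
  | zero => simp only [pow_zero, one_mul] at h1; exact absurd h2 h1.not_ge
  | succ e ih =>
    by_cases h : ‖w‖ ≤ ‖(p : ℚ_[p]) ^ e * x‖
    · refine ⟨e, e.lt_succ_self, h.antisymm ?_⟩
      by_contra! h'
      have := norm_le_p_mul_of_lt h'
      rw [← mul_assoc, ← pow_succ'] at this
      exact this.not_gt h1
    · obtain ⟨k, hk, h3⟩ := ih (not_le.1 h)
      exact ⟨k, hk.trans e.lt_succ_self, h3⟩

lemma exists_centres {d : ℕ} (hd : CellDec p d) {A : (ℕ → ℚ_[p]) → Polynomial ℚ_[p]}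
    (hA : GoodPoly (d + 1) A) (e : ℕ) :
    ∃ Θ : Set ((ℕ → ℚ_[p]) → ℚ_[p]), Θ.Finite ∧ (∀ θ ∈ Θ, Good θ) ∧ ∀ y (s : ℚ_[p]), s ≠ 0 →
      (∃ i ∈ Finset.range (d + 2), ∀ j ∈ Finset.range (d + 2), j ≠ i →
        ‖(A y).coeff j * s ^ j‖ ≤ ‖(p : ℚ_[p]) ^ e * (A y).coeff i * s ^ i‖) ∨
      ∃ θ ∈ Θ, ‖θ y‖ = ‖s‖ := by
  have key : ∀ x : ℕ × ℕ × ℕ × ℕ, ∃ Θ : Set ((ℕ → ℚ_[p]) → ℚ_[p]), Θ.Finite ∧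
      (∀ θ ∈ Θ, Good θ) ∧ (x.1 < x.2.1 → x.2.1 < d + 2 → ∀ y (s : ℚ_[p]), s ≠ 0 →
        ‖s‖ ^ (x.2.1 - x.1) = ‖(p : ℚ_[p]) ^ x.2.2.1 * (A y).coeff x.1 /
          ((p : ℚ_[p]) ^ x.2.2.2 * (A y).coeff x.2.1)‖ → ∃ θ ∈ Θ, ‖θ y‖ = ‖s‖) := by
    intro x
    by_cases hx : x.1 < x.2.1 ∧ x.2.1 < d + 2
    · obtain ⟨Θ, h1, h2, h3⟩ := exists_norm_root (n := x.2.1 - x.1) hd (by omega) (by omega)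
        (((Good.const ((p : ℚ_[p]) ^ x.2.2.1)).mul (hA.coeff x.1)).div
          ((Good.const ((p : ℚ_[p]) ^ x.2.2.2)).mul (hA.coeff x.2.1)))
      exact ⟨Θ, h1, h2, fun _ _ => h3⟩
    · exact ⟨∅, Set.finite_empty, by simp, fun h h' => absurd ⟨h, h'⟩ hx⟩
  choose Θ hfin hgood hΘ using key
  set I := Finset.range (d + 2) ×ˢ Finset.range (d + 2) ×ˢ Finset.range (e + 1) ×ˢ
    Finset.range (e + 1) with hI
  refine ⟨⋃ x ∈ I, Θ x, I.finite_toSet.biUnion fun x _ => hfin x, fun θ hθ => ?_,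
    fun y s hs => ?_⟩
  · obtain ⟨x, -, hx⟩ := Set.mem_iUnion₂.1 hθ
    exact hgood x θ hx
  · obtain ⟨i, hi, hmax⟩ := Finset.exists_max_image (Finset.range (d + 2))
      (fun i => ‖(A y).coeff i * s ^ i‖) ⟨0, by simp⟩
    by_cases hdom : ∀ j ∈ Finset.range (d + 2), j ≠ i →
        ‖(A y).coeff j * s ^ j‖ ≤ ‖(p : ℚ_[p]) ^ e * (A y).coeff i * s ^ i‖
    · exact Or.inl ⟨i, hi, hdom⟩
    right
    push Not at hdom
    obtain ⟨j, hj, hji, hlt⟩ := hdom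
    rw [mul_assoc] at hlt
    obtain ⟨k, hk, hkeq⟩ := exists_norm_eq_pow_mul hlt (hmax j hj)
    have hs0 : ‖s‖ ≠ 0 := norm_ne_zero_iff.2 hs
    have haj : ‖(A y).coeff j‖ ≠ 0 := by
      intro h
      rw [norm_mul _ (s ^ j), h, zero_mul] at hlt
      exact (norm_nonneg _).not_gt hlt
    have hpk : ‖(p : ℚ_[p]) ^ k‖ ≠ 0 := (norm_pow_p_pos k).ne'
    have hai : ‖(A y).coeff i‖ ≠ 0 := by
      intro h
      rw [norm_mul, norm_mul, norm_mul, h, zero_mul, mul_zero] at hkeq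
      exact mul_ne_zero haj (by rw [norm_pow]; exact pow_ne_zero _ hs0) hkeq
    rw [norm_mul, norm_mul, norm_mul _ (s ^ i), norm_pow s, norm_pow s] at hkeq
    rcases lt_or_gt_of_ne hji with h | h
    · obtain ⟨θ, h1, h2⟩ := hΘ (j, i, 0, k) h (Finset.mem_range.1 hi) y s hs (by
        simp only [pow_zero, one_mul]
        rw [norm_div, norm_mul, eq_div_iff (mul_ne_zero hpk hai)]
        have h3 : ‖s‖ ^ i = ‖s‖ ^ j * ‖s‖ ^ (i - j) := by rw [← pow_add]; congr 1; omega
        rw [h3] at hkeq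
        exact mul_right_cancel₀ (pow_ne_zero j hs0) (by linear_combination -hkeq))
      exact ⟨θ, Set.mem_biUnion (by
        simp only [hI, Finset.coe_product, Set.mem_prod, Finset.mem_coe]
        exact ⟨hj, hi, by simp, by simp; omega⟩) h1, h2⟩
    · obtain ⟨θ, h1, h2⟩ := hΘ (i, j, k, 0) h (Finset.mem_range.1 hj) y s hs (by
        simp only [pow_zero, one_mul]
        rw [norm_div, norm_mul, eq_div_iff haj]
        have h3 : ‖s‖ ^ j = ‖s‖ ^ i * ‖s‖ ^ (j - i) := by rw [← pow_add]; congr 1; omega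
        rw [h3] at hkeq
        exact mul_right_cancel₀ (pow_ne_zero i hs0) (by linear_combination hkeq))
      exact ⟨θ, Set.mem_biUnion (by
        simp only [hI, Finset.coe_product, Set.mem_prod, Finset.mem_coe]
        exact ⟨hi, hj, by simp; omega, by simp⟩) h1, h2⟩

lemma Ann.forall_finset {ι : Type*} {c : (ℕ → ℚ_[p]) → ℚ_[p]} (s : Finset ι)
    {W : ι → (ℕ → ℚ_[p]) → ℚ_[p] → Prop} (h : ∀ i ∈ s, Ann c (W i)) :
    Ann c fun y t => ∀ i ∈ s, W i y t := by
  classical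
  induction s using Finset.induction_on with
  | empty => exact (Ann.base SA.true).congr fun y t => by simp
  | insert a s _ ih =>
    refine ((h a (by simp)).and (ih fun i hi => h i (by simp [hi]))).congr fun y t => ?_
    simp

lemma eval_eq_sum_taylor {d : ℕ} {G : Polynomial ℚ_[p]} (hG : G.natDegree ≤ d) (c t : ℚ_[p]) :
    G.eval t = ∑ i ∈ Finset.range (d + 1), (Polynomial.taylor c G).coeff i * (t - c) ^ i := by
  rw [← Polynomial.eval_eq_sum_range' (by rw [Polynomial.natDegree_taylor]; omega),
    Polynomial.taylor_eval, sub_add_cancel]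

lemma cellDec_zero : CellDec p 0 := by
  refine fun P hP e he => Cov.single (c := fun _ => 0) ⟨Good.const 0, Ann.base SA.true, ?_⟩
  rintro F rfl
  refine ⟨_, 0, hP.coeff 0, fun y t _ => ?_⟩
  have := Polynomial.eq_C_of_natDegree_le_zero (hP.natDegree_le y)
  dsimp only
  rw [this]
  simpa using Near.refl e _

lemma cellDec_succ {d : ℕ} (hd : CellDec p d) : CellDec p (d + 1) := by
  intro P hP e he
  obtain ⟨E, hE1, hE⟩ := exists_coeff_le_of_derivative (p := p) d e
  refine Cov.bind (hd _ hP.derivative E hE1) fun c W hW => ?_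
  obtain ⟨hc, hWa, hWn⟩ := hW
  obtain ⟨h, ν, hh, hnear⟩ := hWn _ rfl
  have hA := hP.taylor hc
  set a := fun i y => (Polynomial.taylor (c y) (P y)).coeff i with ha
  obtain ⟨Θ, hΘfin, hΘg, hΘ⟩ := exists_centres hd hA e
  obtain ⟨R, -, hR⟩ := exists_int_reps (p := p) (E + e)
  have covc : Cov (Nice {fun y t => (P y).eval t} e) fun y t =>
      W y t ∧ ‖1 * (t - c y)‖ ≤ ‖(0 : ℚ_[p])‖ := by
    refine Cov.single (c := c) ⟨hc, hWa.and (Ann.ball (Good.const 1) (Good.const 0)), ?_⟩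
    rintro F rfl
    refine ⟨_, 0, hP.eval hc, ?_⟩
    rintro y t ⟨-, h1⟩
    have : t = c y := by simpa [sub_eq_zero] using h1
    simpa [this] using Near.refl e _
  have covi : Cov (Nice {fun y t => (P y).eval t} e) fun y t => ∃ i ∈ Finset.range (d + 2),
      W y t ∧ ∀ j ∈ Finset.range (d + 2), ‖(if j = i then 0 else a j y) * (t - c y) ^ j‖ ≤
        ‖((p : ℚ_[p]) ^ e * a i y) * (t - c y) ^ i‖ := by
    refine Cov.union (Finset.range (d + 2)).finite_toSet (fun i hi => ?_)
      fun y t h => h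
    refine Cov.single (c := c) ⟨hc, hWa.and (Ann.forall_finset _ fun j _ => Ann.mono ?_
      ((Good.const _).mul (hA.coeff i)) j i), ?_⟩
    · by_cases hji : j = i
      · simpa only [hji, if_true] using Good.const 0
      · simpa only [hji, if_false] using hA.coeff j
    rintro F rfl
    refine ⟨a i, i, hA.coeff i, ?_⟩
    rintro y t ⟨-, h1⟩
    dsimp only
    rw [eval_eq_sum_taylor (hP.natDegree_le y) (c y) t, ← Finset.add_sum_erase _ _ hi]
    refine Near.add_right_of_le (norm_sum_padic_le _ (norm_nonneg _) fun j hj => ?_)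
    rw [Finset.mem_erase] at hj
    have := h1 j hj.2
    rwa [if_neg hj.1, mul_assoc _ (a i y)] at this
  have covball : Cov (Nice {fun y t => (P y).eval t} e) fun y t => ∃ θr ∈ Θ ×ˢ (R : Set ℚ_[p]),
      (W y (c y + θr.2 * θr.1 y) ∧ θr.1 y ≠ 0 ∧ ‖θr.2‖ = 1) ∧
      ‖t - (c y + θr.2 * θr.1 y)‖ ≤ ‖(p : ℚ_[p]) ^ e * ((p : ℚ_[p]) ^ E * θr.1 y)‖ := by
    refine Cov.union (hΘfin.prod R.finite_toSet) ?_ fun y t h => h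
    rintro ⟨θ, r⟩ ⟨hθ, -⟩
    have hθ := hΘg θ hθ
    have hc' : Good fun y => c y + r * θ y := hc.add ((Good.const r).mul hθ)
    refine cov_ball (κ := fun y => h y * (r * θ y) ^ ν) hd he hE1 hE hP ((hc'.sa_ann hc hWa).and
      (hθ.sa_ne_zero.and (SA.const _))) hc' ((Good.const _).mul hθ) ?_ ?_
    · rintro y ⟨-, h1, -⟩
      exact mul_ne_zero (pow_ne_zero _ p_ne_zero) h1
    · rintro y ⟨h1, h2, h3⟩ t ht
      have h4 : Near E (t - c y) (r * θ y) := by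
        rw [Near, norm_mul _ (r * θ y), norm_mul r, h3, one_mul, ← norm_mul, sub_sub]
        exact ht
      have h5 : W y t := (hWa.iff_of_norm_eq (by rw [h4.norm_eq hE1, add_sub_cancel_left])).2 h1
      exact (hnear y t h5).trans ((h4.pow hE1 ν).mul_left _ hE1) hE1
  refine (covc.or (covi.or covball)).mono (fun _ _ h => h) fun y t hy => ?_
  by_cases hs : t - c y = 0
  · left
    exact ⟨hy, by simp [hs]⟩
  right
  rcases hΘ y _ hs with ⟨i, hi, h1⟩ | ⟨θ, hθ, h1⟩
  · left
    refine ⟨i, hi, hy, fun j hj => ?_⟩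
    by_cases hji : j = i
    · rw [if_pos hji, zero_mul, norm_zero]
      exact norm_nonneg _
    · rw [if_neg hji]
      exact h1 j hj hji
  · right
    have hθ0 : θ y ≠ 0 := by
      rw [← norm_ne_zero_iff, h1]
      exact norm_ne_zero_iff.2 hs
    have hu : ‖(t - c y) / θ y‖ = 1 := by rw [norm_div, h1, div_self (norm_ne_zero_iff.2 hs)]
    obtain ⟨r, hr, h2⟩ := hR _ hu.le
    have h3 : ‖r‖ = 1 := by
      rw [← hu]
      refine norm_eq_of_sub_lt ?_
      rw [norm_sub_rev, hu]
      exact h2.trans_lt (norm_pow_p_lt_one (by omega))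
    refine ⟨(θ, r), ⟨hθ, hr⟩, ⟨(hWa.iff_of_norm_eq ?_).1 hy, hθ0, h3⟩, ?_⟩
    · rw [add_sub_cancel_left, norm_mul, h3, one_mul, h1]
    · rw [← mul_assoc, ← pow_add, add_comm e, norm_mul,
        show t - (c y + r * θ y) = ((t - c y) / θ y - r) * θ y by field_simp; ring, norm_mul]
      exact mul_le_mul_of_nonneg_right h2 (norm_nonneg _)

theorem cellDec (d : ℕ) : CellDec p d := by
  induction d with
  | zero => exact cellDec_zero
  | succ d ih => exact cellDec_succ ih

/-! ### Cell decomposition for finitely many polynomials -/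

section Merge

variable {e : ℕ} {c c₁ c₂ c₃ k : (ℕ → ℚ_[p]) → ℚ_[p]} {V W W₁ W₂ : (ℕ → ℚ_[p]) → ℚ_[p] → Prop}
  {𝓕 𝓖 : Set ((ℕ → ℚ_[p]) → ℚ_[p] → ℚ_[p])}

lemma Ann.transfer (h : Ann c₁ W) (he : 1 ≤ e) (hk : Good k) (μ : ℕ)
    (hn : ∀ y t, V y t → Near e (t - c₁ y) (k y * (t - c₃ y) ^ μ)) :
    ∃ W', Ann c₃ W' ∧ ∀ y t, V y t → (W y t ↔ W' y t) := by
  induction h with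
  | base hB => exact ⟨_, Ann.base hB, fun _ _ _ => Iff.rfl⟩
  | @mono l a hl ha i j =>
    refine ⟨_, Ann.mono (hl.mul (hk.pow i)) (ha.mul (hk.pow j)) (μ * i) (μ * j),
      fun y t hy => ?_⟩
    simp only [norm_mul, norm_pow, (hn y t hy).norm_eq he, mul_pow, pow_mul, mul_assoc]
  | and _ _ ih1 ih2 =>
    obtain ⟨W1, h1, h2⟩ := ih1
    obtain ⟨W2, h3, h4⟩ := ih2
    exact ⟨_, h1.and h3, fun y t hy => and_congr (h2 y t hy) (h4 y t hy)⟩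

lemma Nice.transfer (h : Nice 𝓕 e c₁ W) (he : 1 ≤ e) (hc : Good c₃) (hV : Ann c₃ V) (hk : Good k)
    (μ : ℕ) (hn : ∀ y t, V y t → Near e (t - c₁ y) (k y * (t - c₃ y) ^ μ)) :
    Nice 𝓕 e c₃ fun y t => W y t ∧ V y t := by
  refine ⟨hc, ?_, fun F hF => ?_⟩
  · obtain ⟨W', h1, h2⟩ := h.ann.transfer he hk μ hn
    exact (h1.and hV).congr fun y t => and_congr_left fun hy => (h2 y t hy).symm
  · obtain ⟨l, ν, hl, h1⟩ := h.nearOn F hF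
    refine ⟨fun y => l y * k y ^ ν, μ * ν, hl.mul (hk.pow ν), fun y t hy => ?_⟩
    rw [pow_mul, mul_assoc, ← mul_pow]
    exact (h1 y t hy.1).trans (((hn y t hy.2).pow he ν).mul_left _ he) he

lemma Nice.inter (h₁ : Nice 𝓕 e c W₁) (h₂ : Nice 𝓖 e c W₂) :
    Nice (𝓕 ∪ 𝓖) e c fun y t => W₁ y t ∧ W₂ y t := by
  refine ⟨h₁.good, h₁.ann.and h₂.ann, ?_⟩
  rintro F (hF | hF)
  · obtain ⟨l, ν, hl, h⟩ := h₁.nearOn F hF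
    exact ⟨l, ν, hl, fun y t hy => h y t hy.1⟩
  · obtain ⟨l, ν, hl, h⟩ := h₂.nearOn F hF
    exact ⟨l, ν, hl, fun y t hy => h y t hy.2⟩

lemma Nice.merge_single (h₁ : Nice 𝓕 e c₁ W₁) (h₂ : Nice 𝓖 e c₂ W₂) (he : 1 ≤ e) (hc : Good c₃)
    (hV : Ann c₃ V) {k₁ k₂ : (ℕ → ℚ_[p]) → ℚ_[p]} (hk₁ : Good k₁) (hk₂ : Good k₂) (μ₁ μ₂ : ℕ)
    (hn : ∀ y t, V y t → Near e (t - c₁ y) (k₁ y * (t - c₃ y) ^ μ₁) ∧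
      Near e (t - c₂ y) (k₂ y * (t - c₃ y) ^ μ₂)) :
    Cov (Nice (𝓕 ∪ 𝓖) e) fun y t => (W₁ y t ∧ W₂ y t) ∧ V y t :=
  (Cov.single ((h₁.transfer he hc hV hk₁ μ₁ fun y t hy => (hn y t hy).1).inter
    (h₂.transfer he hc hV hk₂ μ₂ fun y t hy => (hn y t hy).2))).mono (fun _ _ h => h)
    fun _ _ hy => ⟨⟨hy.1.1, hy.2⟩, hy.1.2, hy.2⟩

lemma Nice.merge (h₁ : Nice 𝓕 e c₁ W₁) (h₂ : Nice 𝓖 e c₂ W₂) (he : 1 ≤ e) :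
    Cov (Nice (𝓕 ∪ 𝓖) e) fun y t => W₁ y t ∧ W₂ y t := by
  have hc₁ := h₁.good
  have hc₂ := h₂.good
  have hΔ := hc₁.sub hc₂
  have hpe := Good.const ((p : ℚ_[p]) ^ e)
  obtain ⟨R, -, hR⟩ := exists_int_reps (p := p) (3 * e)
  have r1 := h₁.merge_single h₂ he (V := fun y t => ‖c₁ y - c₂ y‖ ≤ ‖(p : ℚ_[p]) ^ e * (t - c₁ y)‖)
    hc₁ (Ann.coball hpe hΔ) (Good.const 1) (Good.const 1) 1 1 fun y t hy => by
      rw [one_mul, pow_one]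
      refine ⟨Near.refl _ _, ?_⟩
      have := Near.add_right_of_le hy
      rwa [sub_add_sub_cancel] at this
  have r2 := h₁.merge_single h₂ he
    (V := fun y t => ‖1 * (t - c₁ y)‖ ≤ ‖(p : ℚ_[p]) ^ e * (c₁ y - c₂ y)‖)
    hc₁ (Ann.ball (Good.const 1) (hpe.mul hΔ)) (Good.const 1) hΔ 1 0 fun y t hy => by
      rw [one_mul] at hy
      rw [one_mul, pow_one, pow_zero, mul_one]
      refine ⟨Near.refl _ _, ?_⟩
      have := Near.add_right_of_le hy
      rwa [add_comm, sub_add_sub_cancel] at this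
  have r3 := h₁.merge_single h₂ he
    (V := fun y t => ‖1 * (t - c₂ y)‖ ≤ ‖(p : ℚ_[p]) ^ e * (c₁ y - c₂ y)‖)
    hc₂ (Ann.ball (Good.const 1) (hpe.mul hΔ)) hΔ.neg (Good.const 1) 0 1 fun y t hy => by
      rw [one_mul] at hy
      rw [one_mul, pow_one, pow_zero, mul_one]
      refine ⟨?_, Near.refl _ _⟩
      rw [← norm_neg ((p : ℚ_[p]) ^ e * _), ← mul_neg] at hy
      have := Near.add_right_of_le hy
      rwa [show -(c₁ y - c₂ y) + (t - c₂ y) = t - c₁ y by ring] at this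
  have r4 : ∀ r ∈ R, Cov (Nice (𝓕 ∪ 𝓖) e) _ := fun r _ => h₁.merge_single h₂ he
    (c₃ := fun y => c₁ y + ((p : ℚ_[p]) ^ e)⁻¹ * r * (c₁ y - c₂ y))
    (k₁ := fun y => c₁ y + ((p : ℚ_[p]) ^ e)⁻¹ * r * (c₁ y - c₂ y) - c₁ y)
    (k₂ := fun y => c₁ y + ((p : ℚ_[p]) ^ e)⁻¹ * r * (c₁ y - c₂ y) - c₂ y)
    (V := fun y t => (‖(p : ℚ_[p]) ^ e * (c₁ y - c₂ y)‖ ≤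
      ‖c₁ y + ((p : ℚ_[p]) ^ e)⁻¹ * r * (c₁ y - c₂ y) - c₁ y‖ ∧
      ‖(p : ℚ_[p]) ^ e * (c₁ y - c₂ y)‖ ≤
      ‖c₁ y + ((p : ℚ_[p]) ^ e)⁻¹ * r * (c₁ y - c₂ y) - c₂ y‖) ∧
      ‖1 * (t - (c₁ y + ((p : ℚ_[p]) ^ e)⁻¹ * r * (c₁ y - c₂ y)))‖ ≤
        ‖(p : ℚ_[p]) ^ (2 * e) * (c₁ y - c₂ y)‖)
    (hc₁.add ((Good.const _).mul hΔ))
    ((Ann.base (((hpe.mul hΔ).sa_norm_le ((hc₁.add ((Good.const _).mul hΔ)).sub hc₁)).and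
      ((hpe.mul hΔ).sa_norm_le ((hc₁.add ((Good.const _).mul hΔ)).sub hc₂)))).and
      (Ann.ball (Good.const 1) ((Good.const _).mul hΔ)))
    ((hc₁.add ((Good.const _).mul hΔ)).sub hc₁) ((hc₁.add ((Good.const _).mul hΔ)).sub hc₂)
    0 0 fun y t => by
      rintro ⟨⟨h3, h4⟩, h5⟩
      set c := c₁ y + ((p : ℚ_[p]) ^ e)⁻¹ * r * (c₁ y - c₂ y)
      rw [one_mul, two_mul, pow_add, mul_assoc, norm_mul _ ((p : ℚ_[p]) ^ e * _)] at h5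
      rw [pow_zero, mul_one, mul_one]
      have key : ∀ x, ‖(p : ℚ_[p]) ^ e * (c₁ y - c₂ y)‖ ≤ ‖c - x‖ → Near e (t - x) (c - x) := by
        intro x hx
        have h6 : ‖t - c‖ ≤ ‖(p : ℚ_[p]) ^ e * (c - x)‖ := by
          rw [norm_mul _ (c - x)]
          exact h5.trans (mul_le_mul_of_nonneg_left hx (norm_nonneg _))
        have := Near.add_right_of_le h6
        rwa [show c - x + (t - c) = t - x by ring] at this
      exact ⟨key _ h3, key _ h4⟩
  refine ((r1.or r2).or (r3.or (Cov.union R.finite_toSet r4 fun y t h => h))).mono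
    (fun _ _ h => h) fun y t hy => ?_
  by_cases h1 : ‖c₁ y - c₂ y‖ ≤ ‖(p : ℚ_[p]) ^ e * (t - c₁ y)‖
  · exact Or.inl (Or.inl ⟨hy, h1⟩)
  by_cases h2 : ‖1 * (t - c₁ y)‖ ≤ ‖(p : ℚ_[p]) ^ e * (c₁ y - c₂ y)‖
  · exact Or.inl (Or.inr ⟨hy, h2⟩)
  by_cases h3 : ‖1 * (t - c₂ y)‖ ≤ ‖(p : ℚ_[p]) ^ e * (c₁ y - c₂ y)‖
  · exact Or.inr (Or.inl ⟨hy, h3⟩)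
  right
  right
  rw [one_mul, not_le] at h2 h3
  rw [not_le] at h1
  set Δ := c₁ y - c₂ y with hΔd
  have hΔ0 : Δ ≠ 0 := by
    rintro h
    rw [h, norm_zero] at h1
    exact (norm_nonneg _).not_gt h1
  have hp := pow_ne_zero e (p_ne_zero (p := p))
  obtain ⟨r, hr, hz⟩ := hR ((p : ℚ_[p]) ^ e * (t - c₁ y) / Δ) (by
    rw [norm_div, div_le_one (norm_pos_iff.2 hΔ0)]
    exact h1.le)
  have h5 : ‖t - (c₁ y + ((p : ℚ_[p]) ^ e)⁻¹ * r * Δ)‖ ≤ ‖(p : ℚ_[p]) ^ (2 * e) * Δ‖ := by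
    rw [show t - (c₁ y + ((p : ℚ_[p]) ^ e)⁻¹ * r * Δ) = ((p : ℚ_[p]) ^ e)⁻¹ * Δ *
      ((p : ℚ_[p]) ^ e * (t - c₁ y) / Δ - r) by field_simp; ring, norm_mul]
    refine (mul_le_mul_of_nonneg_left hz (norm_nonneg _)).trans_eq ?_
    rw [← norm_mul]
    congr 1
    rw [show 3 * e = e + 2 * e by ring, pow_add]
    field_simp
  have key : ∀ x, ‖(p : ℚ_[p]) ^ e * Δ‖ < ‖t - x‖ →
      ‖(p : ℚ_[p]) ^ e * Δ‖ ≤ ‖c₁ y + ((p : ℚ_[p]) ^ e)⁻¹ * r * Δ - x‖ := by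
    intro x hx
    refine hx.le.trans_eq (norm_eq_of_sub_lt ?_).symm
    rw [sub_sub_sub_cancel_right, norm_sub_rev]
    refine (h5.trans ?_).trans_lt hx
    rw [norm_mul, norm_mul]
    exact mul_le_mul_of_nonneg_right (norm_pow_p_le (by omega)) (norm_nonneg _)
  exact ⟨r, hr, hy, ⟨key _ h2, key _ h3⟩, by rwa [one_mul]⟩

lemma Cov.nice_union (he : 1 ≤ e) {D : (ℕ → ℚ_[p]) → ℚ_[p] → Prop} (h₁ : Cov (Nice 𝓕 e) D)
    (h₂ : Cov (Nice 𝓖 e) D) : Cov (Nice (𝓕 ∪ 𝓖) e) D := by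
  obtain ⟨S, hS, hS1, hS2⟩ := h₁
  obtain ⟨T, hT, hT1, hT2⟩ := h₂
  refine Cov.union (hS.prod hT) (E := fun st y t => st.1.2 y t ∧ st.2.2 y t)
    (fun st hst => (hS1 _ hst.1).merge (hT1 _ hst.2) he) fun y t hy => ?_
  obtain ⟨s, hs, h1⟩ := hS2 y t hy
  obtain ⟨t', ht, h2⟩ := hT2 y t hy
  exact ⟨(s, t'), ⟨hs, ht⟩, h1, h2⟩

/-- Simultaneous cell decomposition for finitely many polynomials in `t`. -/
lemma cov_nice (he : 1 ≤ e) (h𝓕 : 𝓕.Finite)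
    (h : ∀ F ∈ 𝓕, ∃ d P, GoodPoly d P ∧ F = fun y t => (P y).eval t) :
    Cov (Nice 𝓕 e) fun _ _ => True := by
  induction 𝓕, h𝓕 using Set.Finite.induction_on with
  | empty => exact Cov.single (c := fun _ => 0) ⟨Good.const 0, Ann.base SA.true, by simp⟩
  | @insert F s _ _ ih =>
    rw [Set.insert_eq]
    refine Cov.nice_union he ?_ (ih fun G hG => h G (Set.mem_insert_of_mem _ hG))
    obtain ⟨d, P, hP, rfl⟩ := h F (Set.mem_insert _ _)
    exact cellDec d P hP e he

end Merge

/-! ### Elimination of one quantifier -/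

lemma SA.exists_decide {B : (ℕ → ℚ_[p]) → Prop} (hB : SA B) :
    ∃ 𝓕 : Set ((ℕ → ℚ_[p]) → ℚ_[p] → ℚ_[p]), 𝓕.Finite ∧
      (∀ F ∈ 𝓕, ∃ d P, GoodPoly d P ∧ F = fun y t => (P y).eval t) ∧ ∃ N₀, 0 < N₀ ∧ ∃ e₀,
      ∀ e, e₀ ≤ e → ∀ c W, Nice 𝓕 e c W → ∀ N, N₀ ∣ N → ∀ l : ℚ_[p], l ≠ 0 → ∃ B', SA B' ∧
        ∀ y t, W y t → IsPow N (l * (t - c y)) → (B (pcons t y) ↔ B' y) := by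
  induction hB with
  | basic Q n hn =>
    obtain ⟨d, P, hP, hPQ⟩ := exists_goodPoly Q
    obtain ⟨e₀, -, he₀⟩ := exists_isPow_congr (p := p) n hn
    refine ⟨{fun y t => (P y).eval t}, Set.finite_singleton _, ?_, n, hn, e₀, ?_⟩
    · rintro F rfl
      exact ⟨d, P, hP, rfl⟩
    intro e he c W hW N hN l hl
    obtain ⟨h, ν, hh, hnear⟩ := hW.nearOn _ rfl
    refine ⟨_, (hh.mul (Good.const (l⁻¹ ^ ν))).sa_isPow hn, fun y t hy hp => ?_⟩
    dsimp only
    rw [← hPQ, he₀ e he _ _ (hnear y t hy),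
      ← isPow_mul_iff (b := h y * l⁻¹ ^ ν) ((hp.of_dvd hN).pow ν)]
    rw [show (l * (t - c y)) ^ ν * (h y * l⁻¹ ^ ν) = h y * (t - c y) ^ ν by
      rw [mul_pow, inv_pow]; field_simp]
  | not _ ih =>
    obtain ⟨𝓕, h1, h2, N₀, h3, e₀, h4⟩ := ih
    refine ⟨𝓕, h1, h2, N₀, h3, e₀, fun e he c W hW N hN l hl => ?_⟩
    obtain ⟨B', h5, h6⟩ := h4 e he c W hW N hN l hl
    exact ⟨_, h5.not, fun y t hy hp => not_congr (h6 y t hy hp)⟩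
  | and _ _ ih ih' =>
    obtain ⟨𝓕, h1, h2, N₀, h3, e₀, h4⟩ := ih
    obtain ⟨𝓖, h1', h2', N₀', h3', e₀', h4'⟩ := ih'
    refine ⟨𝓕 ∪ 𝓖, h1.union h1', fun F hF => hF.elim (h2 F) (h2' F), N₀ * N₀', by positivity,
      max e₀ e₀', fun e he c W hW N hN l hl => ?_⟩
    obtain ⟨B', h5, h6⟩ := h4 e ((le_max_left _ _).trans he) c W
      ⟨hW.good, hW.ann, fun F hF => hW.nearOn F (Or.inl hF)⟩ N (dvd_of_mul_right_dvd hN) l hl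
    obtain ⟨C', h5', h6'⟩ := h4' e ((le_max_right _ _).trans he) c W
      ⟨hW.good, hW.ann, fun F hF => hW.nearOn F (Or.inr hF)⟩ N (dvd_of_mul_left_dvd hN) l hl
    exact ⟨_, h5.and h5', fun y t hy hp => and_congr (h6 y t hy hp) (h6' y t hy hp)⟩

lemma Ann.exists_normal_form {c : (ℕ → ℚ_[p]) → ℚ_[p]} {W : (ℕ → ℚ_[p]) → ℚ_[p] → Prop}
    (h : Ann c W) : ∃ (B : (ℕ → ℚ_[p]) → Prop) (b u : (ℕ → ℚ_[p]) → ℚ_[p]) (M : ℕ), 0 < M ∧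
      SA B ∧ Good b ∧ Good u ∧ ∀ y t, t - c y ≠ 0 →
        (W y t ↔ B y ∧ ‖b y‖ ≤ ‖t - c y‖ ^ M ∧ ‖u y‖ * ‖t - c y‖ ^ M ≤ 1) := by
  induction h with
  | @base B hB =>
    exact ⟨B, fun _ => 0, fun _ => 0, 1, one_pos, hB, Good.const 0, Good.const 0,
      fun y t _ => by simp⟩
  | @mono k a hk ha i j =>
    have hB : SA fun y => a y ≠ 0 ∨ k y = 0 := ha.sa_ne_zero.or hk.sa_eq_zero
    have hk0 : ∀ (y : ℕ → ℚ_[p]) (q : ℝ), 0 < q → (‖k y‖ * q ≤ 0 ↔ k y = 0) := fun y q hq => by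
      rw [mul_nonpos_iff_pos_imp_nonpos]
      simp [hq.not_ge]
    rcases lt_trichotomy i j with hij | rfl | hij
    · refine ⟨_, fun y => k y / a y, fun _ => 0, j - i, by omega, hB, hk.div ha, Good.const 0,
        fun y t hs => ?_⟩
      have hs' : 0 < ‖t - c y‖ := norm_pos_iff.2 hs
      have h3 : ‖t - c y‖ ^ j = ‖t - c y‖ ^ i * ‖t - c y‖ ^ (j - i) := by
        rw [← pow_add]; congr 1; omega
      dsimp only
      rw [norm_mul, norm_mul, norm_pow, norm_pow, h3]
      by_cases h0 : a y = 0
      · simpa [h0] using hk0 y _ (by positivity)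
      · have ha' : 0 < ‖a y‖ := norm_pos_iff.2 h0
        simp only [h0, ne_eq, not_false_eq_true, true_or, norm_div, norm_zero, zero_mul,
          zero_le_one, and_true, true_and]
        rw [div_le_iff₀ ha', show ‖a y‖ * (‖t - c y‖ ^ i * ‖t - c y‖ ^ (j - i)) =
          ‖t - c y‖ ^ (j - i) * ‖a y‖ * ‖t - c y‖ ^ i by ring,
          mul_le_mul_iff_left₀ (pow_pos hs' i)]
    · refine ⟨_, fun _ => 0, fun _ => 0, 1, one_pos, hk.sa_norm_le ha, Good.const 0, Good.const 0,
        fun y t hs => ?_⟩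
      have hs' : 0 < ‖t - c y‖ := norm_pos_iff.2 hs
      dsimp only
      rw [norm_mul, norm_mul, norm_pow, mul_le_mul_iff_left₀ (pow_pos hs' i)]
      simp
    · refine ⟨_, fun _ => 0, fun y => k y / a y, i - j, by omega, hB, Good.const 0, hk.div ha,
        fun y t hs => ?_⟩
      have hs' : 0 < ‖t - c y‖ := norm_pos_iff.2 hs
      have h3 : ‖t - c y‖ ^ i = ‖t - c y‖ ^ j * ‖t - c y‖ ^ (i - j) := by
        rw [← pow_add]; congr 1; omega
      dsimp only
      rw [norm_mul, norm_mul, norm_pow, norm_pow, h3]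
      by_cases h0 : a y = 0
      · simpa [h0] using hk0 y _ (by positivity)
      · have ha' : 0 < ‖a y‖ := norm_pos_iff.2 h0
        simp only [h0, ne_eq, not_false_eq_true, true_or, norm_div, norm_zero,
          true_and]
        rw [div_mul_eq_mul_div, div_le_one ha', show ‖k y‖ * (‖t - c y‖ ^ j *
          ‖t - c y‖ ^ (i - j)) = ‖k y‖ * ‖t - c y‖ ^ (i - j) * ‖t - c y‖ ^ j by ring,
          mul_le_mul_iff_left₀ (pow_pos hs' j)]
        simp only [pow_nonneg (norm_nonneg _), true_and]
  | and _ _ ih ih' =>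
    obtain ⟨B, b, u, M, hM, hB, hb, hu, h⟩ := ih
    obtain ⟨B', b', u', M', hM', hB', hb', hu', h'⟩ := ih'
    have hbM := hb.pow M'
    have hbM' := hb'.pow M
    have huM := hu.pow M'
    have huM' := hu'.pow M
    refine ⟨_, _, _, M * M', by positivity, hB.and hB',
      Good.ite (hbM.sa_norm_le hbM') hbM' hbM, Good.ite (huM.sa_norm_le huM') huM' huM,
      fun y t hs => ?_⟩
    have e1 : ∀ (f f' : (ℕ → ℚ_[p]) → ℚ_[p]), ‖if ‖f y‖ ≤ ‖f' y‖ then f' y else f y‖ =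
        max ‖f y‖ ‖f' y‖ := fun f f' => by
      split_ifs with h
      · rw [max_eq_right h]
      · rw [max_eq_left (not_le.1 h).le]
    have e2 := e1 (fun y => b y ^ M') (fun y => b' y ^ M)
    have e3 := e1 (fun y => u y ^ M') (fun y => u' y ^ M)
    dsimp only at e2 e3 ⊢
    rw [h y t hs, h' y t hs, e2, e3, max_le_iff, max_mul_of_nonneg _ _ (by positivity), max_le_iff]
    have p1 : ‖b y ^ M'‖ ≤ ‖t - c y‖ ^ (M * M') ↔ ‖b y‖ ≤ ‖t - c y‖ ^ M := by
      rw [norm_pow, pow_mul, pow_le_pow_iff_left₀ (norm_nonneg _) (by positivity) hM'.ne']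
    have p2 : ‖b' y ^ M‖ ≤ ‖t - c y‖ ^ (M * M') ↔ ‖b' y‖ ≤ ‖t - c y‖ ^ M' := by
      rw [norm_pow, mul_comm M, pow_mul,
        pow_le_pow_iff_left₀ (norm_nonneg _) (by positivity) hM.ne']
    have p3 : ‖u y ^ M'‖ * ‖t - c y‖ ^ (M * M') ≤ 1 ↔ ‖u y‖ * ‖t - c y‖ ^ M ≤ 1 := by
      rw [norm_pow, pow_mul, ← mul_pow, pow_le_one_iff_of_nonneg (by positivity) hM'.ne']
    have p4 : ‖u' y ^ M‖ * ‖t - c y‖ ^ (M * M') ≤ 1 ↔ ‖u' y‖ * ‖t - c y‖ ^ M' ≤ 1 := by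
      rw [norm_pow, mul_comm M, pow_mul, ← mul_pow, pow_le_one_iff_of_nonneg (by positivity) hM.ne']
    rw [p1, p2, p3, p4]
    tauto

lemma exists_isPow_norm_le_iff {N M : ℕ} (hN : 0 < N) (hM : 0 < M) {r : ℚ_[p]} (hr : r ≠ 0)
    {R : Finset ℚ_[p]} (hR1 : ∀ ρ ∈ R, ‖ρ‖ = 1)
    (hR : ∀ u : ℚ_[p], ‖u‖ = 1 → ∃ ρ ∈ R, IsPow (N * M) (ρ * u)) (b u : ℚ_[p]) :
    (∃ s, IsPow N (r * s) ∧ ‖b‖ ≤ ‖s‖ ^ M ∧ ‖u‖ * ‖s‖ ^ M ≤ 1) ↔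
      u = 0 ∨ ∃ j ∈ Finset.range (N * M), ∃ ρ ∈ R,
        IsPow (N * M) (ρ * ((p : ℚ_[p]) ^ j)⁻¹ * (r ^ M)⁻¹ * u) ∧
          ‖b * u‖ ≤ ‖(p : ℚ_[p]) ^ j‖ := by
  have hp0 := p_ne_zero (p := p)
  have hp1 := norm_p_lt_one (p := p)
  have hpp : 0 < ‖(p : ℚ_[p])‖ := norm_pos_iff.2 hp0
  have hrM : ‖r‖ ^ M ≠ 0 := pow_ne_zero _ (norm_ne_zero_iff.2 hr)
  constructor
  · rintro ⟨s, ⟨hs0, z, hz⟩, h1, h2⟩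
    by_cases hu : u = 0
    · exact Or.inl hu
    right
    have hz0 : z ≠ 0 := by
      rintro rfl
      rw [zero_pow hN.ne'] at hz
      exact hs0 hz.symm
    set w := (r ^ M)⁻¹ * u with hw
    have hw0 : w ≠ 0 := mul_ne_zero (inv_ne_zero (pow_ne_zero _ hr)) hu
    have hL : (0 : ℤ) < (N * M : ℕ) := by positivity
    have hv := norm_eq_zpow w hw0
    set q := w.valuation / (N * M : ℕ) with hq
    have hj0 := Int.emod_nonneg w.valuation hL.ne'
    have hj1 := Int.emod_lt_of_pos w.valuation hL
    have hdiv := Int.emod_add_mul_ediv w.valuation (N * M : ℕ)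
    obtain ⟨j, hj⟩ := Int.eq_ofNat_of_zero_le hj0
    rw [← hq, hj] at hdiv
    rw [hj] at hj1
    have hv' : ‖w‖ = ‖(p : ℚ_[p])‖ ^ j * (‖(p : ℚ_[p])‖ ^ q) ^ (N * M) := by
      rw [hv, ← hdiv, zpow_add₀ hpp.ne', zpow_natCast, mul_comm ((N * M : ℕ) : ℤ), zpow_mul,
        zpow_natCast]
    set x := (p : ℚ_[p]) ^ q with hx
    have hx0 : x ≠ 0 := zpow_ne_zero _ hp0
    obtain ⟨ρ, hρ, h3⟩ := hR (w * ((p : ℚ_[p]) ^ j)⁻¹ * (x ^ (N * M))⁻¹) (by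
      rw [norm_mul, norm_mul, norm_inv, norm_inv, norm_pow, norm_pow, hx, norm_zpow, hv']
      field_simp)
    refine ⟨j, Finset.mem_range.2 (by exact_mod_cast hj1), ρ, hρ, ?_, ?_⟩
    · have h4 := (isPow_pow hx0 (N * M)).mul h3
      rwa [show x ^ (N * M) * (ρ * (w * ((p : ℚ_[p]) ^ j)⁻¹ * (x ^ (N * M))⁻¹)) =
        ρ * ((p : ℚ_[p]) ^ j)⁻¹ * (r ^ M)⁻¹ * u by rw [hw]; field_simp] at h4
    · have h5 : ‖u‖ * ‖s‖ ^ M = ‖(p : ℚ_[p])‖ ^ ((j : ℤ) + (N * M : ℕ) * (q + z.valuation)) := by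
        have h6 : ‖u‖ * ‖s‖ ^ M = ‖w‖ * ‖z‖ ^ (N * M) := by
          rw [pow_mul, ← norm_pow z N, hz, hw, norm_mul, norm_mul, norm_inv, norm_pow, mul_pow]
          field_simp
        rw [h6, hv, norm_eq_zpow z hz0, ← zpow_natCast, ← zpow_mul, ← zpow_add₀ hpp.ne', ← hdiv]
        congr 1
        ring
      have h7 : 0 ≤ q + z.valuation := by
        rw [h5, zpow_le_one_iff_right_of_lt_one₀ hpp hp1] at h2
        by_contra! h
        nlinarith
      have h8 : ‖b * u‖ ≤ ‖u‖ * ‖s‖ ^ M := by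
        rw [norm_mul, mul_comm]
        exact mul_le_mul_of_nonneg_left h1 (norm_nonneg _)
      refine h8.trans ?_
      rw [h5, norm_pow, ← zpow_natCast]
      refine zpow_le_zpow_right_of_le_one₀ hpp hp1.le ?_
      nlinarith
  · rintro (rfl | ⟨j, -, ρ, hρ, ⟨h1, z, hz⟩, h2⟩)
    · obtain ⟨k, hk⟩ := exists_pow_norm_lt (p := p) (r := 1 / ((1 + ‖b‖) * ‖r‖ ^ M)) (by
        have := norm_pos_iff.2 hr
        positivity)
      have hr' := norm_pos_iff.2 hr
      refine ⟨r⁻¹ * (((p : ℚ_[p]) ^ k)⁻¹) ^ N, ?_, ?_, by simp⟩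
      · rw [mul_inv_cancel_left₀ hr]
        exact isPow_pow (inv_ne_zero (pow_ne_zero _ hp0)) N
      · have h3 : 1 + ‖b‖ ≤ (‖(p : ℚ_[p]) ^ k‖ * ‖r‖ ^ M)⁻¹ := by
          rw [lt_div_iff₀ (by positivity)] at hk
          have h4 := norm_pow_p_pos (p := p) k
          rw [le_inv_comm₀ (by positivity) (by positivity), ← one_div, le_div_iff₀ (by positivity)]
          linarith
        have h5 : ‖(p : ℚ_[p]) ^ k‖ ^ (N * M) ≤ ‖(p : ℚ_[p]) ^ k‖ :=
          pow_le_of_le_one (norm_nonneg _) (norm_pow_p_le_one k) (by positivity)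
        have h6 := norm_pow_p_pos (p := p) k
        have h7 : ‖r⁻¹ * (((p : ℚ_[p]) ^ k)⁻¹) ^ N‖ ^ M =
            (‖(p : ℚ_[p]) ^ k‖ ^ (N * M) * ‖r‖ ^ M)⁻¹ := by
          rw [norm_mul, norm_inv, norm_pow, norm_inv, mul_pow, ← pow_mul, inv_pow, inv_pow,
            ← mul_inv, mul_comm]
        rw [h7]
        refine le_trans ?_ (inv_anti₀ (by positivity)
          (mul_le_mul_of_nonneg_right h5 (by positivity)))
        linarith
    · have hz0 : z ≠ 0 := by
        rintro rfl
        rw [zero_pow (by positivity)] at hz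
        exact h1 hz.symm
      have hu : u ≠ 0 := right_ne_zero_of_mul h1
      have hρ0 : ρ ≠ 0 := left_ne_zero_of_mul (left_ne_zero_of_mul (left_ne_zero_of_mul h1))
      have hu' := norm_pos_iff.2 hu
      have hnorm : ‖u‖ * ‖r⁻¹ * z⁻¹ ^ N‖ ^ M = ‖(p : ℚ_[p]) ^ j‖ := by
        have h3 : ‖z‖ ^ (N * M) = ‖(p : ℚ_[p]) ^ j‖⁻¹ * (‖r‖ ^ M)⁻¹ * ‖u‖ := by
          rw [← norm_pow, hz, norm_mul, norm_mul, norm_mul, hR1 ρ hρ, norm_inv, norm_inv,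
            norm_pow r, one_mul]
        have h6 := norm_pow_p_pos (p := p) j
        rw [norm_mul, norm_pow, norm_inv, norm_inv, mul_pow, ← pow_mul, inv_pow, inv_pow, h3]
        field_simp
      refine ⟨r⁻¹ * z⁻¹ ^ N, ?_, ?_, hnorm.trans_le (norm_pow_p_le_one j)⟩
      · rw [mul_inv_cancel_left₀ hr]
        exact isPow_pow (inv_ne_zero hz0) N
      · rw [← hnorm, norm_mul, mul_comm] at h2
        exact le_of_mul_le_mul_left h2 hu'

lemma Ann.sa_exists {c : (ℕ → ℚ_[p]) → ℚ_[p]} {W : (ℕ → ℚ_[p]) → ℚ_[p] → Prop} (hW : Ann c W)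
    {N : ℕ} (hN : 0 < N) {r : ℚ_[p]} (hr : r ≠ 0) :
    SA fun y => ∃ t, W y t ∧ IsPow N (r * (t - c y)) := by
  obtain ⟨B, b, u, M, hM, hB, hb, hu, h⟩ := hW.exists_normal_form
  obtain ⟨R, hR1, hR⟩ := exists_unit_reps (p := p) (N * M) (by positivity)
  have h1 : SA fun y => B y ∧ (u y = 0 ∨ ∃ j ∈ Finset.range (N * M), ∃ ρ ∈ R,
        IsPow (N * M) (ρ * ((p : ℚ_[p]) ^ j)⁻¹ * (r ^ M)⁻¹ * u y) ∧
          ‖b y * u y‖ ≤ ‖(p : ℚ_[p]) ^ j‖) :=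
    hB.and (hu.sa_eq_zero.or (SA.exists_finset _ fun j _ => SA.exists_finset _ fun ρ _ =>
      (((Good.const _).mul hu).sa_isPow (by positivity)).and
        ((hb.mul hu).sa_norm_le (Good.const _))))
  refine h1.congr fun y => ?_
  rw [← exists_isPow_norm_le_iff hN hM hr hR1 hR]
  constructor
  · rintro ⟨h2, s, h3, h4⟩
    have h5 : s ≠ 0 := right_ne_zero_of_mul h3.1
    exact ⟨c y + s, (h y _ (by simpa using h5)).2 ⟨h2, by simpa using h4⟩, by simpa using h3⟩
  · rintro ⟨t, h2, h3⟩
    obtain ⟨h4, h5⟩ := (h y t (right_ne_zero_of_mul h3.1)).1 h2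
    exact ⟨h4, t - c y, h3, h5⟩

/-- Projections of semialgebraic sets are semialgebraic. -/
theorem SA.exists {B : (ℕ → ℚ_[p]) → Prop} (hB : SA B) : SA fun y => ∃ t, B (pcons t y) := by
  obtain ⟨𝓕, hfin, hpoly, N, hN, e₀, h⟩ := hB.exists_decide
  obtain ⟨S, hS, hS1, hS2⟩ := cov_nice (e := e₀ + 1) (by omega) hfin hpoly
  obtain ⟨R, hR0, hR⟩ := exists_pow_reps (p := p) N hN
  have h1 : ∀ s ∈ S, ∀ r ∈ R, ∃ B', SA B' ∧ ∀ y t, s.2 y t → IsPow N (r * (t - s.1 y)) →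
      (B (pcons t y) ↔ B' y) := fun s hs r hr =>
    h (e₀ + 1) (by omega) _ _ (hS1 s hs) N dvd_rfl r (hR0 r hr)
  have h2 : ∀ s ∈ S, ∀ r ∈ R, SA fun y => ∃ t, s.2 y t ∧ IsPow N (r * (t - s.1 y)) ∧
      B (pcons t y) := by
    intro s hs r hr
    obtain ⟨B', h3, h4⟩ := h1 s hs r hr
    refine (((hS1 s hs).ann.sa_exists hN (hR0 r hr)).and h3).congr fun y => ?_
    constructor
    · rintro ⟨⟨t, h5, h6⟩, h7⟩
      exact ⟨t, h5, h6, (h4 y t h5 h6).2 h7⟩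
    · rintro ⟨t, h5, h6, h7⟩
      exact ⟨⟨t, h5, h6⟩, (h4 y t h5 h6).1 h7⟩
  have h3 : SA fun y => ∃ s ∈ S, B (pcons (s.1 y) y) ∨
      ∃ r ∈ R, ∃ t, s.2 y t ∧ IsPow N (r * (t - s.1 y)) ∧ B (pcons t y) :=
    SA.exists_finite hS fun s hs => ((hS1 s hs).good.subst hB).or (SA.exists_finset R (h2 s hs))
  refine h3.congr fun y => ?_
  constructor
  · rintro ⟨s, -, h4 | ⟨r, -, t, -, -, h4⟩⟩
    · exact ⟨_, h4⟩
    · exact ⟨_, h4⟩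
  · rintro ⟨t, ht⟩
    obtain ⟨s, hs, hst⟩ := hS2 y t trivial
    refine ⟨s, hs, ?_⟩
    by_cases h0 : t - s.1 y = 0
    · left
      rwa [← sub_eq_zero.1 h0]
    · obtain ⟨r, hr, h4⟩ := hR _ h0
      exact Or.inr ⟨r, hr, t, hst, h4, ht⟩

/-! ### Definable sets are semialgebraic -/

lemma Good.term_realize {A : Set ℚ_[p]} {α : Type*} (τ : (Language.ring[[A]]).Term α)
    (g : α → ℕ) : Good fun y : ℕ → ℚ_[p] => τ.realize fun i => y (g i) := by
  induction τ with
  | var i => exact Good.coord (g i)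
  | @func l F ts ih =>
    cases F with
    | inl F =>
      cases F with
      | add => exact (ih 0).add (ih 1)
      | mul => exact (ih 0).mul (ih 1)
      | neg => exact (ih 0).neg
      | zero => exact Good.const 0
      | one => exact Good.const 1
    | inr F =>
      cases l with
      | zero => exact Good.const (F : A).1
      | succ l => cases l <;> exact F.elim

lemma SA.boundedFormula_realize {A : Set ℚ_[p]} {α : Type*} {n : ℕ}
    (φ : (Language.ring[[A]]).BoundedFormula α n) (g : α → ℕ) (h : Fin n → ℕ) :
    SA fun y : ℕ → ℚ_[p] => φ.Realize (fun i => y (g i)) (fun i => y (h i)) := by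
  induction φ generalizing g with
  | falsum => exact SA.const False
  | equal t₁ t₂ =>
    refine (((Good.term_realize t₁ (Sum.elim g h)).sub
      (Good.term_realize t₂ (Sum.elim g h))).sa_eq_zero).congr fun y => ?_
    have : (fun i => y (Sum.elim g h i)) = Sum.elim (fun i => y (g i)) fun i => y (h i) := by
      funext i
      cases i <;> rfl
    rw [sub_eq_zero, this]
    rfl
  | rel R ts =>
    cases R with
    | inl R => exact R.elim
    | inr R => exact R.elim
  | imp _ _ ih ih' =>
    refine ((ih g h).not.or (ih' g h)).congr fun y => ?_
    rw [FirstOrder.Language.BoundedFormula.realize_imp]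
    tauto
  | all φ ih =>
    have h1 := (ih (fun i => g i + 1) (Fin.snoc (fun i => h i + 1) 0)).not.exists.not
    refine h1.congr fun y => ?_
    rw [FirstOrder.Language.BoundedFormula.realize_all]
    push Not
    refine forall_congr' fun t => iff_of_eq ?_
    congr 1
    funext i
    refine Fin.lastCases ?_ (fun i => ?_) i <;> simp

lemma SA.of_definable {A : Set ℚ_[p]} {α : Type*} {s : Set (α → ℚ_[p])}
    (hs : A.Definable Language.ring s) (g : α → ℕ) :
    SA fun y : ℕ → ℚ_[p] => (fun i => y (g i)) ∈ s := by
  obtain ⟨φ, rfl⟩ := hs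
  refine (SA.boundedFormula_realize φ g Fin.elim0).congr fun y => ?_
  simp only [Set.mem_ofPred_eq, FirstOrder.Language.Formula.Realize]
  exact iff_of_eq (congrArg _ (Subsingleton.elim _ _))

/-! ### Asymptotics at zero of semialgebraic functions of one variable -/

lemma eventually_near {a : ℚ_[p]} (ha : a ≠ 0) (e : ℕ) : ∀ᶠ z in 𝓝 a, Near e z a := by
  have h : 0 < ‖(p : ℚ_[p]) ^ e * a‖ :=
    norm_pos_iff.2 (mul_ne_zero (pow_ne_zero _ p_ne_zero) ha)
  filter_upwards [Metric.ball_mem_nhds a h] with z hz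
  rw [Metric.mem_ball, dist_eq_norm] at hz
  exact hz.le

lemma exists_eventually_near_monomial (P : Polynomial ℚ_[p]) : ∃ (c : ℚ_[p]) (k : ℕ),
    ∀ e, 1 ≤ e → ∀ᶠ x in 𝓝 0, Near e (P.eval x) (c * x ^ k) := by
  by_cases hP : P = 0
  · exact ⟨0, 0, fun e _ => Eventually.of_forall fun x => by simpa [hP] using Near.refl e 0⟩
  obtain ⟨q, hq, hq0⟩ := Polynomial.exists_eq_pow_rootMultiplicity_mul_and_not_dvd P hP 0
  have h0 : q.eval 0 ≠ 0 := fun h => hq0 (Polynomial.dvd_iff_isRoot.2 h)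
  refine ⟨q.eval 0, P.rootMultiplicity 0, fun e he => ?_⟩
  filter_upwards [(q.continuous.tendsto 0).eventually (eventually_near h0 e)] with x hx
  have h1 := hx.mul_left (x ^ P.rootMultiplicity 0) he
  rw [mul_comm _ (q.eval 0)] at h1
  convert h1 using 1
  conv_lhs => rw [hq]
  simp

lemma SA.eventually_const {B : (ℕ → ℚ_[p]) → Prop} (hB : SA B) (y : ℕ → ℚ_[p]) :
    ∃ m, 0 < m ∧ ∃ c : Prop, ∀ᶠ x in 𝓝 0, IsPow m x → (B (pcons x y) ↔ c) := by
  induction hB with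
  | basic Q n hn =>
    obtain ⟨d, P, -, hP⟩ := exists_goodPoly Q
    obtain ⟨c, k, h⟩ := exists_eventually_near_monomial (P y)
    obtain ⟨e, he, hpow⟩ := exists_isPow_congr (p := p) n hn
    refine ⟨n, hn, IsPow n c, ?_⟩
    filter_upwards [h e he] with x hx hxn
    rw [← hP, hpow e le_rfl _ _ hx, mul_comm, isPow_mul_iff (hxn.pow k)]
  | not _ ih =>
    obtain ⟨m, hm, c, h⟩ := ih
    exact ⟨m, hm, ¬ c, h.mono fun x hx hxm => not_congr (hx hxm)⟩
  | and _ _ ih ih' =>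
    obtain ⟨m, hm, c, h⟩ := ih
    obtain ⟨m', hm', c', h'⟩ := ih'
    refine ⟨m * m', by positivity, c ∧ c', ?_⟩
    filter_upwards [h, h'] with x hx hx' hxm
    exact and_congr (hx (hxm.of_dvd (dvd_mul_right _ _))) (hx' (hxm.of_dvd (dvd_mul_left _ _)))

lemma exists_norm_monomial_eq {P : Polynomial ℚ_[p]} (hP : P ≠ 0) {t : ℚ_[p]} (ht : t ≠ 0)
    (h : P.eval t = 0) : ∃ i j, i < j ∧ j ≤ P.natDegree ∧ P.coeff i ≠ 0 ∧ P.coeff j ≠ 0 ∧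
      ‖P.coeff i * t ^ i‖ = ‖P.coeff j * t ^ j‖ := by
  classical
  obtain ⟨i, hi, hmax⟩ := P.support.exists_max_image (fun i => ‖P.coeff i * t ^ i‖)
    (Polynomial.support_nonempty.2 hP)
  have hi0 := Polynomial.mem_support_iff.1 hi
  rw [Polynomial.eval_eq_sum, Polynomial.sum, ← Finset.add_sum_erase _ _ hi] at h
  have hne : (P.support.erase i).Nonempty := by
    by_contra hempty
    rw [Finset.not_nonempty_iff_eq_empty.1 hempty, Finset.sum_empty, add_zero] at h
    exact mul_ne_zero hi0 (pow_ne_zero i ht) h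
  obtain ⟨j, hj, hle⟩ := IsUltrametricDist.exists_norm_finsetSum_le_of_nonempty hne
    fun i => P.coeff i * t ^ i
  rw [← norm_neg, ← eq_neg_of_add_eq_zero_left h] at hle
  obtain ⟨hji, hj⟩ := Finset.mem_erase.1 hj
  have heq := le_antisymm hle (hmax j hj)
  have hj0 := Polynomial.mem_support_iff.1 hj
  rcases lt_or_gt_of_ne hji with hlt | hlt
  · exact ⟨j, i, hlt, Polynomial.le_natDegree_of_ne_zero hi0, hj0, hi0, heq.symm⟩
  · exact ⟨i, j, hlt, Polynomial.le_natDegree_of_ne_zero hj0, hi0, hj0, heq⟩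

/-- A relation `‖c x ^ k t ^ b‖ = ‖c' x ^ k'‖` between `x` and `t`. -/
structure MonomialRel (p : ℕ) [Fact p.Prime] where
  c : ℚ_[p]
  c' : ℚ_[p]
  k : ℕ
  k' : ℕ
  b : ℕ
  c_ne_zero : c ≠ 0
  c'_ne_zero : c' ≠ 0
  b_pos : 0 < b

/-- `x` and `t` satisfy the relation `τ`. -/
def MonomialRel.Holds (τ : MonomialRel p) (x t : ℚ_[p]) : Prop :=
  ‖τ.c * x ^ τ.k * t ^ τ.b‖ = ‖τ.c' * x ^ τ.k'‖

lemma exists_monomialRel_of_root (Q : MvPolynomial ℕ ℚ_[p]) (y : ℕ → ℚ_[p]) :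
    ∃ T : Set (MonomialRel p), T.Finite ∧ ∀ᶠ x in 𝓝 0, x ≠ 0 → ∀ t, t ≠ 0 →
      MvPolynomial.eval (pcons t (pcons x y)) Q = 0 →
      (∃ s, MvPolynomial.eval (pcons s (pcons x y)) Q ≠ 0) → ∃ τ ∈ T, τ.Holds x t := by
  classical
  set P : ℚ_[p] → Polynomial ℚ_[p] :=
    fun x => (splitPoly Q).map (MvPolynomial.eval (pcons x y)) with hP
  have h1 : ∀ i, ∃ (c : ℚ_[p]) (k : ℕ), ∀ᶠ x in 𝓝 0, ‖(P x).coeff i‖ = ‖c * x ^ k‖ := by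
    intro i
    obtain ⟨c, k, h⟩ := exists_eventually_near_monomial
      ((splitPoly ((splitPoly Q).coeff i)).map (MvPolynomial.eval y))
    refine ⟨c, k, (h 1 le_rfl).mono fun x hx => ?_⟩
    rw [← hx.norm_eq le_rfl, eval_splitPoly, hP, Polynomial.coeff_map]
  choose c k hck using h1
  set d := (splitPoly Q).natDegree
  have hT : {τ : MonomialRel p | ∃ i ∈ Finset.range (d + 1), ∃ j ∈ Finset.range (d + 1),
      τ.c = c j ∧ τ.c' = c i ∧ τ.k = k j ∧ τ.k' = k i ∧ τ.b = j - i}.Finite := by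
    refine Set.Finite.subset
      (((Finset.range (d + 1)) ×ˢ (Finset.range (d + 1))).finite_toSet.biUnion
      (t := fun ij => {τ : MonomialRel p | τ.c = c ij.2 ∧ τ.c' = c ij.1 ∧ τ.k = k ij.2 ∧
        τ.k' = k ij.1 ∧ τ.b = ij.2 - ij.1}) fun ij _ => Set.Subsingleton.finite ?_) ?_
    · rintro ⟨⟩ ⟨h1, h2, h3, h4, h5⟩ ⟨⟩ ⟨h1', h2', h3', h4', h5'⟩
      simp_all
    · rintro τ ⟨i, hi, j, hj, h⟩
      simp only [Set.mem_iUnion]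
      exact ⟨(i, j), Finset.mem_coe.2 (Finset.mem_product.2 ⟨hi, hj⟩), h⟩
  refine ⟨_, hT, ?_⟩
  have h2 := (Filter.eventually_all_finset (Finset.range (d + 1))).2 fun i _ => hck i
  filter_upwards [h2] with x hx hx0 t ht hroot hne
  rw [← eval_splitPoly] at hroot
  obtain ⟨s, hs⟩ := hne
  have hP0 : P x ≠ 0 := by
    intro h0
    rw [← eval_splitPoly] at hs
    refine hs ?_
    change (P x).eval s = 0
    rw [h0, Polynomial.eval_zero]
  obtain ⟨i, j, hij, hj, hi0, hj0, h⟩ := exists_norm_monomial_eq hP0 ht hroot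
  have hjd : j ∈ Finset.range (d + 1) :=
    Finset.mem_range.2 (Nat.lt_succ_of_le (hj.trans Polynomial.natDegree_map_le))
  have hid : i ∈ Finset.range (d + 1) :=
    Finset.mem_range.2 (hij.trans (Finset.mem_range.1 hjd))
  have hc : ∀ i ∈ Finset.range (d + 1), (P x).coeff i ≠ 0 → c i ≠ 0 := fun i hi hi0 h0 => by
    have := hx i hi
    rw [h0, zero_mul, norm_zero, norm_eq_zero] at this
    exact hi0 this
  refine ⟨⟨c j, c i, k j, k i, j - i, hc j hjd hj0, hc i hid hi0, by omega⟩,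
    ⟨i, hid, j, hjd, rfl, rfl, rfl, rfl, rfl⟩, ?_⟩
  have ht' : ‖t‖ ^ i ≠ 0 := pow_ne_zero _ (norm_ne_zero_iff.2 ht)
  rw [norm_mul, norm_mul, hx i hid, hx j hjd, norm_pow, norm_pow,
    ← Nat.sub_add_cancel hij.le, pow_add, ← mul_assoc] at h
  have h3 := mul_right_cancel₀ ht' h
  unfold MonomialRel.Holds
  simp only
  rw [norm_mul, norm_pow, h3, Nat.sub_add_cancel hij.le]

lemma SA.exists_monomialRel {B : (ℕ → ℚ_[p]) → Prop} (hB : SA B) (y : ℕ → ℚ_[p]) :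
    ∃ T : Set (MonomialRel p), T.Finite ∧ ∀ᶠ x in 𝓝 0, x ≠ 0 → ∀ t, t ≠ 0 →
      (¬ ∀ᶠ s in 𝓝 t, (B (pcons s (pcons x y)) ↔ B (pcons t (pcons x y)))) →
      ∃ τ ∈ T, τ.Holds x t := by
  induction hB with
  | basic Q n hn =>
    obtain ⟨T, hT, h⟩ := exists_monomialRel_of_root Q y
    refine ⟨T, hT, h.mono fun x hx hx0 t ht hne => hx hx0 t ht ?_ ?_⟩
    · by_contra h0
      obtain ⟨e, he, hpow⟩ := exists_isPow_congr (p := p) n hn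
      have hcont : Continuous fun s => MvPolynomial.eval (pcons s (pcons x y)) Q := by
        simp only [← eval_splitPoly]
        exact Polynomial.continuous _
      exact hne (((hcont.tendsto t).eventually (eventually_near h0 e)).mono fun s hs =>
        hpow e le_rfl _ _ hs)
    · by_contra! h0
      exact hne (Eventually.of_forall fun s => by dsimp only; rw [h0 s, h0 t])
  | not _ ih =>
    obtain ⟨T, hT, h⟩ := ih
    refine ⟨T, hT, h.mono fun x hx hx0 t ht hne => hx hx0 t ht fun h' => hne ?_⟩
    exact h'.mono fun s hs => not_congr hs
  | and _ _ ih ih' =>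
    obtain ⟨T, hT, h⟩ := ih
    obtain ⟨T', hT', h'⟩ := ih'
    refine ⟨T ∪ T', hT.union hT', ?_⟩
    filter_upwards [h, h'] with x hx hx' hx0 t ht hne
    by_contra! hcon
    have h1 := not_imp_comm.1 (hx hx0 t ht) fun ⟨τ, hτ, h⟩ => hcon τ (Or.inl hτ) h
    have h2 := not_imp_comm.1 (hx' hx0 t ht) fun ⟨τ, hτ, h⟩ => hcon τ (Or.inr hτ) h
    exact hne (h1.mp (h2.mono fun s hs hs' => and_congr hs' hs))

lemma MonomialRel.Holds.valuation {τ : MonomialRel p} {x t : ℚ_[p]} (h : τ.Holds x t)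
    (hx : x ≠ 0) (ht : t ≠ 0) : (τ.b : ℤ) * t.valuation =
      ((τ.k' : ℤ) - τ.k) * x.valuation + (τ.c'.valuation - τ.c.valuation) := by
  have h1 : τ.c * x ^ τ.k ≠ 0 := mul_ne_zero τ.c_ne_zero (pow_ne_zero _ hx)
  have h2 : τ.c * x ^ τ.k * t ^ τ.b ≠ 0 := mul_ne_zero h1 (pow_ne_zero _ ht)
  have h3 : τ.c' * x ^ τ.k' ≠ 0 := mul_ne_zero τ.c'_ne_zero (pow_ne_zero _ hx)
  have h4 := h
  rw [MonomialRel.Holds, norm_eq_zpow _ h2, norm_eq_zpow _ h3] at h4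
  have h5 := zpow_right_injective₀ (norm_pos_iff.2 p_ne_zero) norm_p_lt_one.ne h4
  rw [Padic.valuation_mul h1 (pow_ne_zero _ ht), Padic.valuation_mul τ.c_ne_zero (pow_ne_zero _ hx),
    Padic.valuation_mul τ.c'_ne_zero (pow_ne_zero _ hx), Padic.valuation_pow,
    Padic.valuation_pow, Padic.valuation_pow] at h5
  linarith

lemma exists_isPow_of_eventually {m : ℕ} (hm : 0 < m) {P : ℚ_[p] → Prop}
    (h : ∀ᶠ x in 𝓝 0, P x) : ∃ z : ℚ_[p], z ≠ 0 ∧ P (z ^ m) := by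
  have h1 : Tendsto (fun N : ℕ => ((p : ℚ_[p]) ^ N) ^ m) atTop (𝓝 0) := by
    have := (tendsto_pow_atTop_nhds_zero_of_norm_lt_one (norm_p_lt_one (p := p))).pow m
    rwa [zero_pow hm.ne'] at this
  obtain ⟨N, hN⟩ := (h1.eventually h).exists
  exact ⟨_, pow_ne_zero N p_ne_zero, hN⟩

lemma exists_le_valuation_of_eventually {P : ℚ_[p] → Prop} (h : ∀ᶠ x in 𝓝 0, P x) :
    ∃ δ : ℕ, ∀ x, x ≠ 0 → (δ : ℤ) ≤ x.valuation → P x := by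
  obtain ⟨r, hr, hP⟩ := Metric.eventually_nhds_iff.1 h
  obtain ⟨δ, hδ⟩ := exists_pow_norm_lt (p := p) hr
  refine ⟨δ, fun x hx hv => hP ?_⟩
  rw [dist_zero_right, norm_eq_zpow x hx]
  refine lt_of_le_of_lt ?_ hδ
  rw [norm_pow, ← zpow_natCast]
  exact zpow_le_zpow_right_of_le_one₀ (norm_pos_iff.2 p_ne_zero) norm_p_lt_one.le hv

end PadicQE

open PadicQE

/-- **Asymptotic valuation of a definable function.**
Let `f : ℚ_p → ℚ_p` be definable and nonvanishing on
`D = {x ≠ 0 : v(x) ≥ ε, x ∈ P_n}`.  Then there are `δ ≥ ε`, a positive multiple `m` of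
`n`, and integers `a`, `b ≥ 1`, `γ₀` such that `v(f x) = (a/b)·v(x) + γ₀` (cleared of
denominators: `b·v(f x) = a·v(x) + b·γ₀`) for all `x ≠ 0` with `v(x) ≥ δ` and
`x ∈ P_m`. -/
theorem stmt15 (p : ℕ) [Fact p.Prime] (n : ℕ) (hn : 1 ≤ n) (ε : ℤ)
    (f : ℚ_[p] → ℚ_[p])
    (hfdef : Set.Definable (Set.univ : Set ℚ_[p]) FirstOrder.Language.ring
      {v : Fin 2 → ℚ_[p] | f (v 0) = v 1})
    (hD : ∀ x : ℚ_[p], x ≠ 0 → ε ≤ x.valuation → (∃ y : ℚ_[p], y ^ n = x) → f x ≠ 0) :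
    ∃ δ : ℤ, ε ≤ δ ∧ ∃ m : ℕ, 0 < m ∧ n ∣ m ∧
      ∃ a b γ₀ : ℤ, 1 ≤ b ∧
        ∀ x : ℚ_[p], x ≠ 0 → δ ≤ x.valuation → (∃ y : ℚ_[p], y ^ m = x) →
          b * (f x).valuation = a * x.valuation + b * γ₀ := by
  have hB : SA fun y : ℕ → ℚ_[p] => f (y 1) = y 0 := SA.of_definable hfdef ![1, 0]
  obtain ⟨T, hT, hroot⟩ := hB.exists_monomialRel 0
  have hE : ∀ τ : MonomialRel p, ∃ m, 0 < m ∧ ∃ c : Prop, ∀ᶠ x in 𝓝 0,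
      IsPow m x → (τ.Holds x (f x) ↔ c) := by
    intro τ
    have h1 := ((((Good.const τ.c).mul ((Good.coord 1).pow τ.k)).mul
      ((Good.coord 0).pow τ.b)).sa_norm_eq ((Good.const τ.c').mul ((Good.coord 1).pow τ.k')))
    obtain ⟨m, hm, c, h⟩ := (hB.and h1).exists.eventually_const 0
    refine ⟨m, hm, c, h.mono fun x hx hxm => (Iff.trans ?_ (hx hxm))⟩
    simp [MonomialRel.Holds]
  choose M hM C hC using hE
  set m := n * ∏ τ ∈ hT.toFinset, (M τ * τ.b) with hm
  have hm0 : 0 < m := Nat.mul_pos hn (Finset.prod_pos fun τ _ => Nat.mul_pos (hM τ) τ.b_pos)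
  have hdvd : ∀ τ ∈ T, M τ * τ.b ∣ m := fun τ hτ =>
    (Finset.dvd_prod_of_mem (fun τ => M τ * τ.b) (hT.mem_toFinset.2 hτ)).trans (dvd_mul_left _ _)
  have hlarge : ∀ᶠ x : ℚ_[p] in 𝓝 0, x ≠ 0 → ε ≤ x.valuation := by
    have h1 : 0 < ‖(p : ℚ_[p]) ^ ε‖ := norm_pos_iff.2 (zpow_ne_zero _ p_ne_zero)
    filter_upwards [Metric.ball_mem_nhds 0 h1] with x hx hx0
    rw [mem_ball_zero_iff, norm_eq_zpow x hx0, norm_zpow, zpow_lt_zpow_iff_right_of_lt_one₀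
      (norm_pos_iff.2 p_ne_zero) norm_p_lt_one] at hx
    exact hx.le
  have hev : ∀ᶠ x in 𝓝 0, IsPow m x → f x ≠ 0 ∧ (∃ τ ∈ T, τ.Holds x (f x)) ∧
      ∀ τ ∈ T, (τ.Holds x (f x) ↔ C τ) := by
    filter_upwards [hroot, hlarge, (Filter.eventually_all_finite hT).2 fun τ _ => hC τ]
      with x hx hxε hxC hxm
    have hfx := hD x hxm.1 (hxε hxm.1) (hxm.of_dvd (dvd_mul_right _ _)).2
    refine ⟨hfx, hx hxm.1 _ hfx fun h => ?_, fun τ hτ =>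
      hxC τ hτ (hxm.of_dvd ((dvd_mul_right _ _).trans (hdvd τ hτ)))⟩
    change ∀ᶠ s in 𝓝 (f x), (f x = s ↔ f x = f x) at h
    obtain ⟨s, hs, hs'⟩ := ((h.filter_mono nhdsWithin_le_nhds).and
      (self_mem_nhdsWithin (a := f x) (s := {f x}ᶜ))).exists
    exact hs' (hs.2 rfl).symm
  obtain ⟨z, hz, hz'⟩ := exists_isPow_of_eventually hm0 hev
  obtain ⟨hf0, ⟨τ, hτ, hτz⟩, hzC⟩ := hz' (isPow_pow hz m)
  have hCτ := (hzC τ hτ).1 hτz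
  obtain ⟨δ, hδ⟩ := exists_le_valuation_of_eventually hev
  obtain ⟨q, hq⟩ : (τ.b : ℤ) ∣ τ.c'.valuation - τ.c.valuation := by
    have h1 := hτz.valuation (pow_ne_zero m hz) hf0
    have h2 : (τ.b : ℤ) ∣ (z ^ m).valuation := by
      rw [Padic.valuation_pow]
      exact (Int.natCast_dvd_natCast.2 ((dvd_mul_left _ _).trans (hdvd τ hτ))).mul_right _
    exact (Int.dvd_add_right (h2.mul_left _)).1 ⟨_, h1.symm⟩
  refine ⟨max ε δ, le_max_left _ _, m, hm0, dvd_mul_right _ _, (τ.k' : ℤ) - τ.k, τ.b, q,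
    by exact_mod_cast τ.b_pos, fun x hx hv hxm => ?_⟩
  obtain ⟨hfx, -, hxC⟩ := hδ x hx ((le_max_right _ _).trans hv) ⟨hx, hxm⟩
  rw [((hxC τ hτ).2 hCτ).valuation hx hfx, hq]
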